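/- Let g be the finite-dimensional simple Lie algebra of type F₄ over ℂ, and let (h,e,f) be an sl₂-triple in g. Then e lies in the derived subalgebra [g_e,g_e] of the centralizer g_e of e if and only if the Lie subalgebra of g generated by g(1)_e contains g(k)_e for every integer k ≥ 1. -/

import Mathlib

/-- The centralizer `g_e` of `e`, i.e. the kernel of `ad e`. -/
noncomputable def centralizer (e : LieAlgebra.f₄ ℂ) : Submodule ℂ (LieAlgebra.f₄ ℂ) :=
  LinearMap.ker (LieAlgebra.ad ℂ (LieAlgebra.f₄ ℂ) e)

/-- The derived subalgebra `[g_e, g_e]` of the centralizer, as the linear span of all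
brackets of pairs of elements of `g_e`. -/
noncomputable def derived (e : LieAlgebra.f₄ ℂ) : Submodule ℂ (LieAlgebra.f₄ ℂ) :=
  Submodule.span ℂ
    {z : LieAlgebra.f₄ ℂ | ∃ x ∈ centralizer e, ∃ y ∈ centralizer e, ⁅x, y⁆ = z}

/-! ### Chevalley generators of type `F₄` -/

/-- The defining relations of the Lie algebra of type `F₄`, for a generating family. -/
structure IsChevalley {L : Type*} [LieRing L] [LieAlgebra ℂ L] (h e f : Fin 4 → L) : Prop where
  hh : ∀ i j, ⁅h i, h j⁆ = 0
  ef_same : ∀ i, ⁅e i, f i⁆ = h i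
  ef_ne : ∀ i j, i ≠ j → ⁅e i, f j⁆ = 0
  he : ∀ i j, ⁅h i, e j⁆ = (CartanMatrix.F₄ i j : ℂ) • e j
  hf : ∀ i j, ⁅h i, f j⁆ = -((CartanMatrix.F₄ i j : ℂ) • f j)
  ade : ∀ i j, ((LieAlgebra.ad ℂ L (e i)) ^ (-CartanMatrix.F₄ i j).toNat) ⁅e i, e j⁆ = 0
  adf : ∀ i j, ((LieAlgebra.ad ℂ L (f i)) ^ (-CartanMatrix.F₄ i j).toNat) ⁅f i, f j⁆ = 0
  gen : LieSubalgebra.lieSpan ℂ L (Set.range h ∪ Set.range e ∪ Set.range f) = ⊤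

namespace FreeLieAlgebra

theorem lieSpan_range_of (R X : Type*) [CommRing R] :
    LieSubalgebra.lieSpan R (FreeLieAlgebra R X) (Set.range (FreeLieAlgebra.of R)) = ⊤ := by
  set K := LieSubalgebra.lieSpan R (FreeLieAlgebra R X) (Set.range (FreeLieAlgebra.of R))
  let φ : FreeLieAlgebra R X →ₗ⁅R⁆ K :=
    FreeLieAlgebra.lift R fun x => ⟨of R x, LieSubalgebra.subset_lieSpan ⟨x, rfl⟩⟩
  have hφ : K.incl.comp φ = LieHom.id := by
    ext x
    simp [φ]
  rw [eq_top_iff]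
  intro y _
  have := LieHom.congr_fun hφ y
  rw [LieHom.comp_apply] at this
  rw [← LieHom.id_apply (R := R) y, ← this]
  exact (φ y).2

end FreeLieAlgebra

theorem exists_isChevalley_quotient :
    ∃ h e f : Fin 4 → FreeLieAlgebra ℂ (CartanMatrix.Generators (Fin 4)) ⧸
      CartanMatrix.Relations.toIdeal ℂ CartanMatrix.F₄, IsChevalley h e f := by
  let I := CartanMatrix.Relations.toIdeal ℂ CartanMatrix.F₄
  let π : FreeLieAlgebra ℂ (CartanMatrix.Generators (Fin 4)) →ₗ⁅ℂ⁆
      FreeLieAlgebra ℂ (CartanMatrix.Generators (Fin 4)) ⧸ I :=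
    { (LieSubmodule.Quotient.mk' I : FreeLieAlgebra ℂ (CartanMatrix.Generators (Fin 4)) →ₗ[ℂ]
        FreeLieAlgebra ℂ (CartanMatrix.Generators (Fin 4)) ⧸ I) with
      map_lie' := fun {x y} => LieSubmodule.Quotient.mk_bracket I x y }
  let H : Fin 4 → FreeLieAlgebra ℂ (CartanMatrix.Generators (Fin 4)) :=
    fun i => FreeLieAlgebra.of ℂ (.H i)
  let E : Fin 4 → FreeLieAlgebra ℂ (CartanMatrix.Generators (Fin 4)) :=
    fun i => FreeLieAlgebra.of ℂ (.E i)
  let F : Fin 4 → FreeLieAlgebra ℂ (CartanMatrix.Generators (Fin 4)) :=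
    fun i => FreeLieAlgebra.of ℂ (.F i)
  have hπ : ∀ x ∈ CartanMatrix.Relations.toSet ℂ CartanMatrix.F₄, π x = 0 := fun x hx =>
    (LieSubmodule.Quotient.mk_eq_zero' (N := I)).2 (LieSubmodule.subset_lieSpan hx)
  have hsurj : Function.Surjective π := LieSubmodule.Quotient.surjective_mk' I
  have hpow : ∀ (x y : FreeLieAlgebra ℂ (CartanMatrix.Generators (Fin 4))) (n : ℕ),
      π ((LieAlgebra.ad ℂ _ x ^ n) y) = (LieAlgebra.ad ℂ _ (π x) ^ n) (π y) := by
    intro x y n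
    induction n with
    | zero => simp
    | succ n ih => rw [pow_succ', pow_succ', Module.End.mul_apply, Module.End.mul_apply, ← ih,
        LieAlgebra.ad_apply, LieAlgebra.ad_apply, LieHom.map_lie]
  refine ⟨fun i => π (H i), fun i => π (E i), fun i => π (F i), ?_⟩
  constructor
  · intro i j
    have := hπ ⁅H i, H j⁆ (by
      simp only [CartanMatrix.Relations.toSet, Set.mem_union]
      exact Or.inl (Or.inl (Or.inl (Or.inl (Or.inl ⟨(i, j), rfl⟩)))))
    rwa [LieHom.map_lie] at this
  · intro i
    have := hπ (⁅E i, F i⁆ - H i) (by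
      simp only [CartanMatrix.Relations.toSet, Set.mem_union]
      exact Or.inl (Or.inl (Or.inl (Or.inl (Or.inr ⟨(i, i), by
        simp [CartanMatrix.Relations.EF, H, E, F]⟩)))))
    rwa [map_sub, LieHom.map_lie, sub_eq_zero] at this
  · intro i j hij
    have := hπ (⁅E i, F j⁆) (by
      simp only [CartanMatrix.Relations.toSet, Set.mem_union]
      exact Or.inl (Or.inl (Or.inl (Or.inl (Or.inr ⟨(i, j), by
        simp [CartanMatrix.Relations.EF, hij, E, F]⟩)))))
    rwa [LieHom.map_lie] at this
  · intro i j
    have := hπ (⁅H i, E j⁆ - CartanMatrix.F₄ i j • E j) (by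
      simp only [CartanMatrix.Relations.toSet, Set.mem_union]
      exact Or.inl (Or.inl (Or.inl (Or.inr ⟨(i, j), rfl⟩))))
    rwa [map_sub, LieHom.map_lie, map_zsmul, sub_eq_zero, ← Int.cast_smul_eq_zsmul ℂ] at this
  · intro i j
    have := hπ (⁅H i, F j⁆ + CartanMatrix.F₄ i j • F j) (by
      simp only [CartanMatrix.Relations.toSet, Set.mem_union]
      exact Or.inl (Or.inl (Or.inr ⟨(i, j), rfl⟩)))
    rwa [map_add, LieHom.map_lie, map_zsmul, ← eq_neg_iff_add_eq_zero,
      ← Int.cast_smul_eq_zsmul ℂ] at this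
  · intro i j
    have := hπ ((LieAlgebra.ad ℂ _ (E i) ^ (-CartanMatrix.F₄ i j).toNat)
      ⁅E i, E j⁆) (by
      simp only [CartanMatrix.Relations.toSet, Set.mem_union]
      exact Or.inl (Or.inr ⟨(i, j), rfl⟩))
    rwa [hpow, LieHom.map_lie] at this
  · intro i j
    have := hπ ((LieAlgebra.ad ℂ _ (F i) ^ (-CartanMatrix.F₄ i j).toNat)
      ⁅F i, F j⁆) (by
      simp only [CartanMatrix.Relations.toSet, Set.mem_union]
      exact Or.inr ⟨(i, j), rfl⟩)
    rwa [hpow, LieHom.map_lie] at this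
  · rw [eq_top_iff]
    intro y _
    obtain ⟨x, rfl⟩ := hsurj y
    have hx : x ∈ LieSubalgebra.comap π (LieSubalgebra.lieSpan ℂ (_ ⧸ I)
        (Set.range (fun i => π (H i)) ∪ Set.range (fun i => π (E i)) ∪
          Set.range (fun i => π (F i)))) := by
      have : x ∈ (⊤ : LieSubalgebra ℂ _) := LieSubalgebra.mem_top x
      rw [← FreeLieAlgebra.lieSpan_range_of] at this
      refine LieSubalgebra.lieSpan_le.2 ?_ this
      rintro _ ⟨g, rfl⟩
      refine LieSubalgebra.subset_lieSpan ?_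
      rcases g with i | i | i
      · exact Or.inl (Or.inl ⟨i, rfl⟩)
      · exact Or.inl (Or.inr ⟨i, rfl⟩)
      · exact Or.inr ⟨i, rfl⟩
    exact hx

theorem exists_isChevalley_f₄ :
    ∃ h e f : Fin 4 → LieAlgebra.f₄ ℂ, IsChevalley h e f :=
  exists_isChevalley_quotient

/-! ### Elementary `sl₂` theory -/

section SlTwo

variable {L : Type*} [LieRing L] [LieAlgebra ℂ L]

theorem lie_weight {h x y : L} {a b : ℂ} (hx : ⁅h, x⁆ = a • x) (hy : ⁅h, y⁆ = b • y) :
    ⁅h, ⁅x, y⁆⁆ = (a + b) • ⁅x, y⁆ := by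
  rw [leibniz_lie, hx, hy, smul_lie, lie_smul, ← add_smul]

theorem ad_pow_succ_apply (x y : L) (n : ℕ) :
    (LieAlgebra.ad ℂ L x ^ (n + 1)) y = ⁅x, (LieAlgebra.ad ℂ L x ^ n) y⁆ := by
  rw [pow_succ', Module.End.mul_apply, LieAlgebra.ad_apply]

theorem ad_pow_weight {h f z : L} {a m : ℂ} (hf : ⁅h, f⁆ = a • f) (hz : ⁅h, z⁆ = m • z) (n : ℕ) :
    ⁅h, (LieAlgebra.ad ℂ L f ^ n) z⁆ = (n * a + m) • (LieAlgebra.ad ℂ L f ^ n) z := by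
  induction n with
  | zero => simpa using hz
  | succ n ih =>
    rw [ad_pow_succ_apply, lie_weight hf ih]
    congr 1
    push_cast
    ring

theorem eq_zero_of_lie_lie_neg {h e f : L} (he : ⁅h, e⁆ = (2 : ℂ) • e) (hef : ⁅e, f⁆ = h)
    (n : ℕ) : ∀ (z : L) (m c : ℤ), 0 ≤ m → 0 < c → ⁅h, z⁆ = (m : ℂ) • z →
      ⁅f, ⁅e, z⁆⁆ = -((c : ℂ) • z) → (LieAlgebra.ad ℂ L e ^ n) z = 0 → z = 0 := by
  induction n with
  | zero => intro z m c _ _ _ _ hz; simpa using hz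
  | succ n ih =>
    intro z m c hm hc hz hfe hn
    have h1 : ⁅e, z⁆ = 0 := by
      refine ih ⁅e, z⁆ (2 + m) (c + (2 + m)) (by lia) (by lia) ?_ ?_ ?_
      · rw [lie_weight he hz]; push_cast; rfl
      · have : ⁅f, ⁅e, ⁅e, z⁆⁆⁆ = ⁅e, ⁅f, ⁅e, z⁆⁆⁆ - ⁅⁅e, f⁆, ⁅e, z⁆⁆ := by
          rw [leibniz_lie e f ⁅e, z⁆]; abel
        rw [this, hfe, hef, lie_weight he hz, lie_neg, lie_smul]
        push_cast
        module
      · rw [pow_succ, Module.End.mul_apply] at hn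
        exact hn
    rw [h1, lie_zero, eq_comm, neg_eq_zero, smul_eq_zero] at hfe
    rcases hfe with h2 | h2
    · exact absurd (by exact_mod_cast h2) hc.ne'
    · exact h2

theorem ad_f_pow_injective {h e f : L} (he : ⁅h, e⁆ = (2 : ℂ) • e) (hf : ⁅h, f⁆ = (-2 : ℂ) • f)
    (hef : ⁅e, f⁆ = h) (hnil : ∀ z, ∃ n, (LieAlgebra.ad ℂ L e ^ n) z = 0) (j : ℕ) :
    ∀ (z : L) (m : ℤ), j ≤ m → ⁅h, z⁆ = (m : ℂ) • z → (LieAlgebra.ad ℂ L f ^ j) z = 0 → z = 0 := by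
  have key : ∀ (z : L) (m : ℂ), ⁅h, z⁆ = m • z → ∀ j : ℕ,
      ⁅e, (LieAlgebra.ad ℂ L f ^ (j + 1)) z⁆ = (LieAlgebra.ad ℂ L f ^ (j + 1)) ⁅e, z⁆ +
        ((j + 1) * (m - j)) • (LieAlgebra.ad ℂ L f ^ j) z := by
    intro z m hz j
    induction j with
    | zero => simp [leibniz_lie e f z, hef, hz, add_comm]
    | succ j ih =>
      rw [ad_pow_succ_apply f z (j + 1), leibniz_lie, ih, hef, ad_pow_weight hf hz, lie_add,
        lie_smul, ← ad_pow_succ_apply, ← ad_pow_succ_apply]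
      push_cast
      module
  induction j with
  | zero => intro z m _ _ hz; simpa using hz
  | succ j ih =>
    intro z m hj hz hfz
    have h1 := key z m hz j
    rw [hfz, lie_zero] at h1
    have h2 : (LieAlgebra.ad ℂ L f ^ j) (⁅f, ⁅e, z⁆⁆ + (((j + 1) * (m - j) : ℤ) : ℂ) • z) = 0 := by
      rw [map_add, map_smul, h1, pow_succ, Module.End.mul_apply, LieAlgebra.ad_apply]
      push_cast
      rfl
    have h3 := ih _ m (by push_cast at hj; lia) (by
      have h4 : ⁅h, ⁅f, ⁅e, z⁆⁆⁆ = (m : ℂ) • ⁅f, ⁅e, z⁆⁆ := by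
        rw [lie_weight hf (lie_weight he hz)]; congr 1; ring
      rw [lie_add, h4, lie_smul, hz, smul_add, smul_comm]) h2
    obtain ⟨n, hn⟩ := hnil z
    refine eq_zero_of_lie_lie_neg he hef n z m ((j + 1) * (m - j)) (by lia) ?_ hz
      (eq_neg_of_add_eq_zero_left h3) hn
    push_cast at hj
    exact mul_pos (by lia) (by lia)

theorem eq_zero_of_lie_e_lie_f {h e f : L} (he : ⁅h, e⁆ = (2 : ℂ) • e)
    (hef : ⁅e, f⁆ = h) (hnil : ∀ z, ∃ n, (LieAlgebra.ad ℂ L e ^ n) z = 0)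
    {z : L} {m : ℤ} (hm : 0 < m) (hz : ⁅h, z⁆ = (m : ℂ) • z) (hefz : ⁅e, ⁅f, z⁆⁆ = 0) : z = 0 := by
  obtain ⟨n, hn⟩ := hnil z
  refine eq_zero_of_lie_lie_neg he hef n z m m hm.le hm hz ?_ hn
  have := leibniz_lie e f z
  rw [hefz, hef, hz] at this
  exact eq_neg_of_add_eq_zero_right this.symm

end SlTwo

/-! ### Weight spaces and the triangular decomposition -/

/-- The pairing of the simple coroot `i` with a vector written in the basis of simple roots. -/
def coroot (i : Fin 4) (v : Fin 4 → ℤ) : ℤ := ∑ j, CartanMatrix.F₄ i j * v j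

theorem coroot_add (i : Fin 4) (v w : Fin 4 → ℤ) : coroot i (v + w) = coroot i v + coroot i w := by
  simp [coroot, mul_add, Finset.sum_add_distrib]

theorem coroot_neg (i : Fin 4) (v : Fin 4 → ℤ) : coroot i (-v) = -coroot i v := by
  simp [coroot]

theorem coroot_zero (i : Fin 4) : coroot i 0 = 0 := by simp [coroot]

theorem coroot_smul (i : Fin 4) (c : ℤ) (v : Fin 4 → ℤ) : coroot i (c • v) = c * coroot i v := by
  simp only [coroot, Pi.smul_apply, smul_eq_mul, Finset.mul_sum]
  exact Finset.sum_congr rfl fun j _ => by ring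

theorem coroot_single (i j : Fin 4) : coroot i (Pi.single j 1) = CartanMatrix.F₄ i j := by
  simp [coroot, Pi.single_apply]

theorem coroot_injective {v w : Fin 4 → ℤ} (hvw : ∀ i, coroot i v = coroot i w) : v = w := by
  have h0 := hvw 0
  have h1 := hvw 1
  have h2 := hvw 2
  have h3 := hvw 3
  simp only [coroot, CartanMatrix.F₄, Fin.sum_univ_four, Matrix.of_apply, Matrix.cons_val] at h0 h1 h2 h3
  ext i
  fin_cases i <;> simp only [Fin.zero_eta, Fin.mk_one, Fin.reduceFinMk] <;> lia

section Words

variable {L : Type*} [LieRing L]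

/-- Iterated brackets of the family `e`, together with their degree. -/
inductive EWord (e : Fin 4 → L) : (Fin 4 → ℤ) → L → Prop
  | base (i : Fin 4) : EWord e (Pi.single i 1) (e i)
  | step (j : Fin 4) {v : Fin 4 → ℤ} {x : L} : EWord e v x → EWord e (Pi.single j 1 + v) ⁅e j, x⁆

theorem EWord.nonneg {e : Fin 4 → L} {v : Fin 4 → ℤ} {x : L} (hx : EWord e v x) :
    0 ≤ v ∧ v ≠ 0 := by
  induction hx with
  | base i => exact ⟨Pi.single_nonneg.2 zero_le_one, by simp⟩
  | @step j v x _ ih =>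
    refine ⟨add_nonneg (Pi.single_nonneg.2 zero_le_one) ih.1, fun h => ?_⟩
    have h1 := congrFun h j
    have h2 := ih.1 j
    simp at h1 h2
    lia

theorem EWord.eq_of_single {e : Fin 4 → L} {v : Fin 4 → ℤ} {x : L} (hx : EWord e v x) (i : Fin 4)
    (hv : ∀ j, j ≠ i → v j = 0) : (v = Pi.single i 1 ∧ x = e i) ∨ x = 0 := by
  induction hx with
  | base k =>
    by_cases hk : k = i
    · subst hk; exact Or.inl ⟨rfl, rfl⟩
    · have := hv k hk
      simp at this
  | @step j v x hw ih =>
    have hj : j = i := by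
      by_contra hj
      have h1 := hv j hj
      have h2 := hw.nonneg.1 j
      simp at h1 h2
      lia
    subst hj
    have := ih fun k hk => by
      have := hv k hk
      simpa [hk] using this
    rcases this with ⟨-, rfl⟩ | rfl <;> simp

end Words

section Weights

variable {L : Type*} [LieRing L] [LieAlgebra ℂ L]

/-- The simultaneous eigenspace of the family `h` with eigenvalues prescribed by `v`. -/
def wtSpace (h : Fin 4 → L) (v : Fin 4 → ℤ) : Submodule ℂ L where
  carrier := {x | ∀ i, ⁅h i, x⁆ = (coroot i v : ℂ) • x}
  add_mem' := fun ha hb i => by rw [lie_add, ha i, hb i, smul_add]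
  zero_mem' := fun i => by simp
  smul_mem' := fun c x hx i => by rw [lie_smul, hx i, smul_comm]

theorem mem_wtSpace {h : Fin 4 → L} {v : Fin 4 → ℤ} {x : L} :
    x ∈ wtSpace h v ↔ ∀ i, ⁅h i, x⁆ = (coroot i v : ℂ) • x := Iff.rfl

theorem lie_mem_wtSpace {h : Fin 4 → L} {v w : Fin 4 → ℤ} {x y : L} (hx : x ∈ wtSpace h v)
    (hy : y ∈ wtSpace h w) : ⁅x, y⁆ ∈ wtSpace h (v + w) := fun i => by
  rw [lie_weight (hx i) (hy i), coroot_add, Int.cast_add]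

theorem wtSpace_neg (h : Fin 4 → L) (v : Fin 4 → ℤ) : wtSpace (-h) v = wtSpace h (-v) := by
  ext x
  simp only [mem_wtSpace, Pi.neg_apply, neg_lie, coroot_neg, Int.cast_neg, neg_smul, neg_eq_iff_eq_neg]

namespace IsChevalley

variable {h e f : Fin 4 → L}

theorem swap (H : IsChevalley h e f) : IsChevalley (-h) f e where
  hh i j := by simp [H.hh]
  ef_same i := by rw [← lie_skew, H.ef_same]; rfl
  ef_ne i j hij := by rw [← lie_skew, H.ef_ne j i hij.symm, neg_zero]
  he i j := by simp [H.hf]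
  hf i j := by simp [H.he]
  ade := H.adf
  adf := H.ade
  gen := by
    rw [eq_top_iff, ← H.gen, LieSubalgebra.lieSpan_le]
    rintro _ ((⟨i, rfl⟩ | ⟨i, rfl⟩) | ⟨i, rfl⟩)
    · rw [SetLike.mem_coe, ← neg_mem_iff]
      exact LieSubalgebra.subset_lieSpan (Or.inl (Or.inl ⟨i, rfl⟩))
    · exact LieSubalgebra.subset_lieSpan (Or.inr ⟨i, rfl⟩)
    · exact LieSubalgebra.subset_lieSpan (Or.inl (Or.inr ⟨i, rfl⟩))

theorem e_mem (H : IsChevalley h e f) (i : Fin 4) : e i ∈ wtSpace h (Pi.single i 1) := fun j => by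
  rw [H.he, coroot_single]

theorem f_mem (H : IsChevalley h e f) (i : Fin 4) : f i ∈ wtSpace h (-Pi.single i 1) := fun j => by
  rw [H.hf, coroot_neg, coroot_single, Int.cast_neg, neg_smul]

theorem h_mem (H : IsChevalley h e f) (i : Fin 4) : h i ∈ wtSpace h 0 := fun j => by
  rw [H.hh, coroot_zero, Int.cast_zero, zero_smul]

theorem eWord_mem (H : IsChevalley h e f) {v : Fin 4 → ℤ} {x : L} (hx : EWord e v x) :
    x ∈ wtSpace h v := by
  induction hx with
  | base i => exact H.e_mem i
  | step j _ ih => exact lie_mem_wtSpace (H.e_mem j) ih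

theorem fWord_mem (H : IsChevalley h e f) {v : Fin 4 → ℤ} {x : L} (hx : EWord f v x) :
    x ∈ wtSpace h (-v) := by
  rw [← wtSpace_neg]
  exact H.swap.eWord_mem hx

/-- The span of the iterated brackets of the `f i`. -/
def lower (f : Fin 4 → L) : Submodule ℂ L := Submodule.span ℂ {x | ∃ v, EWord f v x}

theorem lie_lower {j : Fin 4} {x : L} (hx : x ∈ lower f) : ⁅f j, x⁆ ∈ lower f := by
  induction hx using Submodule.span_induction with
  | mem x hx => exact Submodule.subset_span ⟨_, .step j hx.choose_spec⟩
  | zero => simp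
  | add x y _ _ hx hy => rw [lie_add]; exact add_mem hx hy
  | smul c x _ hx => rw [lie_smul]; exact Submodule.smul_mem _ _ hx

theorem e_lie_lower (H : IsChevalley h e f) {j : Fin 4} {v : Fin 4 → ℤ} {x : L}
    (hx : EWord f v x) : ⁅e j, x⁆ ∈ Submodule.span ℂ (Set.range h) ⊔ lower f := by
  have hfl : ∀ i, f i ∈ lower f := fun i => Submodule.subset_span ⟨_, .base i⟩
  induction hx with
  | base i =>
    by_cases hij : j = i
    · rw [hij, H.ef_same]
      exact Submodule.mem_sup_left (Submodule.subset_span ⟨i, rfl⟩)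
    · rw [H.ef_ne j i hij]; exact zero_mem _
  | @step i v x hw ih =>
    rw [leibniz_lie]
    refine add_mem ?_ ?_
    · by_cases hij : j = i
      · rw [hij, H.ef_same, H.fWord_mem hw i]
        exact Submodule.smul_mem _ _ (Submodule.mem_sup_right (Submodule.subset_span ⟨_, hw⟩))
      · rw [H.ef_ne j i hij, zero_lie]; exact zero_mem _
    · refine Submodule.mem_sup_right ?_
      obtain ⟨y, hy, z, hz, hyz⟩ := Submodule.mem_sup.1 ih
      rw [← hyz, lie_add]
      refine add_mem ?_ (lie_lower hz)
      clear hyz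
      induction hy using Submodule.span_induction with
      | mem y hy =>
        obtain ⟨k, rfl⟩ := hy
        rw [← lie_skew, H.hf, neg_neg]
        exact Submodule.smul_mem _ _ (hfl i)
      | zero => simp
      | add y y' _ _ hy hy' => rw [lie_add]; exact add_mem hy hy'
      | smul c y _ hy => rw [lie_smul]; exact Submodule.smul_mem _ _ hy

/-- The sum of the three parts of the triangular decomposition. -/
def triangular (h e f : Fin 4 → L) : Submodule ℂ L :=
  (Submodule.span ℂ (Set.range h) ⊔ lower f) ⊔ lower e

theorem e_lie_triangular (H : IsChevalley h e f) {j : Fin 4} {x : L} (hx : x ∈ triangular h e f) :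
    ⁅e j, x⁆ ∈ triangular h e f := by
  obtain ⟨u, hu, w, hw, rfl⟩ := Submodule.mem_sup.1 hx
  rw [lie_add]
  refine add_mem ?_ (Submodule.mem_sup_right (lie_lower hw))
  obtain ⟨y, hy, z, hz, hyz⟩ := Submodule.mem_sup.1 hu
  rw [← hyz, lie_add]
  clear hx hu hw hyz
  refine add_mem ?_ (Submodule.mem_sup_left ?_)
  · refine Submodule.mem_sup_right ?_
    induction hy using Submodule.span_induction with
    | mem y hy =>
      obtain ⟨k, rfl⟩ := hy
      rw [← lie_skew, H.he]
      exact neg_mem (Submodule.smul_mem _ _ (Submodule.subset_span ⟨_, .base j⟩))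
    | zero => simp
    | add y y' _ _ hy hy' => rw [lie_add]; exact add_mem hy hy'
    | smul c y _ hy => rw [lie_smul]; exact Submodule.smul_mem _ _ hy
  · induction hz using Submodule.span_induction with
    | mem y hy => exact H.e_lie_lower hy.choose_spec
    | zero => simp
    | add y y' _ _ hy hy' => rw [lie_add]; exact add_mem hy hy'
    | smul c y _ hy => rw [lie_smul]; exact Submodule.smul_mem _ _ hy

theorem triangular_swap : triangular (-h) f e = triangular h e f := by
  have : Submodule.span ℂ (Set.range (-h)) = Submodule.span ℂ (Set.range h) := by
    rw [← Submodule.span_neg (Set.range h)]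
    congr 1
    ext x
    simp [neg_eq_iff_eq_neg]
  rw [triangular, triangular, this, sup_right_comm]

theorem triangular_eq_top (H : IsChevalley h e f) : triangular h e f = ⊤ := by
  have he : ∀ i, ∀ x ∈ triangular h e f, ⁅e i, x⁆ ∈ triangular h e f :=
    fun i x hx => H.e_lie_triangular hx
  have hf : ∀ i, ∀ x ∈ triangular h e f, ⁅f i, x⁆ ∈ triangular h e f := fun i x hx => by
    rw [← triangular_swap] at hx ⊢
    exact H.swap.e_lie_triangular hx
  let K : LieSubalgebra ℂ L :=
    { carrier := {y | ∀ x ∈ triangular h e f, ⁅y, x⁆ ∈ triangular h e f}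
      add_mem' := fun ha hb x hx => by rw [add_lie]; exact add_mem (ha x hx) (hb x hx)
      zero_mem' := fun x _ => by rw [zero_lie]; exact zero_mem _
      smul_mem' := fun c y hy x hx => by rw [smul_lie]; exact Submodule.smul_mem _ _ (hy x hx)
      lie_mem' := fun {a b} ha hb x hx => by
        rw [lie_lie]; exact sub_mem (ha _ (hb x hx)) (hb _ (ha x hx)) }
  have hK : K = ⊤ := by
    rw [eq_top_iff, ← H.gen, LieSubalgebra.lieSpan_le]
    rintro _ ((⟨i, rfl⟩ | ⟨i, rfl⟩) | ⟨i, rfl⟩)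
    · rw [← H.ef_same]
      exact K.lie_mem (he i) (hf i)
    · exact he i
    · exact hf i
  let T : LieSubalgebra ℂ L :=
    { triangular h e f with
      lie_mem' := fun {a b} _ hb => by
        have : a ∈ K := hK ▸ LieSubalgebra.mem_top a
        exact this b hb }
  have hT : T = ⊤ := by
    rw [eq_top_iff, ← H.gen, LieSubalgebra.lieSpan_le]
    rintro _ ((⟨i, rfl⟩ | ⟨i, rfl⟩) | ⟨i, rfl⟩)
    · exact Submodule.mem_sup_left (Submodule.mem_sup_left (Submodule.subset_span ⟨i, rfl⟩))
    · exact Submodule.mem_sup_right (Submodule.subset_span ⟨_, .base i⟩)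
    · exact Submodule.mem_sup_left (Submodule.mem_sup_right (Submodule.subset_span ⟨_, .base i⟩))
  rw [eq_top_iff]
  intro x _
  have : x ∈ T := hT ▸ LieSubalgebra.mem_top x
  exact this

theorem iSupIndep_wtSpace (H : IsChevalley h e f) : iSupIndep (wtSpace h) := by
  have hc : ∀ i j, Commute (LieAlgebra.ad ℂ L (h i)) (LieAlgebra.ad ℂ L (h j)) := fun i j => by
    ext x
    simp [leibniz_lie (h i) (h j) x, H.hh]
  have h1 := Module.End.independent_iInf_maxGenEigenspace_of_forall_mapsTo
    (fun i => LieAlgebra.ad ℂ L (h i)) fun i j c =>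
      Module.End.mapsTo_maxGenEigenspace_of_comm (hc j i) c
  have h2 : Function.Injective fun (v : Fin 4 → ℤ) (i : Fin 4) => (coroot i v : ℂ) := by
    intro v w hvw
    refine coroot_injective fun i => ?_
    exact Int.cast_injective (α := ℂ) (congrFun hvw i)
  refine (h1.comp h2).mono fun v x hx => ?_
  simp only [Function.comp_apply, Submodule.mem_iInf]
  intro i
  exact Module.End.mem_maxGenEigenspace _ _ _ |>.2 ⟨1, by simp [hx i]⟩

theorem wtSpace_le (H : IsChevalley h e f) (v : Fin 4 → ℤ) : wtSpace h v ≤ Submodule.span ℂ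
    {x | EWord e v x ∨ (v = 0 ∧ x ∈ Set.range h) ∨ EWord f (-v) x} := by
  set S : (Fin 4 → ℤ) → Submodule ℂ L := fun v => Submodule.span ℂ
    {x | EWord e v x ∨ (v = 0 ∧ x ∈ Set.range h) ∨ EWord f (-v) x}
  have hS : ∀ v, S v ≤ wtSpace h v := fun v => Submodule.span_le.2 <| by
    rintro x (hx | ⟨rfl, i, rfl⟩ | hx)
    · exact H.eWord_mem hx
    · exact H.h_mem i
    · simpa using H.fWord_mem hx
  have htop : ⨆ v, S v = ⊤ := by
    rw [eq_top_iff, ← H.triangular_eq_top]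
    refine sup_le (sup_le ?_ ?_) ?_ <;> refine Submodule.span_le.2 ?_
    · exact fun x hx => Submodule.mem_iSup_of_mem 0 (Submodule.subset_span (Or.inr (Or.inl ⟨rfl, hx⟩)))
    · rintro x ⟨w, hx⟩
      exact Submodule.mem_iSup_of_mem (-w) (Submodule.subset_span (Or.inr (Or.inr (by simpa using hx))))
    · rintro x ⟨w, hx⟩
      exact Submodule.mem_iSup_of_mem w (Submodule.subset_span (Or.inl hx))
  intro x hx
  have hx' : x ∈ S v ⊔ ⨆ w, ⨆ _ : w ≠ v, S w := by
    rw [show S v ⊔ ⨆ w, ⨆ _ : w ≠ v, S w = ⨆ w, S w from (iSup_split_single S v).symm, htop]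
    trivial
  obtain ⟨y, hy, z, hz, rfl⟩ := Submodule.mem_sup.1 hx'
  have hz' : z ∈ wtSpace h v := by
    have := sub_mem hx (hS v hy)
    simpa using this
  have := Submodule.disjoint_def.1 (H.iSupIndep_wtSpace v) z hz'
    ((iSup₂_mono fun w _ => hS w) hz)
  rw [this, add_zero]
  exact hy

theorem wtSpace_zero (H : IsChevalley h e f) : wtSpace h 0 = Submodule.span ℂ (Set.range h) := by
  refine le_antisymm ((H.wtSpace_le 0).trans (Submodule.span_mono ?_)) ?_
  · rintro x (hx | ⟨-, hx⟩ | hx)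
    · exact absurd rfl hx.nonneg.2
    · exact hx
    · exact absurd neg_zero hx.nonneg.2
  · rw [Submodule.span_le]
    rintro _ ⟨i, rfl⟩
    exact H.h_mem i

theorem wtSpace_eq_bot_of_mixed (H : IsChevalley h e f) {v : Fin 4 → ℤ} (h1 : ¬ 0 ≤ v)
    (h2 : ¬ v ≤ 0) : wtSpace h v = ⊥ := by
  rw [eq_bot_iff]
  refine (H.wtSpace_le v).trans (Submodule.span_le.2 ?_)
  rintro x (hx | ⟨rfl, -⟩ | hx)
  · exact absurd hx.nonneg.1 h1
  · exact absurd le_rfl h1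
  · exact absurd (neg_nonneg.1 hx.nonneg.1) h2

theorem wtSpace_single (H : IsChevalley h e f) {v : Fin 4 → ℤ} (hv : 0 ≤ v) (hv0 : v ≠ 0)
    (i : Fin 4) (hi : ∀ j, j ≠ i → v j = 0) {x : L} (hx : x ∈ wtSpace h v) :
    x = 0 ∨ (v = Pi.single i 1 ∧ x ∈ Submodule.span ℂ {e i}) := by
  by_cases h1 : v = Pi.single i 1
  · refine Or.inr ⟨h1, (H.wtSpace_le v).trans (Submodule.span_le.2 ?_) hx⟩
    rintro x (hx | ⟨rfl, -⟩ | hx)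
    · rcases hx.eq_of_single i hi with ⟨-, rfl⟩ | rfl
      · exact Submodule.mem_span_singleton_self _
      · exact zero_mem _
    · exact absurd rfl hv0
    · exact absurd (le_antisymm (neg_nonneg.1 hx.nonneg.1) hv) hv0
  · refine Or.inl ?_
    rw [← Submodule.mem_bot ℂ]
    refine (H.wtSpace_le v).trans (Submodule.span_le.2 ?_) hx
    rintro x (hx | ⟨rfl, -⟩ | hx)
    · rcases hx.eq_of_single i hi with ⟨h2, -⟩ | rfl
      · exact absurd h2 h1
      · exact zero_mem _
    · exact absurd rfl hv0
    · exact absurd (le_antisymm (neg_nonneg.1 hx.nonneg.1) hv) hv0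

end IsChevalley

end Weights

/-! ### The root system and the dimensions of the weight spaces -/

/-- The positive roots of type `F₄`, in the basis of simple roots. -/
def posRoots : List (Fin 4 → ℤ) :=
  [![1, 0, 0, 0], ![0, 1, 0, 0], ![0, 0, 1, 0], ![0, 0, 0, 1], ![1, 1, 0, 0], ![0, 1, 1, 0],
    ![0, 0, 1, 1], ![1, 1, 1, 0], ![0, 1, 1, 1], ![0, 2, 1, 0], ![1, 1, 1, 1], ![1, 2, 1, 0],
    ![0, 2, 1, 1], ![1, 2, 1, 1], ![2, 2, 1, 0], ![0, 2, 2, 1], ![1, 2, 2, 1], ![2, 2, 1, 1],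
    ![1, 3, 2, 1], ![2, 2, 2, 1], ![2, 3, 2, 1], ![2, 4, 2, 1], ![2, 4, 3, 1], ![2, 4, 3, 2]]

/-- The roots of type `F₄`, in the basis of simple roots. -/
def roots : List (Fin 4 → ℤ) := posRoots ++ posRoots.map Neg.neg

/-- The simple reflections. -/
def reflect (i : Fin 4) (v : Fin 4 → ℤ) : Fin 4 → ℤ := v - coroot i v • Pi.single i 1

theorem reflect_mem_roots : ∀ v ∈ roots, ∀ i, reflect i v ∈ roots := by decide +kernel

theorem neg_mem_roots : ∀ v ∈ roots, -v ∈ roots := by decide +kernel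

theorem nonneg_or_nonpos_of_mem_roots : ∀ v ∈ roots, (∀ i, 0 ≤ v i) ∨ (∀ i, v i ≤ 0) := by
  decide +kernel

theorem single_mem_roots : ∀ i : Fin 4, (Pi.single i 1 : Fin 4 → ℤ) ∈ roots := by decide +kernel

theorem zero_notMem_roots : (0 : Fin 4 → ℤ) ∉ roots := by decide +kernel

theorem roots_induction {P : (Fin 4 → ℤ) → Prop} (hs : ∀ i : Fin 4, P (Pi.single i 1))
    (hr : ∀ i, ∀ v ∈ roots, P v → P (reflect i v)) : ∀ v ∈ roots, P v := by
  have key : ∀ n : ℕ, n ≤ roots.length → ∀ v ∈ roots.take n, P v := by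
    intro n
    induction n with
    | zero => simp
    | succ n ih =>
      intro hn v hv
      rw [List.take_add_one, List.mem_append] at hv
      rcases hv with hv | hv
      · exact ih (by lia) v hv
      · have hchain : ∀ n < roots.length, ∀ v ∈ roots[n]?.toList,
            (∃ i : Fin 4, v = Pi.single i 1) ∨ ∃ w ∈ roots.take n, ∃ i, v = reflect i w := by
          decide +kernel
        rcases hchain n hn v hv with ⟨i, rfl⟩ | ⟨w, hw, i, rfl⟩
        · exact hs i
        · exact hr i w (List.mem_of_mem_take hw) (ih (by lia) w hw)
  intro v hv
  exact key _ le_rfl v (by rwa [List.take_length])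

theorem exists_coroot_pos {v : Fin 4 → ℤ} (hv : 0 ≤ v) (hv0 : v ≠ 0) : ∃ i, 0 < coroot i v := by
  by_contra! hc
  have h0 := mul_nonneg (hv 0) (neg_nonneg.2 (hc 0))
  have h1 := mul_nonneg (hv 1) (neg_nonneg.2 (hc 1))
  have h2 := mul_nonneg (hv 2) (neg_nonneg.2 (hc 2))
  have h3 := mul_nonneg (hv 3) (neg_nonneg.2 (hc 3))
  simp only [coroot, CartanMatrix.F₄, Fin.sum_univ_four, Matrix.of_apply, Matrix.cons_val] at h0 h1 h2 h3
  have key : 6 * (2 * v 3 - v 2) ^ 2 + 2 * (3 * v 2 - 2 * v 1) ^ 2 + 3 * (2 * v 0 - v 1) ^ 2 +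
      v 1 ^ 2 ≤ 0 := by nlinarith
  have k1 : v 1 = 0 := by nlinarith [sq_nonneg (2 * v 3 - v 2), sq_nonneg (3 * v 2 - 2 * v 1), sq_nonneg (2 * v 0 - v 1)]
  have k0 : 2 * v 0 - v 1 = 0 := by nlinarith [sq_nonneg (2 * v 3 - v 2), sq_nonneg (3 * v 2 - 2 * v 1), sq_nonneg (v 1)]
  have k2 : 3 * v 2 - 2 * v 1 = 0 := by nlinarith [sq_nonneg (2 * v 3 - v 2), sq_nonneg (2 * v 0 - v 1), sq_nonneg (v 1)]
  have k3 : 2 * v 3 - v 2 = 0 := by nlinarith [sq_nonneg (3 * v 2 - 2 * v 1), sq_nonneg (2 * v 0 - v 1), sq_nonneg (v 1)]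
  refine hv0 (funext fun i => ?_)
  fin_cases i <;> simp only [Fin.zero_eta, Fin.mk_one, Fin.reduceFinMk, Pi.zero_apply] <;> lia

theorem coroot_self (i : Fin 4) : coroot i (Pi.single i 1) = 2 := by
  rw [coroot_single]; revert i; decide

theorem coroot_reflect (i : Fin 4) (v : Fin 4 → ℤ) : coroot i (reflect i v) = -coroot i v := by
  rw [reflect, sub_eq_add_neg, coroot_add, coroot_neg, coroot_smul, coroot_self]; ring

theorem reflect_reflect (i : Fin 4) (v : Fin 4 → ℤ) : reflect i (reflect i v) = v := by
  conv_lhs => rw [reflect, coroot_reflect]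
  rw [reflect, neg_smul, sub_neg_eq_add, sub_add_cancel]

namespace IsChevalley

variable {L : Type*} [LieRing L] [LieAlgebra ℂ L] {h e f : Fin 4 → L}

theorem he_same (H : IsChevalley h e f) (i : Fin 4) : ⁅h i, e i⁆ = (2 : ℂ) • e i := by
  rw [H.e_mem i i, coroot_self]; norm_num

theorem hf_same (H : IsChevalley h e f) (i : Fin 4) : ⁅h i, f i⁆ = (-2 : ℂ) • f i := by
  rw [H.f_mem i i, coroot_neg, coroot_self]; norm_num

theorem exists_ad_e_pow_eq_zero (H : IsChevalley h e f) (i : Fin 4) (z : L) :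
    ∃ n, (LieAlgebra.ad ℂ L (e i) ^ n) z = 0 := by
  have : LieSubalgebra.engel ℂ (e i) = ⊤ := by
    rw [eq_top_iff, ← H.gen, LieSubalgebra.lieSpan_le]
    have hh : ∀ j, ⁅e i, h j⁆ = -(CartanMatrix.F₄ j i : ℂ) • e i := fun j => by
      rw [← lie_skew, H.he, neg_smul]
    rintro _ ((⟨j, rfl⟩ | ⟨j, rfl⟩) | ⟨j, rfl⟩) <;>
      rw [SetLike.mem_coe, LieSubalgebra.mem_engel_iff]
    · exact ⟨2, by simp [pow_two, hh]⟩
    · exact ⟨_, (congrArg (fun g => g (e j)) (pow_succ (LieAlgebra.ad ℂ L (e i)) _)).trans (H.ade i j)⟩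
    · refine ⟨3, ?_⟩
      by_cases hij : i = j
      · subst hij
        simp [pow_succ, H.ef_same, hh]
      · simp [pow_succ, H.ef_ne i j hij]
  exact (LieSubalgebra.mem_engel_iff ℂ _ _).1 (this ▸ LieSubalgebra.mem_top z)

theorem ad_f_pow_mem (H : IsChevalley h e f) {v : Fin 4 → ℤ} {z : L} (hz : z ∈ wtSpace h v)
    (i : Fin 4) (n : ℕ) : (LieAlgebra.ad ℂ L (f i) ^ n) z ∈ wtSpace h (v - (n : ℤ) • Pi.single i 1) := by
  induction n with
  | zero => simpa using hz
  | succ n ih =>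
    rw [ad_pow_succ_apply]
    convert lie_mem_wtSpace (H.f_mem i) ih using 2
    push_cast
    module

theorem exists_injective_reflect_of_pos (H : IsChevalley h e f) {v : Fin 4 → ℤ} {i : Fin 4}
    (hv : 0 ≤ coroot i v) : ∃ φ : L →ₗ[ℂ] L, (∀ x ∈ wtSpace h v, φ x ∈ wtSpace h (reflect i v)) ∧
      ∀ x ∈ wtSpace h v, φ x = 0 → x = 0 := by
  obtain ⟨n, hn⟩ := Int.eq_ofNat_of_zero_le hv
  refine ⟨LieAlgebra.ad ℂ L (f i) ^ n, fun x hx => ?_, fun x hx hx0 => ?_⟩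
  · rw [reflect, hn]
    exact H.ad_f_pow_mem hx i n
  · exact ad_f_pow_injective (H.he_same i) (H.hf_same i) (H.ef_same i)
      (H.exists_ad_e_pow_eq_zero i) n x n le_rfl (by rw [hx i, hn]) hx0

theorem exists_injective_reflect (H : IsChevalley h e f) (v : Fin 4 → ℤ) (i : Fin 4) :
    ∃ φ : L →ₗ[ℂ] L, (∀ x ∈ wtSpace h v, φ x ∈ wtSpace h (reflect i v)) ∧
      ∀ x ∈ wtSpace h v, φ x = 0 → x = 0 := by
  rcases le_total 0 (coroot i v) with hv | hv
  · exact H.exists_injective_reflect_of_pos hv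
  · have h1 : 0 ≤ coroot i (-v) := by rw [coroot_neg]; lia
    have h2 := H.swap.exists_injective_reflect_of_pos h1
    have h3 : -reflect i (-v) = reflect i v := by
      rw [reflect, reflect, coroot_neg]; module
    rwa [wtSpace_neg, wtSpace_neg, neg_neg, h3] at h2

theorem exists_smul_of_pos (H : IsChevalley h e f) (n : ℕ) : ∀ v : Fin 4 → ℤ, 0 ≤ v → v ≠ 0 →
    ∑ j, v j ≤ n → ∀ x ∈ wtSpace h v, x ≠ 0 →
      v ∈ roots ∧ ∀ y ∈ wtSpace h v, ∃ c : ℂ, y = c • x := by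
  induction n with
  | zero =>
    intro v hv hv0 hn
    refine absurd ?_ hv0
    have := (Finset.sum_eq_zero_iff_of_nonneg fun j _ => hv j).1 (le_antisymm (by simpa using hn)
      (Finset.sum_nonneg fun j _ => hv j))
    exact funext fun j => this j (Finset.mem_univ j)
  | succ n ih =>
    intro v hv hv0 hn x hx hx0
    obtain ⟨i, hi⟩ := exists_coroot_pos hv hv0
    by_cases hvi : ∀ j, j ≠ i → v j = 0
    · rcases H.wtSpace_single hv hv0 i hvi hx with h1 | ⟨h1, h2⟩
      · exact absurd h1 hx0
      · refine ⟨h1 ▸ single_mem_roots i, fun y hy => ?_⟩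
        obtain ⟨a, rfl⟩ := Submodule.mem_span_singleton.1 h2
        rcases H.wtSpace_single hv hv0 i hvi hy with h3 | ⟨-, h3⟩
        · exact ⟨0, by simp [h3]⟩
        · obtain ⟨b, rfl⟩ := Submodule.mem_span_singleton.1 h3
          have ha : a ≠ 0 := by rintro rfl; simp at hx0
          exact ⟨b * a⁻¹, by rw [smul_smul, mul_assoc, inv_mul_cancel₀ ha, mul_one]⟩
    · push Not at hvi
      obtain ⟨k, hki, hk⟩ := hvi
      obtain ⟨φ, hφ, hφ0⟩ := H.exists_injective_reflect v i
      have hk' : reflect i v k = v k := by simp [reflect, hki]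
      have hkpos : 0 < v k := lt_of_le_of_ne (hv k) hk.symm
      have hφx : φ x ≠ 0 := fun h0 => hx0 (hφ0 x hx h0)
      have hpos : 0 ≤ reflect i v := by
        by_contra hneg
        have := H.wtSpace_eq_bot_of_mixed hneg fun hle => by
          have := hle k
          rw [hk'] at this
          exact absurd this (by simpa using hkpos)
        have h1 := hφ x hx
        rw [this, Submodule.mem_bot] at h1
        exact hφx h1
      have hsum : ∑ j, reflect i v j = ∑ j, v j - coroot i v := by
        simp [reflect, Finset.sum_sub_distrib, ← Finset.mul_sum]
      obtain ⟨h1, h2⟩ := ih (reflect i v) hpos (fun h0 => by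
        rw [h0] at hk'; exact hk hk'.symm) (by push_cast at hn; lia) (φ x) (hφ x hx) hφx
      refine ⟨reflect_reflect i v ▸ reflect_mem_roots _ h1 i, fun y hy => ?_⟩
      obtain ⟨c, hc⟩ := h2 (φ y) (hφ y hy)
      refine ⟨c, sub_eq_zero.1 (hφ0 _ (sub_mem hy (Submodule.smul_mem _ c hx)) ?_)⟩
      rw [map_sub, map_smul, hc, sub_self]

theorem exists_smul (H : IsChevalley h e f) {v : Fin 4 → ℤ} (hv0 : v ≠ 0) {x : L}
    (hx : x ∈ wtSpace h v) (hx0 : x ≠ 0) : v ∈ roots ∧ ∀ y ∈ wtSpace h v, ∃ c : ℂ, y = c • x := by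
  by_cases h1 : 0 ≤ v
  · exact H.exists_smul_of_pos (∑ j, v j).toNat v h1 hv0 (Int.self_le_toNat _) x hx hx0
  by_cases h2 : v ≤ 0
  · have h3 := H.swap.exists_smul_of_pos (∑ j, (-v) j).toNat (-v) (neg_nonneg.2 h2)
      (neg_ne_zero.2 hv0) (Int.self_le_toNat _) x (by rwa [wtSpace_neg, neg_neg]) hx0
    rw [wtSpace_neg, neg_neg] at h3
    exact ⟨neg_neg v ▸ neg_mem_roots _ h3.1, h3.2⟩
  · rw [H.wtSpace_eq_bot_of_mixed h1 h2, Submodule.mem_bot] at hx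
    exact absurd hx hx0

theorem e_ne_zero [Nontrivial L] (H : IsChevalley h e f) (i : Fin 4) : e i ≠ 0 := by
  have step : ∀ i j, CartanMatrix.F₄ i j ≠ 0 → e i = 0 → e j = 0 := fun i j hij hi => by
    have h1 := H.he i j
    rw [← H.ef_same, hi, zero_lie, zero_lie, eq_comm, smul_eq_zero] at h1
    exact h1.resolve_left (by exact_mod_cast hij)
  intro hi
  have hall : ∀ j, e j = 0 := by
    have h01 := step 0 1 (by decide)
    have h12 := step 1 2 (by decide)
    have h23 := step 2 3 (by decide)
    have h32 := step 3 2 (by decide)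
    have h21 := step 2 1 (by decide)
    have h10 := step 1 0 (by decide)
    have h0 : e 0 = 0 := by fin_cases i <;> simp_all
    intro j
    fin_cases j <;> simp_all
  have hh : ∀ j, h j = 0 := fun j => by rw [← H.ef_same, hall, zero_lie]
  have hf : ∀ j, f j = 0 := fun j => by
    have := H.hf_same j
    rw [hh, zero_lie, eq_comm, smul_eq_zero] at this
    exact this.resolve_left (by norm_num)
  have htop := H.gen
  have : LieSubalgebra.lieSpan ℂ L (Set.range h ∪ Set.range e ∪ Set.range f) ≤ ⊥ := by
    rw [LieSubalgebra.lieSpan_le]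
    rintro _ ((⟨j, rfl⟩ | ⟨j, rfl⟩) | ⟨j, rfl⟩) <;> simp [hall, hh, hf]
  obtain ⟨x, hx⟩ := exists_ne (0 : L)
  have h1 : x ∈ (⊥ : LieSubalgebra ℂ L) := this (htop ▸ LieSubalgebra.mem_top x)
  exact hx ((LieSubalgebra.mem_bot x).1 h1)

theorem exists_ne_zero_of_mem_roots [Nontrivial L] (H : IsChevalley h e f) :
    ∀ v ∈ roots, ∃ x ∈ wtSpace h v, x ≠ 0 := by
  refine roots_induction (fun i => ⟨e i, H.e_mem i, H.e_ne_zero i⟩) ?_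
  rintro i v - ⟨x, hx, hx0⟩
  obtain ⟨φ, hφ, hφ0⟩ := H.exists_injective_reflect v i
  exact ⟨φ x, hφ x hx, fun h0 => hx0 (hφ0 x hx h0)⟩

theorem linearIndependent_h [Nontrivial L] (H : IsChevalley h e f) : LinearIndependent ℂ h := by
  rw [Fintype.linearIndependent_iff]
  intro c hc
  have key : ∀ j, ∑ i, c i * (CartanMatrix.F₄ i j : ℂ) = 0 := fun j => by
    have h1 : ⁅∑ i, c i • h i, e j⁆ = (∑ i, c i * (CartanMatrix.F₄ i j : ℂ)) • e j := by
      rw [sum_lie, Finset.sum_smul]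
      exact Finset.sum_congr rfl fun i _ => by rw [smul_lie, H.he, smul_smul]
    rw [hc, zero_lie, eq_comm, smul_eq_zero] at h1
    exact h1.resolve_right (H.e_ne_zero j)
  have h0 := key 0
  have h1 := key 1
  have h2 := key 2
  have h3 := key 3
  simp only [CartanMatrix.F₄, Fin.sum_univ_four, Matrix.of_apply, Matrix.cons_val] at h0 h1 h2 h3
  push_cast at h0 h1 h2 h3
  intro i
  fin_cases i <;> simp only [Fin.zero_eta, Fin.mk_one, Fin.reduceFinMk]
  · linear_combination 2 * h0 + 3 * h1 + 2 * h2 + 1 * h3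
  · linear_combination 3 * h0 + 6 * h1 + 4 * h2 + 2 * h3
  · linear_combination 4 * h0 + 8 * h1 + 6 * h2 + 3 * h3
  · linear_combination 2 * h0 + 4 * h1 + 3 * h2 + 2 * h3

end IsChevalley

/-! ### A basis of weight vectors and the Weyl group automorphisms -/

/-- The weights of a basis of weight vectors. -/
def idxWt : Fin 4 ⊕ Fin roots.length → (Fin 4 → ℤ) := Sum.elim 0 roots.get

theorem coroot_reflect' (i j : Fin 4) (v : Fin 4 → ℤ) :
    coroot j (reflect i v) = coroot j v - CartanMatrix.F₄ j i * coroot i v := by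
  rw [reflect, sub_eq_add_neg, coroot_add, coroot_neg, coroot_smul, coroot_single]; ring

theorem reflect_add (i : Fin 4) (v w : Fin 4 → ℤ) :
    reflect i (v + w) = reflect i v + reflect i w := by
  simp only [reflect, coroot_add]; module

namespace IsChevalley

variable {L : Type*} [LieRing L] [LieAlgebra ℂ L] {h e f : Fin 4 → L}

theorem iSup_wtSpace (H : IsChevalley h e f) : ⨆ v, wtSpace h v = ⊤ := by
  rw [eq_top_iff, ← H.triangular_eq_top]
  refine sup_le (sup_le ?_ ?_) ?_ <;> refine Submodule.span_le.2 ?_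
  · rintro _ ⟨i, rfl⟩
    exact Submodule.mem_iSup_of_mem 0 (H.h_mem i)
  · rintro x ⟨w, hx⟩
    exact Submodule.mem_iSup_of_mem (-w) (H.fWord_mem hx)
  · rintro x ⟨w, hx⟩
    exact Submodule.mem_iSup_of_mem w (H.eWord_mem hx)

theorem exists_basis [Nontrivial L] (H : IsChevalley h e f) :
    ∃ b : Module.Basis (Fin 4 ⊕ Fin roots.length) ℂ L,
      (∀ i, b (Sum.inl i) = h i) ∧ ∀ i, b i ∈ wtSpace h (idxWt i) := by
  choose x hx hx0 using fun k : Fin roots.length =>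
    H.exists_ne_zero_of_mem_roots (roots.get k) (List.get_mem _ _)
  have hnd : Function.Injective roots.get := List.nodup_iff_injective_get.1 (by decide +kernel)
  have hxi : LinearIndependent ℂ x :=
    (H.iSupIndep_wtSpace.comp hnd).linearIndependent _ hx hx0
  have hdisj : Disjoint (Submodule.span ℂ (Set.range h)) (Submodule.span ℂ (Set.range x)) := by
    refine (H.iSupIndep_wtSpace 0).mono H.wtSpace_zero.ge ?_
    rw [Submodule.span_le]
    rintro _ ⟨k, rfl⟩
    refine Submodule.mem_iSup_of_mem (roots.get k) (Submodule.mem_iSup_of_mem ?_ (hx k))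
    intro h0
    exact zero_notMem_roots (h0 ▸ List.get_mem _ _)
  have hli : LinearIndependent ℂ (Sum.elim h x) := H.linearIndependent_h.sum_type hxi hdisj
  have hspan : ⊤ ≤ Submodule.span ℂ (Set.range (Sum.elim h x)) := by
    rw [← H.iSup_wtSpace]
    refine iSup_le fun v y hy => ?_
    by_cases hv : v = 0
    · subst hv
      rw [H.wtSpace_zero] at hy
      refine Submodule.span_mono ?_ hy
      rintro _ ⟨i, rfl⟩
      exact ⟨Sum.inl i, rfl⟩
    · by_cases hy0 : y = 0
      · rw [hy0]; exact zero_mem _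
      · obtain ⟨k, hk⟩ := List.get_of_mem (H.exists_smul hv hy hy0).1
        subst hk
        obtain ⟨c, rfl⟩ := (H.exists_smul hv (hx k) (hx0 k)).2 y hy
        exact Submodule.smul_mem _ _ (Submodule.subset_span ⟨Sum.inr k, rfl⟩)
  refine ⟨Module.Basis.mk hli hspan, fun i => by simp, fun i => ?_⟩
  rw [Module.Basis.mk_apply]
  rcases i with i | k
  · exact H.h_mem i
  · exact hx k

theorem finiteDimensional (H : IsChevalley h e f) : FiniteDimensional ℂ L := by
  cases subsingleton_or_nontrivial L
  · infer_instance
  · exact Module.Basis.finiteDimensional_of_finite H.exists_basis.choose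

theorem isNilpotent_ad_e (H : IsChevalley h e f) (i : Fin 4) :
    IsNilpotent (LieAlgebra.ad ℂ L (e i)) := by
  have := H.finiteDimensional
  rw [Module.End.isNilpotent_iff_of_finite]
  exact H.exists_ad_e_pow_eq_zero i

/-- An inner derivation which is nilpotent exponentiates to an automorphism acting by the usual
series. -/
theorem exists_exp {x : L} (hx : IsNilpotent (LieAlgebra.ad ℂ L x)) :
    ∃ g : L ≃ₗ⁅ℂ⁆ L, ∀ y, ∀ n, (LieAlgebra.ad ℂ L x ^ n) y = 0 →
      g y = ∑ k ∈ Finset.range n, (k.factorial : ℂ)⁻¹ • (LieAlgebra.ad ℂ L x ^ k) y := by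
  let : Module ℚ L := Module.compHom L (algebraMap ℚ ℂ)
  have hq : ∀ (q : ℚ) (y : L), q • y = (q : ℂ) • y := fun q y => rfl
  let : LieAlgebra ℚ L := { lie_smul := fun q y z => by rw [hq, hq, lie_smul] }
  have h1 : (LieDerivation.ad ℂ L x).toLinearMap = LieAlgebra.ad ℂ L x := by
    ext y
    simp
  have hx' : IsNilpotent (LieDerivation.ad ℂ L x).toLinearMap := by rwa [h1]
  refine ⟨LieDerivation.exp _ hx', fun y n hn => ?_⟩
  rw [LieDerivation.exp_map_apply, h1]
  have := IsNilpotent.exp_smul_eq_sum (A := Module.End ℂ L) (M := L) hn hx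
  rw [Module.End.smul_def] at this
  rw [this]
  simp [hq]

theorem exists_weyl (H : IsChevalley h e f) (i : Fin 4) : ∃ g : L ≃ₗ⁅ℂ⁆ L,
    (∀ (t : L) (c : ℂ), ⁅t, e i⁆ = c • e i → ⁅t, f i⁆ = -(c • f i) → g t = t - c • h i) ∧
    ∀ v, ∀ x ∈ wtSpace h v, g x ∈ wtSpace h (reflect i v) := by
  obtain ⟨g₁, hg₁⟩ := exists_exp (H.isNilpotent_ad_e i)
  have hnf : IsNilpotent (LieAlgebra.ad ℂ L (-f i)) := by
    rw [map_neg]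
    exact (H.swap.isNilpotent_ad_e i).neg
  obtain ⟨g₂, hg₂⟩ := exists_exp hnf
  have hfe : ⁅f i, e i⁆ = -h i := by rw [← lie_skew, H.ef_same]
  have heh : ⁅e i, h i⁆ = -((2 : ℂ) • e i) := by rw [← lie_skew, H.he_same]
  have hfh : ⁅f i, h i⁆ = (2 : ℂ) • f i := by rw [← lie_skew, H.hf_same]; module
  have act₁ : ∀ (t : L) (c : ℂ), ⁅t, e i⁆ = c • e i → g₁ t = t - c • e i := by
    intro t c ht
    have ht' : ⁅e i, t⁆ = -(c • e i) := by rw [← lie_skew, ht]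
    rw [hg₁ t 2 (by simp [pow_two, ht'])]
    simp [Finset.sum_range_succ, ht', sub_eq_add_neg]
  have act₂ : ∀ (t : L) (c : ℂ), ⁅t, f i⁆ = -(c • f i) → g₂ t = t - c • f i := by
    intro t c ht
    have ht' : ⁅f i, t⁆ = c • f i := by rw [← lie_skew, ht, neg_neg]
    rw [hg₂ t 2 (by simp [pow_two, ht'])]
    simp [Finset.sum_range_succ, ht', sub_eq_add_neg]
  have act₂e : g₂ (e i) = e i + h i - f i := by
    rw [hg₂ (e i) 3 (by simp [pow_succ, hfe, hfh])]
    simp only [Finset.sum_range_succ, pow_succ, pow_zero, one_mul, Module.End.mul_apply,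
      LieAlgebra.ad_apply, neg_lie, hfe, neg_neg, hfh, Finset.sum_range_zero, Module.End.one_apply]
    have : ((Nat.factorial 2 : ℂ)⁻¹) • (-((2 : ℂ) • f i)) = -f i := by
      rw [smul_neg, smul_smul]
      norm_num [Nat.factorial]
    rw [this]
    simp [sub_eq_add_neg]
  have act₁f : g₁ (f i) = f i + h i - e i := by
    rw [hg₁ (f i) 3 (by simp [pow_succ, H.ef_same, heh])]
    simp only [Finset.sum_range_succ, pow_succ, pow_zero, one_mul, Module.End.mul_apply,
      LieAlgebra.ad_apply, H.ef_same, heh, Finset.sum_range_zero, Module.End.one_apply]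
    have : ((Nat.factorial 2 : ℂ)⁻¹) • (-((2 : ℂ) • e i)) = -e i := by
      rw [smul_neg, smul_smul]
      norm_num [Nat.factorial]
    rw [this]
    simp [sub_eq_add_neg]
  have act₁e : g₁ (e i) = e i := by
    have := act₁ (e i) 0 (by simp)
    simpa using this
  have act₁h : g₁ (h i) = h i - (2 : ℂ) • e i := act₁ _ _ (H.he_same i)
  set g : L ≃ₗ⁅ℂ⁆ L := (g₁.trans g₂).trans g₁
  have hg : ∀ (t : L) (c : ℂ), ⁅t, e i⁆ = c • e i → ⁅t, f i⁆ = -(c • f i) →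
      g t = t - c • h i := by
    intro t c h1 h2
    have : g t = g₁ (g₂ (g₁ t)) := rfl
    rw [this, act₁ t c h1, map_sub, map_smul, act₂ t c h2, act₂e, map_sub, map_sub, map_smul,
      map_smul, map_sub, map_add, act₁ t c h1, act₁e, act₁h, act₁f]
    module
  refine ⟨g, hg, fun v x hx j => ?_⟩
  have hgj : ∀ j, g (h j) = h j - (CartanMatrix.F₄ j i : ℂ) • h i := fun j =>
    hg _ _ (H.he j i) (H.hf j i)
  have h2 : (CartanMatrix.F₄ i i : ℂ) = 2 := by
    rw [← coroot_single, coroot_self]; norm_num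
  have hinv : g (h j - (CartanMatrix.F₄ j i : ℂ) • h i) = h j := by
    rw [map_sub, map_smul, hgj, hgj, h2]
    module
  calc ⁅h j, g x⁆ = g ⁅h j - (CartanMatrix.F₄ j i : ℂ) • h i, x⁆ := by
        rw [LieEquiv.map_lie, hinv]
    _ = (coroot j (reflect i v) : ℂ) • g x := by
        rw [sub_lie, smul_lie, hx j, hx i, ← map_smul, coroot_reflect']
        congr 1
        push_cast
        module

theorem lie_ne_zero [Nontrivial L] (H : IsChevalley h e f) : ∀ v ∈ roots, ∀ w ∈ roots,
    v + w ∈ roots → ∀ x ∈ wtSpace h v, ∀ y ∈ wtSpace h w, x ≠ 0 → y ≠ 0 → ⁅x, y⁆ ≠ 0 := by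
  refine roots_induction ?_ ?_
  · intro i w hw hvw x hx y hy hx0 hy0 hxy
    have hsi : (Pi.single i 1 : Fin 4 → ℤ) ≠ 0 := by simp
    obtain ⟨c, hc⟩ := (H.exists_smul hsi hx hx0).2 (e i) (H.e_mem i)
    have hey : ⁅e i, y⁆ = 0 := by rw [hc, smul_lie, hxy, smul_zero]
    rcases lt_or_ge 0 (coroot i (Pi.single i 1 + w)) with hpos | hneg
    · obtain ⟨z, hz, hz0⟩ := H.exists_ne_zero_of_mem_roots _ hvw
      refine hz0 (eq_zero_of_lie_e_lie_f (H.he_same i) (H.ef_same i) (H.exists_ad_e_pow_eq_zero i)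
        hpos (hz i) ?_)
      have hfz := lie_mem_wtSpace (H.f_mem i) hz
      rw [neg_add_cancel_left] at hfz
      have hw0 : w ≠ 0 := by rintro rfl; exact zero_notMem_roots hw
      obtain ⟨d, hd⟩ := (H.exists_smul hw0 hy hy0).2 _ hfz
      rw [hd, lie_smul, hey, smul_zero]
    · refine hy0 (eq_zero_of_lie_e_lie_f (m := -coroot i w) (H.swap.he_same i) (H.swap.ef_same i)
        (H.swap.exists_ad_e_pow_eq_zero i) ?_ ?_ ?_)
      · rw [coroot_add, coroot_self] at hneg; lia
      · rw [Pi.neg_apply, neg_lie, hy i, Int.cast_neg, neg_smul]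
      · rw [hey, lie_zero]
  · intro i v hv ih w hw hvw x hx y hy hx0 hy0 hxy
    obtain ⟨g, -, hg⟩ := H.exists_weyl i
    have hx' := hg _ x hx
    rw [reflect_reflect] at hx'
    refine ih (reflect i w) (reflect_mem_roots w hw i) ?_ (g x) hx' (g y) (hg _ y hy) ?_ ?_ ?_
    · have := reflect_mem_roots _ hvw i
      rwa [reflect_add, reflect_reflect] at this
    · simpa using hx0
    · simpa using hy0
    · rw [← LieEquiv.map_lie, hxy, map_zero]

end IsChevalley

/-! ### Exponentials of inner derivations -/

section Exponential

open NormedSpace Topology Filter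

theorem exp_neg_exp_apply {V : Type*} [NormedAddCommGroup V] [NormedSpace ℂ V]
    [CompleteSpace V] (D : V →L[ℂ] V) (x : V) : exp (-D) (exp D x) = x := by
  have hF : ∀ t : ℂ, HasDerivAt (fun s : ℂ => exp (s • (-D)) (exp (s • D) x)) 0 t := by
    intro t
    have hB : HasDerivAt (fun s : ℂ => exp (s • D) x) (D (exp (t • D) x)) t := by
      simpa using (hasDerivAt_exp_smul_const' D t).clm_apply (hasDerivAt_const t x)
    convert! (hasDerivAt_exp_smul_const (-D) t).clm_apply hB using 1
    simp
  have hc := is_const_of_deriv_eq_zero (fun t => (hF t).differentiableAt)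
    (fun t => (hF t).deriv) 1 0
  simpa using hc

theorem exp_apply_of_derivation {V : Type*} [NormedAddCommGroup V] [NormedSpace ℂ V]
    [CompleteSpace V] (B : V →L[ℂ] V →L[ℂ] V) (D : V →L[ℂ] V)
    (hD : ∀ x y, D (B x y) = B (D x) y + B x (D y)) (x y : V) :
    exp D (B x y) = B (exp D x) (exp D y) := by
  have hE : ∀ (z : V) (t : ℂ), HasDerivAt (fun s : ℂ => exp (s • D) z) (D (exp (t • D) z)) t := by
    intro z t
    simpa using (hasDerivAt_exp_smul_const' D t).clm_apply (hasDerivAt_const t z)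
  have hF : ∀ t : ℂ, HasDerivAt
      (fun s : ℂ => exp (s • (-D)) (B (exp (s • D) x) (exp (s • D) y))) 0 t := by
    intro t
    have hB : HasDerivAt (fun s : ℂ => B (exp (s • D) x) (exp (s • D) y))
        (B (D (exp (t • D) x)) (exp (t • D) y) + B (exp (t • D) x) (D (exp (t • D) y))) t :=
      (B.hasFDerivAt.comp_hasDerivAt t (hE x t)).clm_apply (hE y t)
    convert! (hasDerivAt_exp_smul_const (-D) t).clm_apply hB using 1
    rw [mul_apply_eq_comp, ← hD, ← map_add]
    simp
  have hc := is_const_of_deriv_eq_zero (fun t => (hF t).differentiableAt)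
    (fun t => (hF t).deriv) 1 0
  simp only [one_smul, zero_smul, exp_zero, one_apply_eq_self] at hc
  rw [← hc]
  simpa using exp_neg_exp_apply (-D) (B (exp D x) (exp D y))

theorem exp_apply_of_apply_eq_zero {V : Type*} [NormedAddCommGroup V] [NormedSpace ℂ V]
    [CompleteSpace V] (D : V →L[ℂ] V) (x : V) (hx : D x = 0) : exp D x = x := by
  have hE : ∀ t : ℂ, HasDerivAt (fun s : ℂ => exp (s • D) x) 0 t := by
    intro t
    simpa [hx] using (hasDerivAt_exp_smul_const D t).clm_apply (hasDerivAt_const t x)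
  have hc := is_const_of_deriv_eq_zero (fun t => (hE t).differentiableAt)
    (fun t => (hE t).deriv) 1 0
  simpa using hc

theorem exp_local_cover {V : Type*} [NormedAddCommGroup V] [NormedSpace ℂ V]
    [FiniteDimensional ℂ V] (A : V →L[ℂ] V →L[ℂ] V) (S T : Submodule ℂ V) (u : V)
    (hST : ∀ y, ∃ z ∈ S, ∃ t ∈ T, y = A z u + t) {N : Set V} (hN : N ∈ 𝓝 u) :
    ∀ᶠ v in 𝓝 u, ∃ z ∈ S, ∃ t ∈ T, u + t ∈ N ∧ exp (A z) (u + t) = v := by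
  have := FiniteDimensional.complete ℂ V
  have := FiniteDimensional.complete ℂ S
  have := FiniteDimensional.complete ℂ T
  let F : S × T → V := fun p => exp (A p.1) (u + p.2)
  let F' : S × T →L[ℂ] V := ((A.flip u).comp S.subtypeL).coprod T.subtypeL
  have hF : HasStrictFDerivAt F F' 0 := by
    have h1 : HasStrictFDerivAt (fun p : S × T => A p.1)
        ((A.comp S.subtypeL).comp (ContinuousLinearMap.fst ℂ S T)) 0 :=
      ((A.comp S.subtypeL).comp (ContinuousLinearMap.fst ℂ S T)).hasStrictFDerivAt
    have h2 : HasStrictFDerivAt (fun p : S × T => exp (A p.1)) _ 0 :=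
      HasStrictFDerivAt.comp (g := exp) (g' := (1 : (V →L[ℂ] V) →L[ℂ] (V →L[ℂ] V))) 0
        (by simpa using hasStrictFDerivAt_exp_zero (𝕂 := ℂ) (𝔸 := V →L[ℂ] V)) h1
    have h3 : HasStrictFDerivAt (fun p : S × T => u + (p.2 : V))
        (T.subtypeL.comp (ContinuousLinearMap.snd ℂ S T)) 0 :=
      (T.subtypeL.comp (ContinuousLinearMap.snd ℂ S T)).hasStrictFDerivAt.const_add u
    convert! h2.clm_apply h3 using 1
    ext p <;> simp [F']
  have hsurj : F'.range = ⊤ := by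
    rw [LinearMap.range_eq_top]
    intro y
    obtain ⟨z, hz, t, ht, rfl⟩ := hST y
    exact ⟨(⟨z, hz⟩, ⟨t, ht⟩), by simp [F']⟩
  have hF0 : F 0 = u := by simp [F]
  have hmap := hF.map_nhds_eq_of_surj hsurj
  rw [hF0] at hmap
  have hN' : {p : S × T | u + (p.2 : V) ∈ N} ∈ 𝓝 0 := by
    have : Continuous fun p : S × T => u + (p.2 : V) := by fun_prop
    exact this.continuousAt.preimage_mem_nhds (by simpa using hN)
  have := image_mem_map (m := F) hN'
  rw [hmap] at this
  filter_upwards [this]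
  rintro _ ⟨p, hp, rfl⟩
  exact ⟨p.1, p.1.2, p.2, p.2.2, hp, rfl⟩

/-- Near `u` every element is conjugate to an element of `u + T`, as soon as `L = ⁅S, u⁆ + T`. -/
theorem eventually_exists_lieEquiv {L : Type*} [LieRing L] [LieAlgebra ℂ L]
    [FiniteDimensional ℂ L] [TopologicalSpace L] [IsTopologicalAddGroup L] [ContinuousSMul ℂ L]
    [T2Space L] (S T : Submodule ℂ L) (u : L) (hST : ∀ y, ∃ z ∈ S, ∃ t ∈ T, y = ⁅z, u⁆ + t)
    {N : Set L} (hN : N ∈ 𝓝 u) :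
    ∀ᶠ v in 𝓝 u, ∃ g : L ≃ₗ⁅ℂ⁆ L, (∃ z ∈ S, ∀ x, ⁅z, x⁆ = 0 → g x = x) ∧
      ∃ t ∈ T, u + t ∈ N ∧ g (u + t) = v := by
  let φ : L ≃L[ℂ] (Fin (Module.finrank ℂ L) → ℂ) :=
    ContinuousLinearEquiv.ofFinrankEq (Module.finrank_fin_fun ℂ).symm
  let V := Fin (Module.finrank ℂ L) → ℂ
  let A₀ : V →ₗ[ℂ] V →ₗ[ℂ] V :=
    ((LieModule.toEnd ℂ L L : L →ₗ[ℂ] Module.End ℂ L).compl₁₂ φ.symm.toLinearMap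
      φ.symm.toLinearMap).compr₂ φ.toLinearMap
  let A : V →L[ℂ] V →L[ℂ] V :=
    LinearMap.toContinuousLinearMap (LinearMap.toContinuousLinearMap.toLinearMap ∘ₗ A₀)
  have hA : ∀ x y, A x y = φ ⁅φ.symm x, φ.symm y⁆ := fun x y => rfl
  have hAφ : ∀ x y, A (φ x) (φ y) = φ ⁅x, y⁆ := fun x y => by simp [hA]
  have key := exp_local_cover A (S.map φ.toLinearMap) (T.map φ.toLinearMap) (φ u) (by
    intro y
    obtain ⟨z, hz, t, ht, hy⟩ := hST (φ.symm y)
    refine ⟨φ z, ⟨z, hz, rfl⟩, φ t, ⟨t, ht, rfl⟩, ?_⟩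
    rw [hAφ, ← map_add, ← hy]
    simp) (N := φ.symm ⁻¹' N) (φ.symm.continuous.continuousAt.preimage_mem_nhds (by simpa using hN))
  filter_upwards [φ.continuous.continuousAt.eventually key]
  rintro v ⟨_, ⟨z, hz, rfl⟩, _, ⟨t, ht, rfl⟩, htN, hv⟩
  have hD : ∀ (z : L) (x y : V), A (φ z) (A x y) = A (A (φ z) x) y + A x (A (φ z) y) := by
    intro z x y
    simp only [hA, ContinuousLinearEquiv.symm_apply_apply, leibniz_lie z, map_add]
  let g : L ≃ₗ⁅ℂ⁆ L :=
    { toFun x := φ.symm (exp (A (φ z)) (φ x))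
      map_add' x y := by simp
      map_smul' c x := by simp
      map_lie' {x y} := by
        rw [← hAφ, exp_apply_of_derivation A _ (hD z), hA]
        simp
      invFun x := φ.symm (exp (-A (φ z)) (φ x))
      left_inv x := by simp [exp_neg_exp_apply]
      right_inv x := by
        have := exp_neg_exp_apply (-A (φ z)) (φ x)
        rw [neg_neg] at this
        simp [this] }
  have hg : ∀ x, g x = φ.symm (exp (A (φ z)) (φ x)) := fun x => rfl
  refine ⟨g, ⟨z, hz, fun x hx => ?_⟩, t, ht, by simpa using htN, ?_⟩
  · rw [hg, exp_apply_of_apply_eq_zero _ _ (by rw [hAφ, hx, map_zero])]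
    simp
  · rw [hg, map_add]
    simpa using congrArg φ.symm hv

end Exponential

/-! ### `sl₂`-triples in finite-dimensional Lie algebras -/

section SlTwo

variable {L : Type*} [LieRing L] [LieAlgebra ℂ L]

theorem lie_ad_pow_apply {h e f : L} (hf : ⁅h, f⁆ = (-2 : ℂ) • f) (hef : ⁅e, f⁆ = h) (y : L)
    (j : ℕ) : ⁅h, (LieAlgebra.ad ℂ L f ^ j) y⁆ =
        (LieAlgebra.ad ℂ L f ^ j) ⁅h, y⁆ - (2 * j : ℂ) • (LieAlgebra.ad ℂ L f ^ j) y ∧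
      ⁅e, (LieAlgebra.ad ℂ L f ^ (j + 1)) y⁆ = (LieAlgebra.ad ℂ L f ^ (j + 1)) ⁅e, y⁆ +
        (j + 1 : ℂ) • ((LieAlgebra.ad ℂ L f ^ j) ⁅h, y⁆ -
          (j : ℂ) • (LieAlgebra.ad ℂ L f ^ j) y) := by
  induction j with
  | zero => simp [leibniz_lie e f y, hef, add_comm]
  | succ j ih =>
    obtain ⟨h1, h2⟩ := ih
    have h3 : ⁅h, (LieAlgebra.ad ℂ L f ^ (j + 1)) y⁆ = (LieAlgebra.ad ℂ L f ^ (j + 1)) ⁅h, y⁆ -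
        (2 * (j + 1 : ℕ) : ℂ) • (LieAlgebra.ad ℂ L f ^ (j + 1)) y := by
      rw [ad_pow_succ_apply, ad_pow_succ_apply, leibniz_lie, h1, hf, smul_lie, lie_sub, lie_smul]
      push_cast
      module
    refine ⟨h3, ?_⟩
    rw [ad_pow_succ_apply f y (j + 1), leibniz_lie, h2, hef, h3, lie_add, lie_smul, lie_sub,
      lie_smul, ← ad_pow_succ_apply, ← ad_pow_succ_apply, ← ad_pow_succ_apply]
    push_cast
    module

end SlTwo

section FiniteDimensionalSlTwo

variable {L : Type*} [LieRing L] [LieAlgebra ℂ L] [FiniteDimensional ℂ L]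

theorem exists_ad_pow_eq_zero {h e : L} {a : ℂ} (ha : a ≠ 0) (he : ⁅h, e⁆ = a • e) :
    ∃ n, LieAlgebra.ad ℂ L e ^ n = 0 := by
  by_contra! hne
  let T : Module.End ℂ (Module.End ℂ L) := 
    LinearMap.mulLeft ℂ (LieAlgebra.ad ℂ L h) - LinearMap.mulRight ℂ (LieAlgebra.ad ℂ L h)
  have hT : ∀ n : ℕ, T (LieAlgebra.ad ℂ L e ^ n) = (n * a) • LieAlgebra.ad ℂ L e ^ n := by
    intro n
    ext z
    simp only [T, LinearMap.sub_apply, LinearMap.mulLeft_apply, LinearMap.mulRight_apply,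
      Module.End.mul_apply, LinearMap.smul_apply, LieAlgebra.ad_apply]
    induction n generalizing z with
    | zero => simp
    | succ n ih =>
      have h1 := ih z
      rw [sub_eq_iff_eq_add] at h1
      rw [ad_pow_succ_apply, ad_pow_succ_apply, leibniz_lie, h1, he, lie_add, lie_smul, smul_lie]
      push_cast
      module
  have hinj : Function.Injective fun n : ℕ => (n : ℂ) * a := by
    intro m n hmn
    simpa [ha] using hmn
  refine (Set.infinite_range_of_injective hinj) (Set.Finite.subset T.finite_hasEigenvalue ?_)
  rintro _ ⟨n, rfl⟩
  exact Module.End.hasEigenvalue_of_hasEigenvector ⟨Module.End.mem_eigenspace_iff.2 (hT n), hne n⟩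

theorem exists_lie_eq_of_pos {h e f : L} (he : ⁅h, e⁆ = (2 : ℂ) • e) (hf : ⁅h, f⁆ = (-2 : ℂ) • f)
    (hef : ⁅e, f⁆ = h) {m : ℤ} (hm : 0 < m) {y : L} (hy : ⁅h, y⁆ = (m : ℂ) • y) :
    ∃ x, ⁅h, x⁆ = ((m - 2 : ℤ) : ℂ) • x ∧ ⁅e, x⁆ = y := by
  obtain ⟨n, hn⟩ := exists_ad_pow_eq_zero two_ne_zero he
  let T : Module.End ℂ L := LieAlgebra.ad ℂ L e * LieAlgebra.ad ℂ L f
  let W := Module.End.eigenspace (LieAlgebra.ad ℂ L h) (m : ℂ)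
  have hT : ∀ z ∈ W, T z ∈ W := by
    intro z hz
    rw [Module.End.mem_eigenspace_iff, LieAlgebra.ad_apply] at hz ⊢
    simp only [T, Module.End.mul_apply, LieAlgebra.ad_apply]
    rw [lie_weight he (lie_weight hf hz)]
    congr 1
    ring
  have hinj : Function.Injective (T.restrict hT) := by
    rw [injective_iff_map_eq_zero]
    rintro ⟨z, hz⟩ h0
    have hz' := Module.End.mem_eigenspace_iff.1 hz
    have := eq_zero_of_lie_e_lie_f he hef (fun z => ⟨n, by rw [hn]; rfl⟩) hm hz'
      (congrArg Subtype.val h0)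
    exact Subtype.ext this
  obtain ⟨⟨z, hz⟩, hzy⟩ := LinearMap.surjective_of_injective hinj
    ⟨y, Module.End.mem_eigenspace_iff.2 hy⟩
  refine ⟨⁅f, z⁆, ?_, congrArg Subtype.val hzy⟩
  rw [lie_weight hf (Module.End.mem_eigenspace_iff.1 hz)]
  push_cast
  congr 1
  ring

theorem eq_zero_of_lie_eq_zero_of_neg {h e f : L} (he : ⁅h, e⁆ = (2 : ℂ) • e)
    (hf : ⁅h, f⁆ = (-2 : ℂ) • f) (hef : ⁅e, f⁆ = h) {m : ℤ} (hm : m < 0) {x : L}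
    (hx : ⁅h, x⁆ = (m : ℂ) • x) (hex : ⁅e, x⁆ = 0) : x = 0 := by
  obtain ⟨n, hn⟩ := exists_ad_pow_eq_zero (by norm_num) hf
  refine ad_f_pow_injective (h := -h) (e := f) (f := e) ?_ ?_ ?_ (fun z => ⟨n, by rw [hn]; rfl⟩) 1 x
    (-m) (by push_cast; lia) ?_ (by simpa using hex)
  · rw [neg_lie, hf]; module
  · rw [neg_lie, he]; module
  · rw [← lie_skew, hef]
  · rw [neg_lie, hx]; push_cast; module

theorem lie_eq_smul_of_sq {h e f : L} (he : ⁅h, e⁆ = (2 : ℂ) • e) (hf : ⁅h, f⁆ = (-2 : ℂ) • f)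
    (hef : ⁅e, f⁆ = h) (k : ℤ) (y : L)
    (hy : ⁅h, ⁅h, y⁆ - (k : ℂ) • y⁆ = (k : ℂ) • (⁅h, y⁆ - (k : ℂ) • y)) :
    ⁅h, y⁆ = (k : ℂ) • y := by
  have hbound : ∃ K : ℤ, ∀ k : ℤ, K ≤ k → ∀ w : L, ⁅h, w⁆ = (k : ℂ) • w → w = 0 := by
    have hfin : Set.Finite {k : ℤ | (LieAlgebra.ad ℂ L h).HasEigenvalue (k : ℂ)} :=
      Set.Finite.preimage (Int.cast_injective.injOn)
        (LieAlgebra.ad ℂ L h).finite_hasEigenvalue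
    obtain ⟨K, hK⟩ := hfin.bddAbove
    refine ⟨K + 1, fun k hk w hw => ?_⟩
    by_contra hw0
    have : k ≤ K := hK (Module.End.hasEigenvalue_of_hasEigenvector
      ⟨Module.End.mem_eigenspace_iff.2 hw, hw0⟩)
    lia
  obtain ⟨K, hK⟩ := hbound
  obtain ⟨n, hn⟩ := exists_ad_pow_eq_zero two_ne_zero he
  obtain ⟨N, hN⟩ := exists_ad_pow_eq_zero (by norm_num) hf
  suffices H : ∀ (d : ℕ) (k : ℤ), K - d ≤ k → ∀ y : L,
      ⁅h, ⁅h, y⁆ - (k : ℂ) • y⁆ = (k : ℂ) • (⁅h, y⁆ - (k : ℂ) • y) → ⁅h, y⁆ = (k : ℂ) • y from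
    H (K - k).toNat k (by lia) y hy
  intro d
  induction d with
  | zero =>
    intro k hk y hy
    exact sub_eq_zero.1 (hK k (by simpa using hk) _ hy)
  | succ d ih =>
    intro k hk y hy
    set w := ⁅h, y⁆ - (k : ℂ) • y with hw
    have hhy : ⁅h, y⁆ = (k : ℂ) • y + w := by rw [hw]; abel
    have hhey : ⁅h, ⁅e, y⁆⁆ - ((k + 2 : ℤ) : ℂ) • ⁅e, y⁆ = ⁅e, w⁆ := by
      rw [leibniz_lie, he, smul_lie, hhy, lie_add, lie_smul]
      push_cast
      module
    have hey : ⁅h, ⁅e, y⁆⁆ = ((k + 2 : ℤ) : ℂ) • ⁅e, y⁆ := by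
      refine ih (k + 2) (by push_cast at hk; lia) _ ?_
      rw [hhey, lie_weight he hy]
      push_cast
      module
    have hew : ⁅e, w⁆ = 0 := by rw [← hhey, hey, sub_self]
    rw [← sub_eq_zero]
    rcases lt_or_ge k 0 with hk0 | hk0
    · exact eq_zero_of_lie_eq_zero_of_neg he hf hef hk0 hy hew
    obtain ⟨y₁, hy₁, hey₁⟩ := exists_lie_eq_of_pos he hf hef (by lia) hey
    rw [add_sub_cancel_right] at hy₁
    have hez : ⁅e, y - y₁⁆ = 0 := by rw [lie_sub, hey₁, sub_self]
    have hhz : ⁅h, y - y₁⁆ = (k : ℂ) • (y - y₁) + w := by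
      rw [lie_sub, hhy, hy₁]
      module
    generalize y - y₁ = z at hez hhz
    by_cases hz0 : z = 0
    · simpa [hz0] using hhz.symm
    have hex : ∃ j : ℕ, (LieAlgebra.ad ℂ L f ^ j) z = 0 := ⟨N, by rw [hN]; rfl⟩
    classical
    obtain ⟨j, hj⟩ : ∃ j, Nat.find hex = j + 1 := Nat.exists_eq_add_one_of_ne_zero (by
      intro h0
      have := Nat.find_spec hex
      rw [h0] at this
      exact hz0 (by simpa using this))
    have hj1 : (LieAlgebra.ad ℂ L f ^ (j + 1)) z = 0 := hj ▸ Nat.find_spec hex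
    have hj0 : (LieAlgebra.ad ℂ L f ^ j) z ≠ 0 := Nat.find_min hex (by lia)
    have h1 := (lie_ad_pow_apply hf hef z j).2
    rw [hj1, hez, lie_zero, map_zero, zero_add, eq_comm, smul_eq_zero] at h1
    have h2 := h1.resolve_left (by exact_mod_cast j.succ_ne_zero)
    rw [hhz, map_add, map_smul] at h2
    have h3 := congrArg (⁅h, ·⁆) h2
    simp only [lie_sub, lie_add, lie_smul, lie_zero, (lie_ad_pow_apply hf hef _ j).1] at h3
    rw [hhz, hy, map_add, map_smul, map_smul] at h3
    have h4 : ((k : ℂ) - j) • (LieAlgebra.ad ℂ L f ^ j) w = 0 := by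
      linear_combination (norm := module) h3 - ((k : ℂ) - 2 * j) • h2
    by_cases hkj : (k : ℂ) - j = 0
    · have hkj' : k = j := by exact_mod_cast sub_eq_zero.1 hkj
      refine ad_f_pow_injective he hf hef (fun z => ⟨n, by rw [hn]; rfl⟩) j w k hkj'.ge hy ?_
      rw [hkj'] at h2
      simpa using h2
    · have h5 := (smul_eq_zero.1 h4).resolve_left hkj
      rw [h5, add_zero, ← sub_smul, smul_eq_zero] at h2
      exact (h2.elim hkj hj0).elim

theorem exists_lie_eq_zero_add (h : L)
    (hss : ∀ y : L, ⁅h, ⁅h, y⁆⁆ = 0 → ⁅h, y⁆ = 0) (y : L) :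
    ∃ z t : L, ⁅h, t⁆ = 0 ∧ y = ⁅z, h⁆ + t := by
  have hdisj : Disjoint (LieAlgebra.ad ℂ L h).ker (LieAlgebra.ad ℂ L h).range := by
    rw [Submodule.disjoint_def]
    rintro _ hx ⟨z, rfl⟩
    exact hss z hx
  have htop := Submodule.eq_top_of_disjoint _ _
    (by rw [add_comm, LinearMap.finrank_range_add_finrank_ker]) hdisj
  have hy : y ∈ (LieAlgebra.ad ℂ L h).ker ⊔ (LieAlgebra.ad ℂ L h).range := htop ▸ Submodule.mem_top
  obtain ⟨t, ht, _, ⟨z, rfl⟩, rfl⟩ := Submodule.mem_sup.1 hy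
  exact ⟨-z, t, ht, by rw [LieAlgebra.ad_apply, neg_lie, lie_skew, add_comm]⟩

end FiniteDimensionalSlTwo

/-! ### Conjugacy by connectedness -/

section Conjugacy

open Topology Filter

theorem induction_compl_finite {F : Set ℂ} (hF : F.Finite) (P : ℂ → ℂ → Prop)
    (hloc : ∀ s ∉ F, ∀ᶠ t in 𝓝 s, t ∉ F → P s t)
    (htrans : ∀ r s t, P r s → P s t → P r t) (hsymm : ∀ s t, P s t → P t s) {s t : ℂ}
    (hs : s ∉ F) (ht : t ∉ F) : P s t := by
  have hconn : IsPreconnected Fᶜ :=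
    (hF.countable.isPathConnected_compl_of_one_lt_rank
      (by rw [Complex.rank_real_complex]; exact Cardinal.one_lt_two)).isConnected.isPreconnected
  refine hconn.induction₂ P (fun x hx => ?_) (fun x y z _ _ _ => htrans x y z)
    (fun x y _ _ => hsymm x y) hs ht
  exact eventually_nhdsWithin_iff.2 (hloc x hx)

variable {L : Type*} [LieRing L] [LieAlgebra ℂ L] [FiniteDimensional ℂ L]

theorem exists_vectorSpace_topology : ∃ _ : TopologicalSpace L,
    IsTopologicalAddGroup L ∧ ContinuousSMul ℂ L ∧ T2Space L := by
  let φ := (Module.finBasis ℂ L).equivFun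
  let τ : TopologicalSpace L := TopologicalSpace.induced φ inferInstance
  exact ⟨τ, topologicalAddGroup_induced φ, continuousSMul_induced φ,
    T2Space.of_injective_continuous φ.injective continuous_induced_dom⟩

theorem exists_lieEquiv_of_surjective {h e e₀ : L} (he : ⁅h, e⁆ = (2 : ℂ) • e)
    (he₀ : ⁅h, e₀⁆ = (2 : ℂ) • e₀)
    (hss : ∀ y : L, ⁅h, ⁅h, y⁆ - (2 : ℂ) • y⁆ = (2 : ℂ) • (⁅h, y⁆ - (2 : ℂ) • y) →
      ⁅h, y⁆ = (2 : ℂ) • y)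
    (hs : ∀ y : L, ⁅h, y⁆ = (2 : ℂ) • y → ∃ z : L, ⁅z, h⁆ = 0 ∧ ⁅z, e⁆ = y)
    (hs₀ : ∀ y : L, ⁅h, y⁆ = (2 : ℂ) • y → ∃ z : L, ⁅z, h⁆ = 0 ∧ ⁅z, e₀⁆ = y) :
    ∃ g : L ≃ₗ⁅ℂ⁆ L, g h = h ∧ g e = e₀ := by
  obtain ⟨_, _, _, _⟩ := exists_vectorSpace_topology (L := L)
  let E : Module.End ℂ L := LieAlgebra.ad ℂ L h - (2 : ℂ) • LinearMap.id
  have hE : ∀ y, E y = ⁅h, y⁆ - (2 : ℂ) • y := fun y => rfl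
  let S : Submodule ℂ L := (LieAlgebra.ad ℂ L h).ker
  have hS : ∀ z, z ∈ S ↔ ⁅z, h⁆ = 0 := by
    intro z
    rw [← lie_skew, neg_eq_zero]
    rfl
  have hdisj : Disjoint E.ker E.range := by
    rw [Submodule.disjoint_def]
    rintro _ hx ⟨z, rfl⟩
    refine sub_eq_zero.2 (hss z ?_)
    exact sub_eq_zero.1 hx
  have htop := Submodule.eq_top_of_disjoint _ _
    (by rw [add_comm, LinearMap.finrank_range_add_finrank_ker]) hdisj
  let p : ℂ → L := fun s => e + s • (e₀ - e)
  have hp : ∀ s, ⁅h, p s⁆ = (2 : ℂ) • p s := by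
    intro s
    simp only [p, lie_add, lie_smul, lie_sub, he, he₀]
    module
  let F : Set ℂ := {s | ¬ ∀ y, ⁅h, y⁆ = (2 : ℂ) • y → ∃ z : L, ⁅z, h⁆ = 0 ∧ ⁅z, p s⁆ = y}
  have hF : F.Finite := by
    have hcod : ∀ w : L, ⁅h, w⁆ = (2 : ℂ) • w →
        ∀ z : S, ((-LieAlgebra.ad ℂ L w) ∘ₗ S.subtype) z ∈ E.ker := by
      intro w hw z
      have hz : ⁅h, (z : L)⁆ = (0 : ℂ) • (z : L) := by
        rw [zero_smul]
        exact z.2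
      have h1 := lie_weight hz hw
      have h2 : ((-LieAlgebra.ad ℂ L w) ∘ₗ S.subtype) z = ⁅(z : L), w⁆ := lie_skew _ _
      rw [zero_add] at h1
      rw [h2, LinearMap.mem_ker, hE, h1, sub_self]
    let Φ : S →ₗ[ℂ] E.ker := LinearMap.codRestrict _ _ (hcod e he)
    let Ψ : S →ₗ[ℂ] E.ker := LinearMap.codRestrict _ _
      (hcod (e₀ - e) (by rw [lie_sub, he, he₀, smul_sub]))
    have hΦv : ∀ z : S, (Φ z : L) = ⁅(z : L), e⁆ := fun z => lie_skew _ _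
    have hΨv : ∀ z : S, (Ψ z : L) = ⁅(z : L), e₀ - e⁆ := fun z => lie_skew _ _
    have hΦ : Φ.range = ⊤ := by
      rw [LinearMap.range_eq_top]
      rintro ⟨y, hy⟩
      obtain ⟨z, hz, hzy⟩ := hs y (sub_eq_zero.1 hy)
      exact ⟨⟨z, (hS z).2 hz⟩, Subtype.ext ((hΦv _).trans hzy)⟩
    obtain ⟨R, hR⟩ := Φ.exists_rightInverse_of_surjective hΦ
    let N : Module.End ℂ E.ker := Ψ ∘ₗ R
    refine (N.finite_hasEigenvalue.image fun μ => -μ⁻¹).subset fun s hs => ?_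
    have hninj : ¬ Function.Injective (1 + s • N : Module.End ℂ E.ker) := by
      intro hinj
      refine hs fun y hy => ?_
      obtain ⟨w, hw⟩ := LinearMap.surjective_of_injective hinj ⟨y, sub_eq_zero.2 hy⟩
      refine ⟨R w, (hS _).1 (R w).2, ?_⟩
      have h1 := congrArg Subtype.val hw
      have h2 : Φ (R w) = w := LinearMap.congr_fun hR w
      simp only [p, lie_add, lie_smul]
      rw [← hΦv, ← hΨv, h2]
      exact h1
    simp only [injective_iff_map_eq_zero, not_forall] at hninj
    obtain ⟨w, hw, hw0⟩ := hninj
    have hw' : w + s • N w = 0 := hw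
    have hs0 : s ≠ 0 := by
      rintro rfl
      simp [hw0] at hw'
    refine ⟨-s⁻¹, Module.End.hasEigenvalue_of_hasEigenvector
      ⟨Module.End.mem_eigenspace_iff.2 ?_, hw0⟩, by simp⟩
    conv_rhs => rw [eq_neg_of_add_eq_zero_left hw']
    rw [smul_neg, neg_smul, neg_neg, smul_smul, inv_mul_cancel₀ hs0, one_smul]
  have hp0 : p 0 = e := by simp [p]
  have hp1 : p 1 = e₀ := by simp [p]
  have h0 : (0 : ℂ) ∉ F := by simpa [F, hp0] using hs
  have h1 : (1 : ℂ) ∉ F := by simpa [F, hp1] using hs₀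
  have key := induction_compl_finite hF (fun s t => ∃ g : L ≃ₗ⁅ℂ⁆ L, g h = h ∧ g (p s) = p t)
    ?_ ?_ ?_ h0 h1
  · rwa [hp0, hp1] at key
  · intro s hs
    have hcov := eventually_exists_lieEquiv S E.range (p s) (fun y => by
      have hy : y ∈ E.ker ⊔ E.range := htop ▸ Submodule.mem_top
      obtain ⟨a, ha, t, ht, rfl⟩ := Submodule.mem_sup.1 hy
      obtain ⟨z, hz, hza⟩ := not_not.1 hs a (sub_eq_zero.1 ha)
      exact ⟨z, (hS z).2 hz, t, ht, by rw [hza]⟩) Filter.univ_mem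
    have hpc : Continuous p := by fun_prop
    filter_upwards [hpc.continuousAt.eventually hcov]
    rintro t ⟨g, ⟨z, hz, hg⟩, r, hr, -, hgt⟩ -
    have hgh : g h = h := hg h ((hS z).1 hz)
    refine ⟨g, hgh, ?_⟩
    have hr0 : E (p s + r) = 0 := by
      have h2 : g ⁅h, p s + r⁆ = g ((2 : ℂ) • (p s + r)) := by
        rw [LieEquiv.map_lie, hgh, map_smul, hgt, hp t]
      exact sub_eq_zero.2 (g.injective h2)
    have hr' : r = 0 := by
      refine Submodule.disjoint_def.1 hdisj r ?_ hr
      rw [map_add] at hr0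
      have : E (p s) = 0 := sub_eq_zero.2 (hp s)
      rwa [this, zero_add] at hr0
    rw [← hgt, hr', add_zero]
  · rintro r s t ⟨g₁, h₁, h₂⟩ ⟨g₂, h₃, h₄⟩
    refine ⟨g₁.trans g₂, ?_, ?_⟩
    · rw [LieEquiv.trans_apply, h₁, h₃]
    · rw [LieEquiv.trans_apply, h₂, h₄]
  · rintro s t ⟨g, h₁, h₂⟩
    refine ⟨g.symm, ?_, ?_⟩
    · rw [← h₁, LieEquiv.symm_apply_apply, h₁]
    · rw [← h₂, LieEquiv.symm_apply_apply]

open LieAlgebra LieSubalgebra in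
theorem finite_setOf_not_isRegular {x y : L} (hy : IsRegular ℂ y) :
    {s : ℂ | ¬ IsRegular ℂ (x + s • (y - x))}.Finite := by
  classical
  let b := Module.finBasis ℂ L
  obtain ⟨q, hq⟩ : ∃ q : MvPolynomial (Fin (Module.finrank ℂ L)) ℂ,
      ∀ z : L, IsRegular ℂ z ↔ MvPolynomial.eval (b.repr z) q ≠ 0 :=
    ⟨_, fun z => isRegular_iff_coeff_polyCharpoly_rank_ne_zero ℂ b z⟩
  let Q : Polynomial ℂ := MvPolynomial.aeval
    (fun i => Polynomial.C (b.repr x i) + Polynomial.X * Polynomial.C (b.repr (y - x) i)) q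
  have hQ : ∀ s, Q.eval s = MvPolynomial.eval (b.repr (x + s • (y - x))) q := by
    intro s
    rw [← Polynomial.coe_aeval_eq_eval, ← MvPolynomial.coe_aeval_eq_eval]
    simp only [Q, RingHom.coe_coe]
    rw [← AlgHom.comp_apply, MvPolynomial.comp_aeval]
    congr 2
    ext i
    simp
  have hreg : ∀ s, IsRegular ℂ (x + s • (y - x)) ↔ Q.eval s ≠ 0 := fun s => by
    rw [hq, hQ]
  have hQ0 : Q ≠ 0 := by
    rintro h0
    have := (hreg 1).1 (by simpa using hy)
    simp [h0] at this
  refine (Polynomial.finite_setOfPred_isRoot hQ0).subset fun s hs => ?_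
  exact not_not.1 (fun h => hs ((hreg s).2 h))

open LieAlgebra in
theorem exists_isRegular_of_eventually [TopologicalSpace L] [IsTopologicalAddGroup L]
    [ContinuousSMul ℂ L] {P : L → Prop} {x : L} (hP : ∀ᶠ v in 𝓝 x, P v) :
    ∃ v, IsRegular ℂ v ∧ P v := by
  obtain ⟨y, hy⟩ := exists_isRegular ℂ L
  have hc : Continuous fun s : ℂ => x + s • (y - x) := by fun_prop
  have h1 : ∀ᶠ s in 𝓝 (0 : ℂ), P (x + s • (y - x)) :=
    hc.continuousAt.eventually (by simpa using hP)
  obtain ⟨s, hs, hs'⟩ := ((infinite_of_mem_nhds _ h1).sdiff (finite_setOf_not_isRegular hy)).nonempty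
  exact ⟨_, not_not.1 hs', hs⟩

open LieAlgebra LieSubalgebra in
theorem engel_eq_of_mem_engel {x y : L} (hx : IsRegular ℂ x) (hy : IsRegular ℂ y)
    (hyx : y ∈ engel ℂ x) : engel ℂ x = engel ℂ y := by
  rw [isRegular_iff_finrank_engel_eq_rank] at hx hy
  let Ex : {engel ℂ z | z ∈ engel ℂ x} := ⟨engel ℂ x, x, self_mem_engel _ _, rfl⟩
  have hbot : IsBot Ex := by
    refine engel_isBot_of_isMin ?_ (engel ℂ x) Ex le_rfl ?_
    · exact (Cardinal.natCast_le_aleph0).trans (Cardinal.infinite_iff.1 inferInstance)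
    · rintro ⟨_, z, hz, rfl⟩ hle
      refine le_of_eq (Subtype.ext ?_)
      refine (LieSubalgebra.toSubmodule_injective (Submodule.eq_of_le_of_finrank_le hle ?_)).symm
      exact hx.le.trans (rank_le_finrank_engel ℂ z)
  refine LieSubalgebra.toSubmodule_injective
    (Submodule.eq_of_le_of_finrank_le (hbot ⟨engel ℂ y, y, hyx, rfl⟩) ?_)
  exact (hy.trans hx.symm).le

open LieAlgebra LieSubalgebra in
theorem mem_engel_map_iff (g : L ≃ₗ⁅ℂ⁆ L) (x y : L) : g y ∈ engel ℂ (g x) ↔ y ∈ engel ℂ x := by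
  have h : ∀ n : ℕ, (ad ℂ L (g x) ^ n) (g y) = g ((ad ℂ L x ^ n) y) := by
    intro n
    induction n with
    | zero => rfl
    | succ n ih => rw [ad_pow_succ_apply, ad_pow_succ_apply, ih, LieEquiv.map_lie]
  simp [mem_engel_iff, h]

open LieAlgebra LieSubalgebra in
theorem isRegular_map_iff (g : L ≃ₗ⁅ℂ⁆ L) (x : L) : IsRegular ℂ (g x) ↔ IsRegular ℂ x := by
  rw [isRegular_iff_finrank_engel_eq_rank, isRegular_iff_finrank_engel_eq_rank]
  have h1 : (engel ℂ x).toSubmodule.map g.toLinearEquiv.toLinearMap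
      = (engel ℂ (g x)).toSubmodule := by
    ext w
    obtain ⟨w, rfl⟩ := g.surjective w
    rw [Submodule.mem_map]
    refine ⟨?_, fun h => ⟨w, (mem_engel_map_iff g x w).1 h, rfl⟩⟩
    rintro ⟨v, hv, hvw⟩
    rw [← hvw]
    exact (mem_engel_map_iff g x v).2 hv
  have h2 := LinearEquiv.finrank_eq
    ((g.toLinearEquiv.submoduleMap (engel ℂ x).toSubmodule).trans (LinearEquiv.ofEq _ _ h1))
  have h3 : Module.finrank ℂ (engel ℂ x) = Module.finrank ℂ (engel ℂ (g x)) := h2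
  rw [h3]

open LieAlgebra LieSubalgebra in
theorem exists_engel_conj {x y : L} (hx : IsRegular ℂ x) (hy : IsRegular ℂ y) :
    ∃ g : L ≃ₗ⁅ℂ⁆ L, ∀ z, g z ∈ engel ℂ y ↔ z ∈ engel ℂ x := by
  obtain ⟨_, _, _, _⟩ := exists_vectorSpace_topology (L := L)
  let p : ℂ → L := fun s => x + s • (y - x)
  have hp0 : p 0 = x := by simp [p]
  have hp1 : p 1 = y := by simp [p]
  have hpc : Continuous p := by fun_prop
  have key := induction_compl_finite (finite_setOf_not_isRegular (x := x) hy)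
    (fun s t => ∃ g : L ≃ₗ⁅ℂ⁆ L, ∀ z, g z ∈ engel ℂ (p t) ↔ z ∈ engel ℂ (p s)) ?_ ?_ ?_
    (s := 0) (t := 1) (by simpa using hx) (by simpa using hy)
  · rwa [hp0, hp1] at key
  · intro s hs
    have hs := not_not.1 hs
    have hcov := eventually_exists_lieEquiv ⊤ (engel ℂ (p s)).toSubmodule (p s) (fun w => by
      obtain ⟨n, hn, hn0⟩ := ((LieAlgebra.ad ℂ L (p s)).eventually_isCompl_ker_pow_range_pow.and
        (eventually_gt_atTop 0)).exists
      have hw : w ∈ (LieAlgebra.ad ℂ L (p s) ^ n).ker ⊔ (LieAlgebra.ad ℂ L (p s) ^ n).range :=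
        hn.sup_eq_top ▸ Submodule.mem_top
      obtain ⟨t, ht, _, ⟨z, rfl⟩, rfl⟩ := Submodule.mem_sup.1 hw
      obtain ⟨m, rfl⟩ := Nat.exists_eq_add_one_of_ne_zero hn0.ne'
      refine ⟨-(LieAlgebra.ad ℂ L (p s) ^ m) z, trivial, t, (mem_engel_iff ℂ _ _).2 ⟨_, ht⟩, ?_⟩
      rw [neg_lie, lie_skew, ad_pow_succ_apply, add_comm]) Filter.univ_mem
    filter_upwards [hpc.continuousAt.eventually hcov]
    rintro t ⟨g, -, r, hr, -, hgt⟩ ht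
    have ht : IsRegular ℂ (p t) := not_not.1 ht
    have hmem : p s + r ∈ engel ℂ (p s) := add_mem (self_mem_engel ℂ _) hr
    have hreg : IsRegular ℂ (p s + r) := by
      rwa [← isRegular_map_iff g, hgt]
    refine ⟨g, fun z => ?_⟩
    rw [engel_eq_of_mem_engel hs hreg hmem, ← hgt, mem_engel_map_iff]
  · rintro r s t ⟨g₁, h₁⟩ ⟨g₂, h₂⟩
    exact ⟨g₁.trans g₂, fun z => by rw [LieEquiv.trans_apply, h₂, h₁]⟩
  · rintro s t ⟨g, h₁⟩
    exact ⟨g.symm, fun z => by rw [← h₁, LieEquiv.apply_symm_apply]⟩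

open LieAlgebra LieSubalgebra in
theorem exists_isRegular_add (u : L) (hss : ∀ y : L, ⁅u, ⁅u, y⁆⁆ = 0 → ⁅u, y⁆ = 0) :
    ∃ t, ⁅u, t⁆ = 0 ∧ IsRegular ℂ (u + t) := by
  obtain ⟨_, _, _, _⟩ := exists_vectorSpace_topology (L := L)
  have hcov := eventually_exists_lieEquiv ⊤ (LieAlgebra.ad ℂ L u).ker u (fun w => by
    obtain ⟨z, t, ht, h⟩ := exists_lie_eq_zero_add u hss w
    exact ⟨z, trivial, t, ht, h⟩) Filter.univ_mem
  obtain ⟨v, hv, g, -, t, ht, -, rfl⟩ := exists_isRegular_of_eventually hcov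
  exact ⟨t, ht, (isRegular_map_iff g _).1 hv⟩

open LieAlgebra LieSubalgebra in
/-- An element with semisimple adjoint action is conjugate to an element of the Cartan subalgebra
centralizing `ρ`. -/
theorem exists_lieEquiv_lie_eq_zero {h ρ : L} (hss : ∀ y : L, ⁅h, ⁅h, y⁆⁆ = 0 → ⁅h, y⁆ = 0)
    (hρ : ∀ y : L, ⁅ρ, ⁅ρ, y⁆⁆ = 0 → ⁅ρ, y⁆ = 0)
    (hab : ∀ x y : L, ⁅ρ, x⁆ = 0 → ⁅ρ, y⁆ = 0 → ⁅x, y⁆ = 0) :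
    ∃ g : L ≃ₗ⁅ℂ⁆ L, ⁅ρ, g h⁆ = 0 := by
  obtain ⟨t, ht, hreg⟩ := exists_isRegular_add h hss
  obtain ⟨r, hr, hreg'⟩ := exists_isRegular_add ρ hρ
  have hh : h ∈ engel ℂ (h + t) := by
    refine (mem_engel_iff ℂ _ _).2 ⟨1, ?_⟩
    rw [pow_one, ad_apply, add_lie, lie_self, zero_add, ← lie_skew, ht, neg_zero]
  have hρr : ρ ∈ engel ℂ (ρ + r) := by
    refine (mem_engel_iff ℂ _ _).2 ⟨1, ?_⟩
    rw [pow_one, ad_apply, add_lie, lie_self, zero_add, ← lie_skew, hr, neg_zero]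
  have hpow : ∀ n y, (ad ℂ L ρ ^ n) y = 0 → ⁅ρ, y⁆ = 0 := by
    intro n
    induction n with
    | zero =>
      intro y hy
      rw [show y = 0 from hy, lie_zero]
    | succ n ih =>
      intro y hy
      rw [pow_succ] at hy
      exact hρ y (ih _ hy)
  have hle : (engel ℂ ρ).toSubmodule ≤ (engel ℂ (ρ + r)).toSubmodule := by
    intro y hy
    obtain ⟨n, hn⟩ := (mem_engel_iff ℂ _ _).1 hy
    have h1 := hpow n y hn
    refine (mem_engel_iff ℂ _ _).2 ⟨1, ?_⟩
    rw [pow_one, ad_apply, add_lie, h1, hab r y hr h1, zero_add]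
  have heq : (engel ℂ ρ).toSubmodule = (engel ℂ (ρ + r)).toSubmodule := by
    refine Submodule.eq_of_le_of_finrank_le hle ?_
    exact ((isRegular_iff_finrank_engel_eq_rank ℂ _).1 hreg').le.trans (rank_le_finrank_engel ℂ ρ)
  obtain ⟨g, hg⟩ := exists_engel_conj hreg hreg'
  refine ⟨g, ?_⟩
  have h2 : g h ∈ (engel ℂ (ρ + r)).toSubmodule := (hg h).2 hh
  rw [← heq] at h2
  obtain ⟨n, hn⟩ := (mem_engel_iff ℂ _ _).1 h2
  exact hpow n _ hn

end Conjugacy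

/-! ### Elements of the Cartan subalgebra -/

/-- The value on `v`, written in the basis of simple roots, of the functional taking the value
`a j` on the `j`-th simple root. -/
def deg (a v : Fin 4 → ℤ) : ℤ := ∑ j, v j * a j

theorem deg_add (a v w : Fin 4 → ℤ) : deg a (v + w) = deg a v + deg a w := by
  simp [deg, add_mul, Finset.sum_add_distrib]

theorem deg_neg (a v : Fin 4 → ℤ) : deg a (-v) = -deg a v := by simp [deg]

theorem deg_zero (a : Fin 4 → ℤ) : deg a 0 = 0 := by simp [deg]

theorem deg_single (a : Fin 4 → ℤ) (i : Fin 4) : deg a (Pi.single i 1) = a i := by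
  simp [deg, Pi.single_apply]

theorem deg_reflect (a v : Fin 4 → ℤ) (i : Fin 4) :
    deg a (reflect i v) = deg a v - a i * coroot i v := by
  simp only [deg, reflect, Pi.sub_apply, Pi.smul_apply, smul_eq_mul, sub_mul,
    Finset.sum_sub_distrib, Pi.single_apply, mul_ite, mul_one, mul_zero, ite_mul, zero_mul,
    Finset.sum_ite_eq', Finset.mem_univ, if_true]
  ring

section Labels

variable {L : Type*} [LieRing L] [LieAlgebra ℂ L]

/-- The element `t` acts on every weight space `wtSpace h v` as the scalar `deg a v`. -/
def HasLabels (h : Fin 4 → L) (t : L) (a : Fin 4 → ℤ) : Prop :=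
  ∀ v, ∀ x ∈ wtSpace h v, ⁅t, x⁆ = (deg a v : ℂ) • x

namespace IsChevalley

variable {h e f : Fin 4 → L}

theorem exists_labels (H : IsChevalley h e f) {t : L} (ht : t ∈ wtSpace h 0) :
    ∃ a : Fin 4 → ℂ, ∀ v, ∀ x ∈ wtSpace h v, ⁅t, x⁆ = (∑ j, v j * a j) • x := by
  rw [H.wtSpace_zero] at ht
  obtain ⟨c, rfl⟩ := (Submodule.mem_span_range_iff_exists_fun ℂ).1 ht
  refine ⟨fun j => ∑ i, c i * (CartanMatrix.F₄ i j : ℂ), fun v x hx => ?_⟩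
  rw [sum_lie]
  simp only [smul_lie, mem_wtSpace.1 hx, coroot, smul_smul, ← Finset.sum_smul]
  congr 1
  simp only [Int.cast_sum, Int.cast_mul, Finset.mul_sum]
  rw [Finset.sum_comm]
  exact Finset.sum_congr rfl fun j _ => Finset.sum_congr rfl fun i _ => by ring

end IsChevalley

theorem exists_hasLabels (h : Fin 4 → L) (a : Fin 4 → ℤ) : ∃ t : L, HasLabels h t a := by
  let c : Fin 4 → ℤ := ![2 * a 0 + 3 * a 1 + 2 * a 2 + a 3, 3 * a 0 + 6 * a 1 + 4 * a 2 + 2 * a 3,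
    4 * a 0 + 8 * a 1 + 6 * a 2 + 3 * a 3, 2 * a 0 + 4 * a 1 + 3 * a 2 + 2 * a 3]
  refine ⟨∑ i, (c i : ℂ) • h i, fun v x hx => ?_⟩
  rw [sum_lie]
  simp only [smul_lie, mem_wtSpace.1 hx, smul_smul, ← Finset.sum_smul]
  congr 1
  norm_cast
  simp only [coroot, deg, CartanMatrix.F₄, Fin.sum_univ_four, Matrix.of_apply, Matrix.cons_val, c]
  ring

section Basis

variable {h : Fin 4 → L} {b : Module.Basis (Fin 4 ⊕ Fin roots.length) ℂ L} {d : L} {a : Fin 4 → ℤ}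

theorem repr_lie (hb : ∀ i, b i ∈ wtSpace h (idxWt i)) (hd : HasLabels h d a) (x : L) (i) :
    b.repr ⁅d, x⁆ i = deg a (idxWt i) * b.repr x i := by
  have key : (b.coord i) ∘ₗ (LieAlgebra.ad ℂ L d)
      = (deg a (idxWt i) : ℂ) • b.coord i := by
    refine b.ext fun j => ?_
    change b.repr ⁅d, b j⁆ i = deg a (idxWt i) * b.repr (b j) i
    rw [hd _ _ (hb j), map_smul, Finsupp.smul_apply, smul_eq_mul, b.repr_self]
    rcases eq_or_ne j i with rfl | hji
    · rfl
    · rw [Finsupp.single_eq_of_ne' hji, mul_zero, mul_zero]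
  exact LinearMap.congr_fun key x

theorem repr_eq_zero (hb : ∀ i, b i ∈ wtSpace h (idxWt i)) (hd : HasLabels h d a)
    {k : ℂ} {x : L} (hx : ⁅d, x⁆ = k • x) {i}
    (hi : (deg a (idxWt i) : ℂ) ≠ k) : b.repr x i = 0 := by
  have h1 := repr_lie hb hd x i
  rw [hx, map_smul, Finsupp.smul_apply, smul_eq_mul] at h1
  exact (mul_eq_mul_right_iff.1 h1).resolve_left hi.symm

theorem mem_of_lie_eq_smul (hb : ∀ i, b i ∈ wtSpace h (idxWt i)) (hd : HasLabels h d a)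
    {k : ℂ} {x : L} (hx : ⁅d, x⁆ = k • x) {P : Submodule ℂ L}
    (hP : ∀ i, (deg a (idxWt i) : ℂ) = k → b i ∈ P) : x ∈ P := by
  rw [← b.sum_repr x]
  refine P.sum_mem fun i _ => ?_
  by_cases hi : (deg a (idxWt i) : ℂ) = k
  · exact P.smul_mem _ (hP i hi)
  · rw [repr_eq_zero hb hd hx hi, zero_smul]
    exact P.zero_mem

end Basis

end Labels

/-! ### Dominant neutral elements -/

section Dominant

variable {L : Type*} [LieRing L] [LieAlgebra ℂ L]

/-- An `sl₂`-triple of elements of a complex Lie algebra. -/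
structure IsTriple (d x y : L) : Prop where
  dx : ⁅d, x⁆ = (2 : ℂ) • x
  dy : ⁅d, y⁆ = (-2 : ℂ) • y
  xy : ⁅x, y⁆ = d

theorem IsTriple.map {d x y : L} (T : IsTriple d x y) (g : L ≃ₗ⁅ℂ⁆ L) :
    IsTriple (g d) (g x) (g y) where
  dx := by rw [← LieEquiv.map_lie, T.dx, map_smul]
  dy := by rw [← LieEquiv.map_lie, T.dy, map_smul]
  xy := by rw [← LieEquiv.map_lie, T.xy]

theorem IsTriple.exists_int [FiniteDimensional ℂ L] {d x y : L} (T : IsTriple d x y) {k : ℂ} {z : L}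
    (hz0 : z ≠ 0) (hz : ⁅d, z⁆ = k • z) : ∃ n : ℤ, k = n := by
  by_cases hx0 : x = 0
  · have hd : d = 0 := by rw [← T.xy, hx0, zero_lie]
    rw [hd, zero_lie, eq_comm, smul_eq_zero] at hz
    exact ⟨0, by simpa [hz0] using hz⟩
  obtain ⟨n, hn⟩ := exists_ad_pow_eq_zero two_ne_zero T.dx
  classical
  have hex : ∃ n, (LieAlgebra.ad ℂ L x ^ n) z = 0 := ⟨n, by rw [hn]; rfl⟩
  obtain ⟨m, hm⟩ : ∃ m, Nat.find hex = m + 1 := by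
    refine Nat.exists_eq_add_one_of_ne_zero fun h0 => hz0 ?_
    have := Nat.find_spec hex
    rwa [h0] at this
  let w := (LieAlgebra.ad ℂ L x ^ m) z
  have hw0 : w ≠ 0 := Nat.find_min hex (by rw [hm]; exact Nat.lt_succ_self m)
  have hxw : ⁅x, w⁆ = 0 := by
    rw [← ad_pow_succ_apply, ← hm]
    exact Nat.find_spec hex
  have t : IsSl2Triple d x y :=
    { h_ne_zero := by
        intro h0
        have := T.dx
        rw [h0, zero_lie, eq_comm, smul_eq_zero] at this
        exact hx0 (this.resolve_left two_ne_zero)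
      lie_e_f := T.xy
      lie_h_e_nsmul := by rw [T.dx]; module
      lie_h_f_nsmul := by rw [T.dy]; module }
  have P : t.HasPrimitiveVectorWith w (m * 2 + k) := ⟨hw0, ad_pow_weight T.dx hz m, hxw⟩
  obtain ⟨n, hn⟩ := P.exists_nat
  exact ⟨n - m * 2, by push_cast; linear_combination hn⟩

namespace IsChevalley

variable {h e f : Fin 4 → L}

theorem mem_zero_of_lie_eq_zero [Nontrivial L] (H : IsChevalley h e f) {r x : L}
    (hr : HasLabels h r 1) (hx : ⁅r, x⁆ = 0) : x ∈ wtSpace h 0 := by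
  obtain ⟨b, -, hb⟩ := H.exists_basis
  refine mem_of_lie_eq_smul hb hr (k := 0) (by rw [hx, zero_smul]) fun i hi => ?_
  have key : ∀ i : Fin 4 ⊕ Fin roots.length, deg 1 (idxWt i) = 0 → idxWt i = 0 := by
    decide +kernel
  rw [← key i (by exact_mod_cast hi)]
  exact hb i

theorem lie_eq_zero_of_mem_zero (H : IsChevalley h e f) {x y : L} (hx : x ∈ wtSpace h 0)
    (hy : y ∈ wtSpace h 0) : ⁅x, y⁆ = 0 := by
  obtain ⟨a, ha⟩ := H.exists_labels hx
  rw [ha 0 y hy]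
  simp

theorem exists_lieEquiv_mem_zero [Nontrivial L] (H : IsChevalley h e f) {d x y : L}
    (T : IsTriple d x y) : ∃ g : L ≃ₗ⁅ℂ⁆ L, g d ∈ wtSpace h 0 := by
  have := H.finiteDimensional
  obtain ⟨b, -, hb⟩ := H.exists_basis
  obtain ⟨r, hr⟩ := exists_hasLabels h 1
  have hdd : ∀ z : L, ⁅d, ⁅d, z⁆⁆ = 0 → ⁅d, z⁆ = 0 := fun z hz => by
    simpa using lie_eq_smul_of_sq T.dx T.dy T.xy 0 z (by simpa using hz)
  have hrr : ∀ z : L, ⁅r, ⁅r, z⁆⁆ = 0 → ⁅r, z⁆ = 0 := fun z hz => by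
    refine b.repr.injective (Finsupp.ext fun i => ?_)
    have h1 := congrArg (fun w => b.repr w i) hz
    simpa [repr_lie hb hr] using h1
  obtain ⟨g, hg⟩ := exists_lieEquiv_lie_eq_zero hdd hrr
    (fun x y hx hy => H.lie_eq_zero_of_mem_zero (H.mem_zero_of_lie_eq_zero hr hx)
      (H.mem_zero_of_lie_eq_zero hr hy))
  exact ⟨g, H.mem_zero_of_lie_eq_zero hr hg⟩

theorem exists_hasLabels_of_mem_zero [Nontrivial L] (H : IsChevalley h e f) {d x y : L}
    (T : IsTriple d x y) (hd : d ∈ wtSpace h 0) : ∃ a, HasLabels h d a := by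
  have := H.finiteDimensional
  obtain ⟨a, ha⟩ := H.exists_labels hd
  have hInt : ∀ i, ∃ n : ℤ, a i = n := fun i => by
    refine T.exists_int (H.e_ne_zero i) ?_
    rw [ha _ _ (H.e_mem i)]
    simp [Pi.single_apply]
  choose n hn using hInt
  refine ⟨n, fun v x hx => ?_⟩
  rw [ha v x hx, deg]
  push_cast
  simp only [hn]

theorem exists_dominant [Nontrivial L] (H : IsChevalley h e f) (N : ℕ) : ∀ (d : L) (a : Fin 4 → ℤ),
    HasLabels h d a → (posRoots.toFinset.filter fun v => deg a v < 0).card ≤ N →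
    ∃ (g : L ≃ₗ⁅ℂ⁆ L) (a' : Fin 4 → ℤ), (∀ i, 0 ≤ a' i) ∧ HasLabels h (g d) a' := by
  induction N with
  | zero =>
    intro d a hd hN
    refine ⟨LieEquiv.refl, a, fun i => ?_, hd⟩
    by_contra! hi
    have h1 : ∀ i : Fin 4, Pi.single i 1 ∈ posRoots := by decide +kernel
    have := Finset.filter_eq_empty_iff.1 (Finset.card_eq_zero.1 (Nat.le_zero.1 hN))
      (List.mem_toFinset.2 (h1 i))
    exact this (by rwa [deg_single])
  | succ N ih =>
    intro d a hd hN
    by_cases hdom : ∀ i, 0 ≤ a i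
    · exact ⟨LieEquiv.refl, a, hdom, hd⟩
    push Not at hdom
    obtain ⟨i, hi⟩ := hdom
    obtain ⟨g, hg, hgw⟩ := H.exists_weyl i
    have hgd : g d = d - (a i : ℂ) • h i := by
      refine hg d (a i) ?_ ?_
      · rw [hd _ _ (H.e_mem i), deg_single]
      · rw [hd _ _ (H.f_mem i), deg_neg, deg_single]
        push_cast
        rw [neg_smul]
    let a' : Fin 4 → ℤ := fun j => deg a (reflect i (Pi.single j 1))
    have ha' : ∀ v, deg a' v = deg a (reflect i v) := by
      intro v
      simp only [deg_reflect, deg_single, a', coroot_single]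
      simp only [deg, coroot, mul_sub, Finset.sum_sub_distrib, Finset.mul_sum]
      congr 1
      exact Finset.sum_congr rfl fun j _ => by ring
    have hlab : HasLabels h (g d) a' := by
      intro v x hx
      rw [ha', deg_reflect, hgd, sub_lie, smul_lie, hd v x hx, mem_wtSpace.1 hx i]
      push_cast
      module
    have hcard : (posRoots.toFinset.filter fun v => deg a' v < 0).card ≤ N := by
      have hpos : ∀ v ∈ posRoots, ∀ i : Fin 4, v ≠ Pi.single i 1 →
          reflect i v ∈ posRoots ∧ reflect i v ≠ Pi.single i 1 := by decide +kernel
      have hself : reflect i (Pi.single i 1) = -Pi.single i 1 := by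
        rw [reflect, coroot_self]; module
      have hmem : Pi.single i 1 ∈ posRoots.toFinset.filter fun v => deg a v < 0 := by
        have h1 : ∀ i : Fin 4, Pi.single i 1 ∈ posRoots := by decide +kernel
        exact Finset.mem_filter.2 ⟨List.mem_toFinset.2 (h1 i), by rwa [deg_single]⟩
      refine le_trans ?_ (Nat.le_of_lt_succ ((Finset.card_erase_lt_of_mem hmem).trans_le hN))
      refine Finset.card_le_card_of_injOn (reflect i) ?_ ?_
      · intro v hv
        obtain ⟨hv, hv'⟩ := Finset.mem_filter.1 hv
        rw [ha'] at hv'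
        have hne : v ≠ Pi.single i 1 := by
          rintro rfl
          rw [hself, deg_neg, deg_single] at hv'
          lia
        have := hpos v (List.mem_toFinset.1 hv) i hne
        exact Finset.mem_erase.2 ⟨this.2, Finset.mem_filter.2 ⟨List.mem_toFinset.2 this.1, hv'⟩⟩
      · intro v _ w _ hvw
        rw [← reflect_reflect i v, hvw, reflect_reflect]
    obtain ⟨g', a'', hdom, hlab'⟩ := ih (g d) a' hlab hcard
    exact ⟨g.trans g', a'', hdom, by rwa [LieEquiv.trans_apply]⟩

theorem label_le_two [Nontrivial L] (H : IsChevalley h e f) {d x y : L} (T : IsTriple d x y)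
    {a : Fin 4 → ℤ} (ha : ∀ i, 0 ≤ a i) (hd : HasLabels h d a) (i : Fin 4) : a i ≤ 2 := by
  have := H.finiteDimensional
  obtain ⟨b, -, hb⟩ := H.exists_basis
  by_contra! hi
  obtain ⟨z, hz, hxz⟩ := exists_lie_eq_of_pos T.dx T.dy T.xy (m := a i) (by lia)
    (y := e i) (by rw [hd _ _ (H.e_mem i), deg_single])
  have hnon : ∀ i : Fin 4 ⊕ Fin roots.length,
      (∀ j, 0 ≤ idxWt i j ∧ 0 < deg 1 (idxWt i)) ∨ ∀ j, idxWt i j ≤ 0 := by decide +kernel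
  have hpos : ∀ i, 0 < deg a (idxWt i) → 1 ≤ deg 1 (idxWt i) := by
    intro i hi
    rcases hnon i with h1 | h1
    · exact (h1 0).2
    · refine absurd hi (not_lt.2 (Finset.sum_nonpos fun j _ => ?_))
      exact mul_nonpos_of_nonpos_of_nonneg (h1 j) (ha j)
  let P : Submodule ℂ L := ⨆ (v) (_ : v ≠ Pi.single i 1), wtSpace h v
  refine H.e_ne_zero i (Submodule.disjoint_def.1 (H.iSupIndep_wtSpace (Pi.single i 1)) _
    (H.e_mem i) ?_)
  change e i ∈ P
  rw [← hxz]
  suffices h1 : x ∈ P.comap (-LieAlgebra.ad ℂ L z) by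
    have h2 : -⁅z, x⁆ ∈ P := h1
    rwa [lie_skew] at h2
  refine mem_of_lie_eq_smul hb hd T.dx fun k hk => ?_
  change -⁅z, b k⁆ ∈ P
  rw [lie_skew]
  suffices h1 : z ∈ P.comap (LieAlgebra.ad ℂ L (b k)) from h1
  refine mem_of_lie_eq_smul hb hd hz fun l hl => ?_
  change ⁅b k, b l⁆ ∈ P
  have hk1 := hpos k (by have : deg a (idxWt k) = 2 := by exact_mod_cast hk
                         lia)
  have hl1 := hpos l (by have : deg a (idxWt l) = a i - 2 := by exact_mod_cast hl
                         lia)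
  refine Submodule.mem_iSup_of_mem _ (Submodule.mem_iSup_of_mem ?_ (lie_mem_wtSpace (hb k) (hb l)))
  intro h0
  have := congrArg (deg 1) h0
  rw [deg_add, deg_single, Pi.one_apply] at this
  lia

end IsChevalley

end Dominant

/-! ### A criterion for not lying in the derived subalgebra of the centralizer -/

section Unreachable

variable {L : Type*} [LieRing L] [LieAlgebra ℂ L]

/-- The vectors of weight `k` for `d` in the centralizer of `x`. -/
def grCent (d x : L) (k : ℂ) : Submodule ℂ L :=
  (LieAlgebra.ad ℂ L x).ker ⊓ Module.End.eigenspace (LieAlgebra.ad ℂ L d) k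

theorem mem_grCent {d x z : L} {k : ℂ} : z ∈ grCent d x k ↔ ⁅x, z⁆ = 0 ∧ ⁅d, z⁆ = k • z :=
  and_congr Iff.rfl Module.End.mem_eigenspace_iff

theorem killingForm_lie (x y z : L) : killingForm ℂ L x ⁅y, z⁆ = killingForm ℂ L ⁅x, y⁆ z :=
  (LieModule.traceForm_apply_lie_apply ℂ L L x y z).symm

theorem killingForm_eq_zero {d D z : L} {k : ℂ} (hk : k ≠ 0) (hD : ⁅d, D⁆ = 0)
    (hz : ⁅d, z⁆ = k • z) : killingForm ℂ L D z = 0 := by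
  have h1 := killingForm_lie D d z
  rw [← lie_skew D d, hD, hz, neg_zero, map_smul, map_zero, LinearMap.zero_apply, smul_eq_mul] at h1
  exact (mul_eq_zero.1 h1).resolve_left hk

variable [FiniteDimensional ℂ L]

theorem ker_le_iSup_grCent {d x y : L} (T : IsTriple d x y)
    (hss : ⨆ k, Module.End.eigenspace (LieAlgebra.ad ℂ L d) k = ⊤) :
    (LieAlgebra.ad ℂ L x).ker ≤ ⨆ k, grCent d x k := by
  refine (Submodule.eq_iSup_inf_genEigenspace (k := 1) (fun z hz => ?_) hss).le
  change ⁅x, ⁅d, z⁆⁆ = 0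
  have hz : ⁅x, z⁆ = 0 := hz
  have h1 := leibniz_lie d x z
  rw [hz, T.dx, smul_lie, hz, lie_zero, smul_zero, zero_add] at h1
  exact h1.symm

theorem notMem_span_of_killingForm {d x y D : L} (T : IsTriple d x y)
    (hss : ⨆ k, Module.End.eigenspace (LieAlgebra.ad ℂ L d) k = ⊤)
    (hD : ∀ z : L, ⁅d, z⁆ = 0 → ⁅D, z⁆ = 0) (hDd : killingForm ℂ L D d ≠ 0)
    (h1 : ∀ u v : L, ⁅x, u⁆ = 0 → ⁅x, v⁆ = 0 → ⁅d, u⁆ = u → ⁅d, v⁆ = v →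
      ⁅D, ⁅u, v⁆⁆ = 0) :
    x ∉ Submodule.span ℂ {z | ∃ u ∈ (LieAlgebra.ad ℂ L x).ker, ∃ v ∈ (LieAlgebra.ad ℂ L x).ker,
      ⁅u, v⁆ = z} := by
  have hdD : ⁅d, D⁆ = 0 := by
    rw [← lie_skew, hD d (lie_self d), neg_zero]
  let φ : L →ₗ[ℂ] ℂ := killingForm ℂ L D ∘ₗ (-LieAlgebra.ad ℂ L y)
  have hφ : ∀ z, φ z = killingForm ℂ L D ⁅z, y⁆ := fun z =>
    congrArg (killingForm ℂ L D) (lie_skew z y)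
  have hφ' : ∀ z, φ z = killingForm ℂ L ⁅D, z⁆ y := fun z => by rw [hφ, killingForm_lie]
  have hzero : ∀ u v : L, ⁅d, u⁆ = 0 → ⁅x, u⁆ = 0 → φ ⁅u, v⁆ = 0 := by
    intro u v hu hxu
    have huy : ⁅u, y⁆ = 0 := by
      refine eq_zero_of_lie_eq_zero_of_neg T.dx T.dy T.xy (m := -2) (by norm_num) ?_ ?_
      · have := lie_weight (a := 0) (by rw [hu, zero_smul]) T.dy
        rw [this]; push_cast; rw [zero_add]
      · rw [leibniz_lie, hxu, zero_lie, zero_add, T.xy, ← lie_skew, hu, neg_zero]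
    rw [hφ, lie_lie, huy, lie_zero, sub_zero, killingForm_lie, hD u hu, map_zero,
      LinearMap.zero_apply]
  intro hx
  refine hDd ?_
  suffices hle : Submodule.span ℂ {z | ∃ u ∈ (LieAlgebra.ad ℂ L x).ker,
      ∃ v ∈ (LieAlgebra.ad ℂ L x).ker, ⁅u, v⁆ = z} ≤ φ.ker by
    have h2 : φ x = 0 := hle hx
    rwa [hφ, T.xy] at h2
  have main : ∀ k l : ℂ, ∀ u ∈ grCent d x k, ∀ v ∈ grCent d x l, φ ⁅u, v⁆ = 0 := by
    intro k l u hu v hv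
    obtain ⟨hxu, hdu⟩ := mem_grCent.1 hu
    obtain ⟨hxv, hdv⟩ := mem_grCent.1 hv
    by_cases hu0 : u = 0
    · rw [hu0, zero_lie, map_zero]
    by_cases hv0 : v = 0
    · rw [hv0, lie_zero, map_zero]
    obtain ⟨k, rfl⟩ := T.exists_int hu0 hdu
    obtain ⟨l, rfl⟩ := T.exists_int hv0 hdv
    have hk : 0 ≤ k := by
      by_contra! hk
      exact hu0 (eq_zero_of_lie_eq_zero_of_neg T.dx T.dy T.xy hk hdu hxu)
    have hl : 0 ≤ l := by
      by_contra! hl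
      exact hv0 (eq_zero_of_lie_eq_zero_of_neg T.dx T.dy T.xy hl hdv hxv)
    by_cases hkl : k + l = 2
    · obtain rfl | rfl | rfl : k = 0 ∨ k = 1 ∨ k = 2 := by lia
      · exact hzero u v (by simpa using hdu) hxu
      · obtain rfl : l = 1 := by lia
        rw [hφ', h1 u v hxu hxv (by simpa using hdu) (by simpa using hdv), map_zero,
          LinearMap.zero_apply]
      · obtain rfl : l = 0 := by lia
        rw [← lie_skew, map_neg, hzero v u (by simpa using hdv) hxv, neg_zero]
    · rw [hφ]
      refine killingForm_eq_zero (k := (k : ℂ) + l + -2) ?_ hdD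
        (lie_weight (lie_weight hdu hdv) T.dy)
      intro h0
      refine hkl ?_
      have : (k : ℂ) + l = 2 := by linear_combination h0
      exact_mod_cast this
  refine Submodule.span_le.2 ?_
  rintro _ ⟨u, hu, v, hv, rfl⟩
  change φ ⁅u, v⁆ = 0
  replace hu := ker_le_iSup_grCent T hss hu
  replace hv := ker_le_iSup_grCent T hss hv
  induction hu using Submodule.iSup_induction' with
  | mem k u hu =>
    induction hv using Submodule.iSup_induction' with
    | mem l v hv => exact main k l u hu v hv
    | zero => rw [lie_zero, map_zero]
    | add v w _ _ hv hw => rw [lie_add, map_add, hv, hw, add_zero]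
  | zero => rw [zero_lie, map_zero]
  | add u w _ _ hu hw => rw [add_lie, map_add, hu, hw, add_zero]

end Unreachable

/-! ### Counting roots -/

/-- The weight of the `i`-th basis vector lies in degree `k` for `a` and in degree at least `p`
for `m`. -/
def topIdx (a m : Fin 4 → ℤ) (k p : ℤ) : Finset (Fin 4 ⊕ Fin roots.length) :=
  Finset.univ.filter fun i => deg a (idxWt i) = k ∧ p ≤ deg m (idxWt i)

/-- Adding a weight of degree two for `a` to a weight of degree `k` for `a` and of degree less
than `p` for `m` gives a degree less than `q` for `m`. -/
def DegLT (a m : Fin 4 → ℤ) (k p q : ℤ) : Prop :=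
  ∀ i, deg a (idxWt i) = k → deg m (idxWt i) < p → ∀ j, deg a (idxWt j) = 2 →
    deg m (idxWt i) + deg m (idxWt j) < q

instance (a m : Fin 4 → ℤ) (k p q : ℤ) : Decidable (DegLT a m k p q) := by
  unfold DegLT; infer_instance

/-- The centralizer of a nilpotent element with labels `a` has components of weight one which
commute with the element with labels `m`. -/
def CommCrit (a m : Fin 4 → ℤ) : Prop :=
  (∀ i, deg a (idxWt i) = 0 → deg m (idxWt i) = 0) ∧
    (∑ i, deg m (idxWt i) * deg a (idxWt i) ≠ 0) ∧
    (∀ i, deg a (idxWt i) = 1 → 0 ≤ deg m (idxWt i)) ∧ DegLT a m 1 1 2 ∧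
    (topIdx a m 1 1).card ≤ (topIdx a m 3 2).card

instance (a m : Fin 4 → ℤ) : Decidable (CommCrit a m) := by
  unfold CommCrit; infer_instance

/-- The part of degree one of the centralizer of a nilpotent element with labels `a` is at most
one-dimensional. -/
def AbCrit (a : Fin 4 → ℤ) : Prop :=
  (∑ i, deg a (idxWt i) * deg a (idxWt i) ≠ 0) ∧
    (topIdx a 0 1 0).card ≤ (topIdx a 0 3 0).card + 1

instance (a : Fin 4 → ℤ) : Decidable (AbCrit a) := by
  unfold AbCrit; infer_instance

/-- There is no nilpotent element with labels `a`. -/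
def VoidCrit (a m : Fin 4 → ℤ) : Prop :=
  DegLT a m (-1) 0 1 ∧ (topIdx a m (-1) 0).card < (topIdx a m 1 1).card

instance (a m : Fin 4 → ℤ) : Decidable (VoidCrit a m) := by
  unfold VoidCrit; infer_instance

theorem crit_cases : ∀ a₀ a₁ a₂ a₃ : Fin 3,
    ![(a₀ : ℤ), (a₁ : ℤ), (a₂ : ℤ), (a₃ : ℤ)] ∈
      [![0, 0, 0, 0], ![1, 0, 0, 0], ![0, 0, 0, 1], ![0, 0, 1, 0], ![0, 1, 0, 0]] ∨
    AbCrit ![(a₀ : ℤ), (a₁ : ℤ), (a₂ : ℤ), (a₃ : ℤ)] ∨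
    (∃ m ∈ [![1, 0, 0, 0], ![0, 1, 0, 0], ![0, 0, 1, 0], ![0, 0, 0, 1], ![1, 0, 0, 1]],
      CommCrit ![(a₀ : ℤ), (a₁ : ℤ), (a₂ : ℤ), (a₃ : ℤ)] m) ∨
    VoidCrit ![(a₀ : ℤ), (a₁ : ℤ), (a₂ : ℤ), (a₃ : ℤ)] ![0, 0, 0, 1] := by
  decide +kernel

section Counting

variable {L : Type*} [LieRing L] [LieAlgebra ℂ L] {h : Fin 4 → L}
  {b : Module.Basis (Fin 4 ⊕ Fin roots.length) ℂ L}

theorem repr_eq_zero_of_mem_wtSpace (hb : ∀ i, b i ∈ wtSpace h (idxWt i)) {v : Fin 4 → ℤ} {x : L}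
    (hx : x ∈ wtSpace h v) {i} (hi : idxWt i ≠ v) : b.repr x i = 0 := by
  by_contra h0
  refine hi (coroot_injective fun j => ?_)
  by_contra hj
  have hdeg : ∀ w, deg (fun l => CartanMatrix.F₄ j l) w = coroot j w := fun w => by
    simp only [coroot, deg, mul_comm]
  have hlab : HasLabels h (h j) (fun l => CartanMatrix.F₄ j l) := fun v x hx => by
    rw [mem_wtSpace.1 hx j, hdeg]
  refine h0 (repr_eq_zero hb hlab (mem_wtSpace.1 hx j) ?_)
  rw [hdeg]
  exact fun h1 => hj (Int.cast_injective h1)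

theorem killingForm_eq_sum (hb : ∀ i, b i ∈ wtSpace h (idxWt i)) {d D : L} {a m : Fin 4 → ℤ}
    (hd : HasLabels h d a) (hD : HasLabels h D m) :
    killingForm ℂ L D d = (∑ i, deg m (idxWt i) * deg a (idxWt i) : ℤ) := by
  rw [killingForm_apply_apply, LinearMap.trace_eq_matrix_trace ℂ b, Matrix.trace]
  push_cast
  refine Finset.sum_congr rfl fun i _ => ?_
  rw [Matrix.diag_apply, LinearMap.toMatrix_apply, LinearMap.comp_apply]
  change b.repr ⁅D, ⁅d, b i⁆⁆ i = _
  rw [repr_lie hb hD, repr_lie hb hd, b.repr_self, Finsupp.single_eq_same, mul_one]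

theorem iSup_eigenspace_eq_top (hb : ∀ i, b i ∈ wtSpace h (idxWt i)) {d : L} {a : Fin 4 → ℤ}
    (hd : HasLabels h d a) : ⨆ k, Module.End.eigenspace (LieAlgebra.ad ℂ L d) k = ⊤ := by
  rw [eq_top_iff, ← b.span_eq, Submodule.span_le]
  rintro _ ⟨i, rfl⟩
  exact Submodule.mem_iSup_of_mem _ (Module.End.mem_eigenspace_iff.2 (hd _ _ (hb i)))

/-- The coordinates of a vector with indices in `A`. -/
noncomputable def coords (b : Module.Basis (Fin 4 ⊕ Fin roots.length) ℂ L)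
    (A : Finset (Fin 4 ⊕ Fin roots.length)) : L →ₗ[ℂ] (A → ℂ) :=
  LinearMap.funLeft ℂ ℂ Subtype.val ∘ₗ b.equivFun.toLinearMap

theorem coords_apply (A : Finset (Fin 4 ⊕ Fin roots.length)) (x : L) (i : A) :
    coords b A x i = b.repr x i := rfl

/-- The vector with prescribed coordinates with indices in `A`. -/
noncomputable def ofCoords (b : Module.Basis (Fin 4 ⊕ Fin roots.length) ℂ L)
    (A : Finset (Fin 4 ⊕ Fin roots.length)) : (A → ℂ) →ₗ[ℂ] L :=
  Fintype.linearCombination ℂ fun i : A => b i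

theorem coords_basis (A : Finset (Fin 4 ⊕ Fin roots.length)) (i : A) :
    coords b A (b i) = Pi.single i 1 := by
  ext j
  rw [coords_apply, b.repr_self, Pi.single_apply, Finsupp.single_apply]
  simp only [Subtype.ext_iff, eq_comm]

theorem coords_ofCoords (A : Finset (Fin 4 ⊕ Fin roots.length)) (c : A → ℂ) :
    coords b A (ofCoords b A c) = c := by
  have h1 : coords b A ∘ₗ ofCoords b A = LinearMap.id := by
    refine (Pi.basisFun ℂ A).ext fun i => ?_
    rw [Pi.basisFun_apply, LinearMap.comp_apply, ofCoords,
      Fintype.linearCombination_apply_single, one_smul, coords_basis, LinearMap.id_apply]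
  exact LinearMap.congr_fun h1 c

theorem ofCoords_mem (A : Finset (Fin 4 ⊕ Fin roots.length)) (c : A → ℂ) {P : Submodule ℂ L}
    (hP : ∀ i ∈ A, b i ∈ P) : ofCoords b A c ∈ P := by
  rw [ofCoords, Fintype.linearCombination_apply]
  exact P.sum_mem fun i _ => P.smul_mem _ (hP i i.2)

variable {d x y : L} {a : Fin 4 → ℤ}

theorem exists_leading_part [FiniteDimensional ℂ L] (hb : ∀ i, b i ∈ wtSpace h (idxWt i))
    (hd : HasLabels h d a) (T : IsTriple d x y) {m : Fin 4 → ℤ} {k p q : ℤ} (hk : 0 < k + 2)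
    (hdeg : DegLT a m k p q) :
    ∃ Θ : (topIdx a m k p → ℂ) →ₗ[ℂ] (topIdx a m (k + 2) q → ℂ), Function.Surjective Θ ∧
      ∀ z, ⁅d, z⁆ = (k : ℂ) • z →
        Θ (coords b (topIdx a m k p) z) = coords b (topIdx a m (k + 2) q) ⁅x, z⁆ := by
  let A := topIdx a m k p
  let B := topIdx a m (k + 2) q
  let Ψ : L →ₗ[ℂ] (B → ℂ) := coords b B ∘ₗ LieAlgebra.ad ℂ L x
  let Θ : (A → ℂ) →ₗ[ℂ] (B → ℂ) := Ψ ∘ₗ ofCoords b A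
  have hΘ : ∀ z, ⁅d, z⁆ = (k : ℂ) • z → Θ (coords b A z) = Ψ z := by
    intro z hz
    suffices h1 : z ∈ LinearMap.eqLocus (Θ ∘ₗ coords b A) Ψ from h1
    refine mem_of_lie_eq_smul hb hd hz fun i hi => ?_
    have hi : deg a (idxWt i) = k := by exact_mod_cast hi
    change Θ (coords b A (b i)) = Ψ (b i)
    by_cases hiA : i ∈ A
    · rw [coords_basis A ⟨i, hiA⟩, LinearMap.comp_apply, ofCoords,
        Fintype.linearCombination_apply_single, one_smul]
    · have hlt : deg m (idxWt i) < p := by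
        by_contra! hlt
        exact hiA (Finset.mem_filter.2 ⟨Finset.mem_univ _, hi, hlt⟩)
      have h0 : coords b A (b i) = 0 := by
        ext j
        rw [coords_apply, b.repr_self, Finsupp.single_eq_of_ne]
        · rfl
        · rintro rfl
          exact hiA j.2
      rw [h0, map_zero, eq_comm]
      ext r
      have hr := (Finset.mem_filter.1 r.2).2.2
      change b.coord r ⁅x, b i⁆ = 0
      suffices h1 : x ∈ (b.coord r ∘ₗ (-LieAlgebra.ad ℂ L (b i))).ker by
        have h2 : b.coord r (-⁅b i, x⁆) = 0 := h1
        rwa [lie_skew] at h2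
      refine mem_of_lie_eq_smul hb hd T.dx fun j hj => ?_
      have hj : deg a (idxWt j) = 2 := by exact_mod_cast hj
      change b.coord r (-⁅b i, b j⁆) = 0
      rw [map_neg, neg_eq_zero]
      refine repr_eq_zero_of_mem_wtSpace hb (lie_mem_wtSpace (hb i) (hb j)) fun h1 => ?_
      have := hdeg i hi hlt j hj
      rw [← deg_add, ← h1] at this
      lia
  refine ⟨Θ, fun c => ?_, hΘ⟩
  have hc : ofCoords b B c ∈
      Module.End.eigenspace (LieAlgebra.ad ℂ L d) (((k + 2 : ℤ) : ℂ)) := by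
    refine ofCoords_mem B c fun i hi => Module.End.mem_eigenspace_iff.2 ?_
    rw [← (Finset.mem_filter.1 hi).2.1]
    exact hd _ _ (hb i)
  obtain ⟨z, hz, hxz⟩ := exists_lie_eq_of_pos T.dx T.dy T.xy hk (Module.End.mem_eigenspace_iff.1 hc)
  refine ⟨coords b A z, ?_⟩
  have hz : ⁅d, z⁆ = (k : ℂ) • z := by rw [hz]; congr 2; lia
  rw [hΘ z hz]
  change coords b B ⁅x, z⁆ = c
  rw [hxz, coords_ofCoords]

theorem card_topIdx_le [FiniteDimensional ℂ L] (hb : ∀ i, b i ∈ wtSpace h (idxWt i))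
    (hd : HasLabels h d a) (T : IsTriple d x y) {m : Fin 4 → ℤ} {k p q : ℤ} (hk : 0 < k + 2)
    (hdeg : DegLT a m k p q) : (topIdx a m (k + 2) q).card ≤ (topIdx a m k p).card := by
  obtain ⟨Θ, hΘ, -⟩ := exists_leading_part hb hd T hk hdeg
  simpa using LinearMap.finrank_le_finrank_of_surjective hΘ

theorem CommCrit.lie_eq_zero [FiniteDimensional ℂ L] (hb : ∀ i, b i ∈ wtSpace h (idxWt i))
    (hd : HasLabels h d a) (T : IsTriple d x y) {m : Fin 4 → ℤ} (hm : CommCrit a m) {D : L}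
    (hD : HasLabels h D m) {z : L} (hz : ⁅d, z⁆ = z) (hxz : ⁅x, z⁆ = 0) : ⁅D, z⁆ = 0 := by
  obtain ⟨-, -, hnon, hdeg, hcard⟩ := hm
  obtain ⟨Θ, hΘ, hΘ'⟩ := exists_leading_part hb hd T (by norm_num) hdeg
  have hz : ⁅d, z⁆ = ((1 : ℤ) : ℂ) • z := by simpa using hz
  have hinj : Function.Injective Θ := by
    have h1 : (topIdx a m (1 + 2) 2).card = (topIdx a m 1 1).card :=
      le_antisymm (card_topIdx_le hb hd T (by norm_num) hdeg) hcard
    exact (LinearMap.injective_iff_surjective_of_finrank_eq_finrank (by simpa using h1.symm)).2 hΘ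
  have h0 : coords b (topIdx a m 1 1) z = 0 := by
    refine hinj ?_
    rw [hΘ' z hz, hxz, map_zero, map_zero]
  refine b.repr.injective (Finsupp.ext fun i => ?_)
  rw [repr_lie hb hD, map_zero, Finsupp.zero_apply]
  by_cases hi : deg a (idxWt i) = 1
  · by_cases hi' : deg m (idxWt i) = 0
    · rw [hi', Int.cast_zero, zero_mul]
    · have hmem : i ∈ topIdx a m 1 1 :=
        Finset.mem_filter.2 ⟨Finset.mem_univ _, hi, by have := hnon i hi; lia⟩
      rw [show b.repr z i = 0 from congrFun h0 ⟨i, hmem⟩, mul_zero]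
  · rw [repr_eq_zero hb hd hz (fun h1 => hi (Int.cast_injective h1)), mul_zero]

theorem AbCrit.lie_eq_zero [FiniteDimensional ℂ L] (hb : ∀ i, b i ∈ wtSpace h (idxWt i))
    (hd : HasLabels h d a) (T : IsTriple d x y) (ha : AbCrit a) {u v : L} (hu : ⁅d, u⁆ = u)
    (hv : ⁅d, v⁆ = v) (hxu : ⁅x, u⁆ = 0) (hxv : ⁅x, v⁆ = 0) : ⁅u, v⁆ = 0 := by
  have hdeg : DegLT a 0 1 0 0 := fun i _ hi => by simp [deg] at hi
  obtain ⟨Θ, hΘ, hΘ'⟩ := exists_leading_part hb hd T (by norm_num) hdeg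
  have hker : Module.finrank ℂ Θ.ker ≤ 1 := by
    have h1 := Θ.finrank_range_add_finrank_ker
    rw [LinearMap.range_eq_top.2 hΘ, finrank_top] at h1
    simp only [Module.finrank_fintype_fun_eq_card, Fintype.card_coe] at h1
    have h2 : (topIdx a 0 1 0).card ≤ (topIdx a 0 (1 + 2) 0).card + 1 := ha.2
    lia
  have hz : ∀ z : L, ⁅d, z⁆ = z → ⁅d, z⁆ = ((1 : ℤ) : ℂ) • z := fun z hz => by simpa using hz
  have hof : ∀ z : L, ⁅d, z⁆ = z → ofCoords b (topIdx a 0 1 0) (coords b (topIdx a 0 1 0) z) = z := by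
    intro z hdz
    suffices h1 : z ∈ LinearMap.eqLocus (ofCoords b (topIdx a 0 1 0) ∘ₗ coords b (topIdx a 0 1 0))
      LinearMap.id from h1
    refine mem_of_lie_eq_smul hb hd (hz z hdz) fun i hi => ?_
    have hi : deg a (idxWt i) = 1 := by exact_mod_cast hi
    have hmem : i ∈ topIdx a 0 1 0 := Finset.mem_filter.2 ⟨Finset.mem_univ _, hi, by simp [deg]⟩
    change ofCoords b (topIdx a 0 1 0) (coords b (topIdx a 0 1 0) (b i)) = b i
    rw [coords_basis _ ⟨i, hmem⟩, ofCoords, Fintype.linearCombination_apply_single, one_smul]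
  have hmem : ∀ z : L, ⁅d, z⁆ = z → ⁅x, z⁆ = 0 → coords b (topIdx a 0 1 0) z ∈ Θ.ker := by
    intro z hdz hxz
    rw [LinearMap.mem_ker, hΘ' z (hz z hdz), hxz, map_zero]
  obtain ⟨w, hw⟩ := finrank_le_one_iff.1 hker
  obtain ⟨s, hs⟩ := hw ⟨_, hmem u hu hxu⟩
  obtain ⟨t, ht⟩ := hw ⟨_, hmem v hv hxv⟩
  have hs' : s • (w : _ → ℂ) = coords b (topIdx a 0 1 0) u := congrArg Subtype.val hs
  have ht' : t • (w : _ → ℂ) = coords b (topIdx a 0 1 0) v := congrArg Subtype.val ht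
  rw [← hof u hu, ← hof v hv, ← hs', ← ht', map_smul, map_smul, smul_lie, lie_smul, lie_self,
    smul_zero, smul_zero]

theorem labels_of_mem_span [FiniteDimensional ℂ L] (hb : ∀ i, b i ∈ wtSpace h (idxWt i))
    (hd : HasLabels h d a) (T : IsTriple d x y) (ha : ∀ i, 0 ≤ a i ∧ a i ≤ 2)
    (hx : x ∈ Submodule.span ℂ {z | ∃ u ∈ (LieAlgebra.ad ℂ L x).ker,
      ∃ v ∈ (LieAlgebra.ad ℂ L x).ker, ⁅u, v⁆ = z}) :
    a ∈ [![0, 0, 0, 0], ![1, 0, 0, 0], ![0, 0, 0, 1], ![0, 0, 1, 0], ![0, 1, 0, 0]] := by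
  have hfin : ∀ i, ∃ n : Fin 3, a i = n := fun i => by
    obtain ⟨h1, h2⟩ := ha i
    exact ⟨⟨(a i).toNat, by lia⟩, by simp; lia⟩
  choose n hn using hfin
  have han : a = ![(n 0 : ℤ), (n 1 : ℤ), (n 2 : ℤ), (n 3 : ℤ)] := by
    ext i
    fin_cases i <;> simp [hn]
  have hss := iSup_eigenspace_eq_top hb hd
  rcases crit_cases (n 0) (n 1) (n 2) (n 3) with h1 | h1 | ⟨m, -, h1⟩ | h1 <;> rw [← han] at h1
  · exact h1
  · refine absurd hx (notMem_span_of_killingForm T hss (D := d) (fun z hz => hz) ?_ ?_)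
    · rw [killingForm_eq_sum hb hd hd]
      exact_mod_cast h1.1
    · intro u v hxu hxv hu hv
      rw [h1.lie_eq_zero hb hd T hu hv hxu hxv, lie_zero]
  · obtain ⟨D, hD⟩ := exists_hasLabels h m
    refine absurd hx (notMem_span_of_killingForm T hss (D := D) (fun z hz => ?_) ?_ ?_)
    · suffices h2 : z ∈ (LieAlgebra.ad ℂ L D).ker from h2
      refine mem_of_lie_eq_smul hb hd (k := 0) (by rw [hz, zero_smul]) fun i hi => ?_
      change ⁅D, b i⁆ = 0
      rw [hD _ _ (hb i), h1.1 i (by exact_mod_cast hi), Int.cast_zero, zero_smul]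
    · rw [killingForm_eq_sum hb hd hD]
      exact_mod_cast h1.2.1
    · intro u v hxu hxv hu hv
      rw [leibniz_lie, h1.lie_eq_zero hb hd T hD hu hxu, h1.lie_eq_zero hb hd T hD hv hxv, zero_lie,
        lie_zero, add_zero]
  · exact absurd h1.2 (not_lt.2 (card_topIdx_le hb hd T (by norm_num) h1.1))

end Counting

/-! ### Nilpotent elements in normal form -/

section Normal

variable {L : Type*} [LieRing L] [LieAlgebra ℂ L]

/-- The subalgebra generated by the part of degree one of the centralizer of `x` contains the
parts of all positive degrees of this centralizer. -/
def IsGenerated (d x : L) : Prop :=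
  ∀ k : ℤ, 1 ≤ k → ∀ z, ⁅x, z⁆ = 0 → ⁅d, z⁆ = (k : ℂ) • z →
    z ∈ LieSubalgebra.lieSpan ℂ L {z | ⁅x, z⁆ = 0 ∧ ⁅d, z⁆ = z}

theorem IsGenerated.of_map {d x : L} (g : L ≃ₗ⁅ℂ⁆ L) (hg : IsGenerated (g d) (g x)) :
    IsGenerated d x := by
  intro k hk z hxz hdz
  have h1 := hg k hk (g z) (by rw [← LieEquiv.map_lie, hxz, map_zero])
    (by rw [← LieEquiv.map_lie, hdz, map_smul])
  have h2 : LieSubalgebra.lieSpan ℂ L {z | ⁅g x, z⁆ = 0 ∧ ⁅g d, z⁆ = z} ≤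
      (LieSubalgebra.lieSpan ℂ L {z | ⁅x, z⁆ = 0 ∧ ⁅d, z⁆ = z}).comap (g.symm : L →ₗ⁅ℂ⁆ L) := by
    refine LieSubalgebra.lieSpan_le.2 fun w hw => LieSubalgebra.subset_lieSpan ⟨?_, ?_⟩
    · have := congrArg g.symm hw.1
      rwa [LieEquiv.map_lie, LieEquiv.symm_apply_apply, map_zero] at this
    · have := congrArg g.symm hw.2
      rwa [LieEquiv.map_lie, LieEquiv.symm_apply_apply] at this
  have h3 := h2 h1
  change g.symm (g z) ∈ LieSubalgebra.lieSpan ℂ L {z | ⁅x, z⁆ = 0 ∧ ⁅d, z⁆ = z} at h3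
  rwa [LieEquiv.symm_apply_apply] at h3

variable {h e f : Fin 4 → L}

namespace IsChevalley

theorem eq_zero_of_notMem_roots (H : IsChevalley h e f) {v : Fin 4 → ℤ} (hv : v ∉ roots)
    (hv0 : v ≠ 0) {x : L} (hx : x ∈ wtSpace h v) : x = 0 := by
  by_contra hx0
  exact hv (H.exists_smul hv0 hx hx0).1

theorem exists_lie_eq [Nontrivial L] (H : IsChevalley h e f) {v w u : Fin 4 → ℤ} (hv : v ∈ roots)
    (hw : w ∈ roots) (hu : u ∈ roots) (hvw : v + w = u) {x : L} (hx : x ∈ wtSpace h v)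
    (hx0 : x ≠ 0) {y : L} (hy : y ∈ wtSpace h u) : ∃ z ∈ wtSpace h w, ⁅x, z⁆ = y := by
  obtain ⟨z, hz, hz0⟩ := H.exists_ne_zero_of_mem_roots w hw
  subst hvw
  obtain ⟨c, hc⟩ := (H.exists_smul (fun h0 => zero_notMem_roots (h0 ▸ hu)) (lie_mem_wtSpace hx hz)
    (H.lie_ne_zero v hv w hw hu x hx z hz hx0 hz0)).2 y hy
  exact ⟨c • z, Submodule.smul_mem _ c hz, by rw [lie_smul, hc]⟩

end IsChevalley

/-- The roots `β i` of degree two for `a` are such that the sum of corresponding root vectors is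
a generic vector of degree two. The elements with labels `μ i` separate the `β i`. -/
structure NormalForm {n : ℕ} (a : Fin 4 → ℤ) (β μ : Fin n → Fin 4 → ℤ) : Prop where
  mem : ∀ i, β i ∈ roots
  deg_eq : ∀ i, deg a (β i) = 2
  deg_self : ∀ i, deg (μ i) (β i) ≠ 0
  deg_ne : ∀ i j, j ≠ i → deg (μ i) (β j) = 0
  cases : ∀ v ∈ roots, deg a v = 2 → (∃ i, v = β i) ∨
    ∃ i, v - β i ∈ roots ∧ ∀ j, j ≠ i → v - β i + β j ∉ roots ∧ v - β i + β j ≠ 0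

theorem idxWt_mem_roots {a : Fin 4 → ℤ} {k : ℤ} (hk : k ≠ 0) {i : Fin 4 ⊕ Fin roots.length}
    (hi : deg a (idxWt i) = k) : idxWt i ∈ roots := by
  rcases i with i | i
  · exact absurd (deg_zero a) (fun h0 => hk (hi ▸ h0))
  · exact List.get_mem _ _

variable {d x y : L} {a : Fin 4 → ℤ}

theorem NormalForm.exists_lieEquiv [Nontrivial L] (H : IsChevalley h e f) {n : ℕ}
    {β μ : Fin n → Fin 4 → ℤ} (N : NormalForm a β μ) (hd : HasLabels h d a) (T : IsTriple d x y) :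
    ∃ z : Fin n → L, (∀ i, z i ∈ wtSpace h (β i)) ∧ (∀ i, z i ≠ 0) ∧
      ∃ g : L ≃ₗ⁅ℂ⁆ L, g d = d ∧ g x = ∑ i, z i := by
  have := H.finiteDimensional
  obtain ⟨b, -, hb⟩ := H.exists_basis
  choose z hz hz0 using fun i => H.exists_ne_zero_of_mem_roots (β i) (N.mem i)
  refine ⟨z, hz, hz0, exists_lieEquiv_of_surjective T.dx ?_ ?_ ?_ ?_⟩
  · rw [lie_sum, Finset.smul_sum]
    refine Finset.sum_congr rfl fun i _ => ?_
    rw [hd _ _ (hz i), N.deg_eq]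
    norm_num
  · intro w hw
    exact_mod_cast lie_eq_smul_of_sq T.dx T.dy T.xy 2 w (by exact_mod_cast hw)
  · intro w hw
    obtain ⟨u, hu, hxu⟩ := exists_lie_eq_of_pos T.dx T.dy T.xy (m := 2) (by norm_num)
      (by exact_mod_cast hw)
    refine ⟨-u, ?_, ?_⟩
    · rw [neg_lie, lie_skew, hu]
      simp
    · rw [neg_lie, lie_skew, hxu]
  · intro w hw
    suffices h1 : w ∈ (LieAlgebra.ad ℂ L d).ker.map (LieAlgebra.ad ℂ L (∑ i, z i)) by
      obtain ⟨u, hu, rfl⟩ := h1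
      refine ⟨-u, ?_, ?_⟩
      · rw [neg_lie, lie_skew]
        exact hu
      · rw [neg_lie, lie_skew]
        rfl
    refine mem_of_lie_eq_smul hb hd hw fun i hi => ?_
    have hi : deg a (idxWt i) = 2 := by exact_mod_cast hi
    rcases N.cases _ (idxWt_mem_roots two_ne_zero hi) hi with ⟨j, hj⟩ | ⟨j, hj, hj'⟩
    · obtain ⟨t, ht⟩ := exists_hasLabels h (μ j)
      have htd : ⁅t, d⁆ = 0 := by
        have hd0 : d ∈ wtSpace h 0 := fun l => by
          rw [← lie_skew, hd 0 _ (H.h_mem l)]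
          simp [deg_zero, coroot_zero]
        rw [ht 0 d hd0, deg_zero, Int.cast_zero, zero_smul]
      have hβ0 : β j ≠ 0 := fun h0 => zero_notMem_roots (h0 ▸ N.mem j)
      obtain ⟨c, hc⟩ := (H.exists_smul hβ0 (hz j) (hz0 j)).2 (b i) (hj ▸ hb i)
      have htz : ⁅t, ∑ i, z i⁆ = (deg (μ j) (β j) : ℂ) • z j := by
        rw [lie_sum, Finset.sum_eq_single j, ht _ _ (hz j)]
        · intro l _ hl
          rw [ht _ _ (hz l), N.deg_ne j l hl, Int.cast_zero, zero_smul]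
        · simp
      have hm : (deg (μ j) (β j) : ℂ) ≠ 0 := by exact_mod_cast N.deg_self j
      refine ⟨-(c * (deg (μ j) (β j) : ℂ)⁻¹) • t, ?_, ?_⟩
      · change ⁅d, _⁆ = 0
        rw [lie_smul, ← lie_skew, htd, neg_zero, smul_zero]
      · change ⁅∑ i, z i, _⁆ = b i
        rw [lie_smul, ← lie_skew, htz, hc, smul_neg, neg_smul, neg_neg, smul_smul,
          inv_mul_cancel_right₀ hm]
    · obtain ⟨u, hu, hzu⟩ := H.exists_lie_eq (N.mem j) hj (idxWt_mem_roots two_ne_zero hi)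
        (by abel) (hz j) (hz0 j) (hb i)
      refine ⟨u, ?_, ?_⟩
      · change ⁅d, u⁆ = 0
        rw [hd _ _ hu, sub_eq_add_neg, deg_add, deg_neg, hi, N.deg_eq]
        simp
      · change ⁅∑ i, z i, u⁆ = b i
        rw [sum_lie, Finset.sum_eq_single j, hzu]
        · intro l _ hl
          refine H.eq_zero_of_notMem_roots (hj' l hl).1 (hj' l hl).2 ?_
          rw [add_comm]
          exact lie_mem_wtSpace (hz l) hu
        · simp

end Normal

/-- The roots of degree one for `a` whose sums with the `β i` are not roots. -/
def commRoots {n : ℕ} (a : Fin 4 → ℤ) (β : Fin n → Fin 4 → ℤ) : List (Fin 4 → ℤ) :=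
  roots.filter fun v => deg a v = 1 ∧ ∀ i, β i + v ∉ roots

section Generation

variable {L : Type*} [LieRing L] [LieAlgebra ℂ L] [Nontrivial L] {h e f : Fin 4 → L} {d x : L}
  {a : Fin 4 → ℤ}

theorem IsChevalley.wtSpace_le_of_add (H : IsChevalley h e f) {S : LieSubalgebra ℂ L}
    {v w u : Fin 4 → ℤ} (hv : v ∈ roots) (hw : w ∈ roots) (hu : u ∈ roots) (hvw : v + w = u)
    (hvS : wtSpace h v ≤ S.toSubmodule) (hwS : wtSpace h w ≤ S.toSubmodule) :
    wtSpace h u ≤ S.toSubmodule := by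
  intro y hy
  obtain ⟨p, hp, hp0⟩ := H.exists_ne_zero_of_mem_roots v hv
  obtain ⟨q, hq, rfl⟩ := H.exists_lie_eq hv hw hu hvw hp hp0 hy
  exact S.lie_mem (hvS hp) (hwS hq)

theorem isGenerated_of_le (H : IsChevalley h e f) (hd : HasLabels h d a)
    (h2 : ∀ z, ⁅x, z⁆ = 0 → ⁅d, z⁆ = (2 : ℂ) • z →
      z ∈ LieSubalgebra.lieSpan ℂ L {z | ⁅x, z⁆ = 0 ∧ ⁅d, z⁆ = z})
    (h3 : ∀ v ∈ roots, 3 ≤ deg a v → wtSpace h v ≤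
      (LieSubalgebra.lieSpan ℂ L {z | ⁅x, z⁆ = 0 ∧ ⁅d, z⁆ = z}).toSubmodule) :
    IsGenerated d x := by
  obtain ⟨b, -, hb⟩ := H.exists_basis
  intro k hk z hxz hdz
  have hk' : k = 1 ∨ k = 2 ∨ 3 ≤ k := by lia
  rcases hk' with rfl | rfl | hk'
  · exact LieSubalgebra.subset_lieSpan ⟨hxz, by simpa using hdz⟩
  · exact h2 z hxz (by exact_mod_cast hdz)
  · suffices h1 : z ∈ (LieSubalgebra.lieSpan ℂ L {z | ⁅x, z⁆ = 0 ∧ ⁅d, z⁆ = z}).toSubmodule from h1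
    refine mem_of_lie_eq_smul hb hd hdz fun i hi => ?_
    have hi : deg a (idxWt i) = k := by exact_mod_cast hi
    exact h3 _ (idxWt_mem_roots (by lia) hi) (by lia) (hb i)

theorem isGenerated_of_roots (H : IsChevalley h e f) (hd : HasLabels h d a)
    {A : List (Fin 4 → ℤ)} (hA : ∀ v ∈ A, v ∈ roots ∧ deg a v = 1)
    (hAx : ∀ v ∈ A, ∀ z ∈ wtSpace h v, ⁅x, z⁆ = 0)
    (h2 : ∀ v ∈ roots, 2 ≤ deg a v → ∃ w ∈ A, v - w ∈ roots ∧
      (v - w ∈ A ∨ ∃ u ∈ A, v - w - u ∈ A)) : IsGenerated d x := by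
  obtain ⟨b, -, hb⟩ := H.exists_basis
  have hAS : ∀ v ∈ A, wtSpace h v ≤
      (LieSubalgebra.lieSpan ℂ L {z | ⁅x, z⁆ = 0 ∧ ⁅d, z⁆ = z}).toSubmodule := fun v hv z hz => by
    refine LieSubalgebra.subset_lieSpan ⟨hAx v hv z hz, ?_⟩
    rw [hd _ _ hz, (hA v hv).2, Int.cast_one, one_smul]
  have h2S : ∀ v ∈ roots, 2 ≤ deg a v → wtSpace h v ≤
      (LieSubalgebra.lieSpan ℂ L {z | ⁅x, z⁆ = 0 ∧ ⁅d, z⁆ = z}).toSubmodule := fun v hv hav => by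
    obtain ⟨w, hw, hvw, h1⟩ := h2 v hv hav
    refine H.wtSpace_le_of_add (hA w hw).1 hvw hv (add_sub_cancel w v) (hAS w hw) ?_
    rcases h1 with h1 | ⟨u, hu, h1⟩
    · exact hAS _ h1
    · exact H.wtSpace_le_of_add (hA u hu).1 (hA _ h1).1 hvw (add_sub_cancel u _) (hAS u hu)
        (hAS _ h1)
  refine isGenerated_of_le H hd (fun z _ hdz => ?_) fun v hv hav => h2S v hv (by lia)
  suffices h1 : z ∈ (LieSubalgebra.lieSpan ℂ L {z | ⁅x, z⁆ = 0 ∧ ⁅d, z⁆ = z}).toSubmodule from h1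
  refine mem_of_lie_eq_smul hb hd hdz fun i hi => ?_
  have hi : deg a (idxWt i) = 2 := by exact_mod_cast hi
  exact h2S _ (idxWt_mem_roots (by lia) hi) (by lia) (hb i)

theorem isGenerated_of_height_two (H : IsChevalley h e f) (hd : HasLabels h d a)
    (hx : ⁅d, x⁆ = (2 : ℂ) • x) (ha : ∀ v ∈ roots, deg a v ≤ 2)
    (h2 : ∀ v ∈ roots, deg a v = 2 → ∃ w ∈ roots, deg a w = 1 ∧ v - w ∈ roots) :
    IsGenerated d x := by
  obtain ⟨b, -, hb⟩ := H.exists_basis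
  refine isGenerated_of_roots H hd (A := roots.filter fun v => deg a v = 1) (fun v hv => ?_) ?_ ?_
  · simpa using hv
  · intro v hv z hz
    simp only [List.mem_filter, decide_eq_true_eq] at hv
    have hdz : ⁅d, ⁅x, z⁆⁆ = ((3 : ℤ) : ℂ) • ⁅x, z⁆ := by
      rw [lie_weight hx (hd _ _ hz), hv.2]
      norm_num
    rw [← Submodule.mem_bot ℂ]
    refine mem_of_lie_eq_smul hb hd hdz fun i hi => ?_
    have hi : deg a (idxWt i) = 3 := by exact_mod_cast hi
    exact absurd (ha _ (idxWt_mem_roots three_ne_zero hi)) (by lia)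
  · intro v hv hav
    have hav : deg a v = 2 := le_antisymm (ha v hv) hav
    obtain ⟨w, hw, haw, hvw⟩ := h2 v hv hav
    refine ⟨w, by simp [hw, haw], hvw, Or.inl ?_⟩
    simp only [List.mem_filter, decide_eq_true_eq]
    exact ⟨hvw, by rw [sub_eq_add_neg, deg_add, deg_neg]; lia⟩

theorem isGenerated_of_normalForm (H : IsChevalley h e f) {n : ℕ} {β μ : Fin n → Fin 4 → ℤ}
    (N : NormalForm a β μ) {y : L} (T : IsTriple d x y) (hd : HasLabels h d a)
    (h2 : ∀ v ∈ roots, 2 ≤ deg a v → ∃ w ∈ commRoots a β, v - w ∈ roots ∧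
      (v - w ∈ commRoots a β ∨ ∃ u ∈ commRoots a β, v - w - u ∈ commRoots a β)) :
    IsGenerated d x := by
  obtain ⟨z, hz, -, g, hgd, hgx⟩ := N.exists_lieEquiv H hd T
  refine IsGenerated.of_map g ?_
  rw [hgd, hgx]
  refine isGenerated_of_roots H hd (fun v hv => ?_) (fun v hv w hw => ?_) h2
  · simp only [commRoots, List.mem_filter, decide_eq_true_eq] at hv
    exact ⟨hv.1, hv.2.1⟩
  · simp only [commRoots, List.mem_filter, decide_eq_true_eq] at hv
    rw [sum_lie]
    refine Finset.sum_eq_zero fun i _ => H.eq_zero_of_notMem_roots (hv.2.2 i) (fun h0 => ?_)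
      (lie_mem_wtSpace (hz i) hw)
    have := congrArg (deg a) h0
    rw [deg_add, N.deg_eq, hv.2.1, deg_zero] at this
    lia

end Generation

theorem normalForm_two : NormalForm ![0, 0, 1, 0] ![![0, 2, 2, 1], ![2, 3, 2, 1]]
    ![![-1, 0, 1, 0], ![1, 0, 0, 0]] where
  mem := by decide +kernel
  deg_eq := by decide +kernel
  deg_self := by decide +kernel
  deg_ne := by decide +kernel
  cases := by decide +kernel

theorem normalForm_three : NormalForm ![0, 1, 0, 0]
    ![![2, 2, 2, 1], ![1, 2, 1, 1], ![0, 2, 1, 0]]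
    ![![1, 0, 0, -1], ![1, 0, 0, -2], ![1, 0, -1, 0]] where
  mem := by decide +kernel
  deg_eq := by decide +kernel
  deg_self := by decide +kernel
  deg_ne := by decide +kernel
  cases := by decide +kernel

theorem exists_sub_mem_roots : ∀ a ∈ [![0, 0, 0, 0], ![1, 0, 0, 0], ![0, 0, 0, 1]],
    (∀ v ∈ roots, deg a v ≤ 2) ∧
      ∀ v ∈ roots, deg a v = 2 → ∃ w ∈ roots, deg a w = 1 ∧ v - w ∈ roots := by
  decide +kernel

theorem exists_sub_mem_commRoots : ∀ v ∈ roots, 2 ≤ deg ![0, 0, 1, 0] v →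
    ∃ w ∈ commRoots ![0, 0, 1, 0] ![![0, 2, 2, 1], ![2, 3, 2, 1]], v - w ∈ roots ∧
      (v - w ∈ commRoots ![0, 0, 1, 0] ![![0, 2, 2, 1], ![2, 3, 2, 1]] ∨
        ∃ u ∈ commRoots ![0, 0, 1, 0] ![![0, 2, 2, 1], ![2, 3, 2, 1]],
          v - w - u ∈ commRoots ![0, 0, 1, 0] ![![0, 2, 2, 1], ![2, 3, 2, 1]]) := by
  decide +kernel

section Linked

variable {L : Type*} [LieRing L] [LieAlgebra ℂ L] {h e f : Fin 4 → L}

/-- Modulo the subalgebra `S`, the root space of `v` is contained in the root space of `w`. -/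
def Linked (h : Fin 4 → L) (S : LieSubalgebra ℂ L) (v w : Fin 4 → ℤ) : Prop :=
  ∀ p ∈ wtSpace h v, ∃ q ∈ wtSpace h w, p + q ∈ S

variable {S : LieSubalgebra ℂ L} {v w u s t : Fin 4 → ℤ}

theorem Linked.wtSpace_le (hl : Linked h S v w) (H : IsChevalley h e f) (hw : w ∉ roots)
    (hw0 : w ≠ 0) : wtSpace h v ≤ S.toSubmodule := by
  intro p hp
  obtain ⟨q, hq, hpq⟩ := hl p hp
  rwa [H.eq_zero_of_notMem_roots hw hw0 hq, add_zero] at hpq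

theorem Linked.lie [Nontrivial L] (hl : Linked h S v w) (H : IsChevalley h e f)
    (hu : wtSpace h u ≤ S.toSubmodule) (hur : u ∈ roots) (hvr : v ∈ roots) (hsr : s ∈ roots)
    (hs : u + v = s) (ht : u + w = t) : Linked h S s t := by
  intro p hp
  obtain ⟨c, hc, hc0⟩ := H.exists_ne_zero_of_mem_roots u hur
  obtain ⟨r, hr, rfl⟩ := H.exists_lie_eq hur hvr hsr hs hc hc0 hp
  obtain ⟨q, hq, hrq⟩ := hl r hr
  exact ⟨⁅c, q⁆, ht ▸ lie_mem_wtSpace hc hq, by rw [← lie_add]; exact S.lie_mem (hu hc) hrq⟩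

variable {n : ℕ} {β : Fin n → Fin 4 → ℤ} {z : Fin n → L}

theorem sum_lie_eq_of_notMem_roots (H : IsChevalley h e f) (hz : ∀ i, z i ∈ wtSpace h (β i))
    (j : Fin n) (hv : ∀ i, i ≠ j → β i + v ∉ roots ∧ β i + v ≠ 0) {p : L} (hp : p ∈ wtSpace h v) :
    ⁅∑ i, z i, p⁆ = ⁅z j, p⁆ := by
  rw [sum_lie, Finset.sum_eq_single j]
  · exact fun i _ hi => H.eq_zero_of_notMem_roots (hv i hi).1 (hv i hi).2 (lie_mem_wtSpace (hz i) hp)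
  · simp

theorem linked_of_add_eq_add [Nontrivial L] (H : IsChevalley h e f)
    (hz : ∀ i, z i ∈ wtSpace h (β i)) (hz0 : ∀ i, z i ≠ 0) (hβ : ∀ i, β i ∈ roots) {d : L}
    {a : Fin 4 → ℤ} (hd : HasLabels h d a) (hv1 : deg a v = 1) (hw1 : deg a w = 1) (i j : Fin n)
    (hv : ∀ l, l ≠ i → β l + v ∉ roots ∧ β l + v ≠ 0)
    (hw : ∀ l, l ≠ j → β l + w ∉ roots ∧ β l + w ≠ 0) (hwr : w ∈ roots) (hur : β j + w ∈ roots)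
    (hvw : β i + v = β j + w) :
    Linked h (LieSubalgebra.lieSpan ℂ L {y | ⁅∑ i, z i, y⁆ = 0 ∧ ⁅d, y⁆ = y}) v w := by
  intro p hp
  have h1 : -⁅z i, p⁆ ∈ wtSpace h (β j + w) :=
    Submodule.neg_mem _ (hvw ▸ lie_mem_wtSpace (hz i) hp)
  obtain ⟨q, hq, hzq⟩ := H.exists_lie_eq (hβ j) hwr hur rfl (hz j) (hz0 j) h1
  refine ⟨q, hq, LieSubalgebra.subset_lieSpan ⟨?_, ?_⟩⟩
  · rw [lie_add, sum_lie_eq_of_notMem_roots H hz i hv hp, sum_lie_eq_of_notMem_roots H hz j hw hq,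
      hzq, add_neg_cancel]
  · rw [lie_add, hd _ _ hp, hd _ _ hq, hv1, hw1, Int.cast_one, one_smul, one_smul]

theorem wtSpace_le_of_notMem_roots (H : IsChevalley h e f)
    (hz : ∀ i, z i ∈ wtSpace h (β i)) {d : L}
    {a : Fin 4 → ℤ} (hd : HasLabels h d a) (hv1 : deg a v = 1)
    (hv : ∀ l, β l + v ∉ roots ∧ β l + v ≠ 0) :
    wtSpace h v ≤
      (LieSubalgebra.lieSpan ℂ L {y | ⁅∑ i, z i, y⁆ = 0 ∧ ⁅d, y⁆ = y}).toSubmodule := by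
  intro p hp
  refine LieSubalgebra.subset_lieSpan ⟨?_, ?_⟩
  · rw [sum_lie]
    exact Finset.sum_eq_zero fun i _ =>
      H.eq_zero_of_notMem_roots (hv i).1 (hv i).2 (lie_mem_wtSpace (hz i) hp)
  · rw [hd _ _ hp, hv1, Int.cast_one, one_smul]

theorem lie_eq_zero_of_mem_lieSpan {d x y : L}
    (hy : y ∈ LieSubalgebra.lieSpan ℂ L {y | ⁅x, y⁆ = 0 ∧ ⁅d, y⁆ = y}) : ⁅x, y⁆ = 0 := by
  let C : LieSubalgebra ℂ L :=
    { (LieAlgebra.ad ℂ L x).ker with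
      lie_mem' := fun {u v} hu hv => by
        change ⁅x, ⁅u, v⁆⁆ = 0
        have hu : ⁅x, u⁆ = 0 := hu
        have hv : ⁅x, v⁆ = 0 := hv
        rw [leibniz_lie, hu, hv, zero_lie, lie_zero, add_zero] }
  have h1 : LieSubalgebra.lieSpan ℂ L {y | ⁅x, y⁆ = 0 ∧ ⁅d, y⁆ = y} ≤ C :=
    LieSubalgebra.lieSpan_le.2 fun w hw => hw.1
  exact h1 hy

theorem eq_zero_of_add_add_eq_zero [Nontrivial L] (H : IsChevalley h e f) {p q r : L}
    (hp : p ∈ wtSpace h v) (hq : q ∈ wtSpace h w) (hr : r ∈ wtSpace h u) (hvw : v ≠ w)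
    (hvu : v ≠ u) (h0 : p + q + r = 0) : p = 0 := by
  obtain ⟨b, -, hb⟩ := H.exists_basis
  refine b.ext_elem fun i => ?_
  rw [map_zero, Finsupp.zero_apply]
  by_cases hi : idxWt i = v
  · have h1 := congrArg (fun y => b.repr y i) h0
    simpa [repr_eq_zero_of_mem_wtSpace hb hq (hi.trans_ne hvw),
      repr_eq_zero_of_mem_wtSpace hb hr (hi.trans_ne hvu)] using h1
  · exact repr_eq_zero_of_mem_wtSpace hb hp hi

end Linked

section HeightFour

variable {L : Type*} [LieRing L] [LieAlgebra ℂ L] [Nontrivial L] {h e f : Fin 4 → L}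

theorem isGenerated_sum_three (H : IsChevalley h e f) {d : L} (hd : HasLabels h d ![0, 1, 0, 0])
    {z : Fin 3 → L}
    (hz : ∀ i, z i ∈ wtSpace h (![![2, 2, 2, 1], ![1, 2, 1, 1], ![0, 2, 1, 0]] i))
    (hz0 : ∀ i, z i ≠ 0) : IsGenerated d (∑ i, z i) := by
  obtain ⟨b, -, hb⟩ := H.exists_basis
  let S := LieSubalgebra.lieSpan ℂ L {y | ⁅∑ i, z i, y⁆ = 0 ∧ ⁅d, y⁆ = y}
  have r : ∀ i, ![![2, 2, 2, 1], ![1, 2, 1, 1], ![0, 2, 1, 0]] i ∈ roots := normalForm_three.mem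
  have g₁ : wtSpace h ![1, 1, 0, 0] ≤ S.toSubmodule :=
    wtSpace_le_of_notMem_roots H hz hd (by decide +kernel) (by decide +kernel)
  have g₂ : wtSpace h ![0, 1, 1, 1] ≤ S.toSubmodule :=
    wtSpace_le_of_notMem_roots H hz hd (by decide +kernel) (by decide +kernel)
  have l₁ : Linked h S ![0, 1, 0, 0] ![1, 1, 1, 0] :=
    linked_of_add_eq_add H hz hz0 r hd (by decide +kernel) (by decide +kernel) 0 1
      (by decide +kernel) (by decide +kernel) (by decide +kernel) (by decide +kernel)
      (by decide +kernel)
  have l₂ : Linked h S ![1, 1, 1, 0] ![0, 1, 0, 0] :=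
    linked_of_add_eq_add H hz hz0 r hd (by decide +kernel) (by decide +kernel) 1 0
      (by decide +kernel) (by decide +kernel) (by decide +kernel) (by decide +kernel)
      (by decide +kernel)
  have l₃ : Linked h S ![0, 1, 1, 0] ![1, 1, 1, 1] :=
    linked_of_add_eq_add H hz hz0 r hd (by decide +kernel) (by decide +kernel) 1 2
      (by decide +kernel) (by decide +kernel) (by decide +kernel) (by decide +kernel)
      (by decide +kernel)
  have l₄ : Linked h S ![1, 1, 1, 1] ![0, 1, 1, 0] :=
    linked_of_add_eq_add H hz hz0 r hd (by decide +kernel) (by decide +kernel) 2 1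
      (by decide +kernel) (by decide +kernel) (by decide +kernel) (by decide +kernel)
      (by decide +kernel)
  have k₁ : wtSpace h ![1, 2, 1, 1] ≤ S.toSubmodule :=
    H.wtSpace_le_of_add (v := ![1, 1, 0, 0]) (w := ![0, 1, 1, 1]) (by decide +kernel)
      (by decide +kernel) (by decide +kernel) (by decide +kernel) g₁ g₂
  have k₂ : wtSpace h ![2, 2, 1, 0] ≤ S.toSubmodule :=
    (l₂.lie (s := ![2, 2, 1, 0]) H g₁ (by decide +kernel) (by decide +kernel) (by decide +kernel)
      (by decide +kernel) rfl).wtSpace_le H (by decide +kernel) (by decide +kernel)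
  have k₃ : wtSpace h ![0, 2, 2, 1] ≤ S.toSubmodule :=
    (l₃.lie (s := ![0, 2, 2, 1]) H g₂ (by decide +kernel) (by decide +kernel) (by decide +kernel)
      (by decide +kernel) rfl).wtSpace_le H (by decide +kernel) (by decide +kernel)
  have m₁ : Linked h S ![1, 2, 1, 0] ![2, 2, 1, 1] :=
    l₃.lie H g₁ (by decide +kernel) (by decide +kernel) (by decide +kernel) (by decide +kernel)
      (by decide +kernel)
  have m₂ : Linked h S ![0, 2, 1, 1] ![1, 2, 2, 1] :=
    l₁.lie H g₂ (by decide +kernel) (by decide +kernel) (by decide +kernel) (by decide +kernel)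
      (by decide +kernel)
  have m₃ : Linked h S ![1, 2, 2, 1] ![0, 2, 1, 1] :=
    l₂.lie H g₂ (by decide +kernel) (by decide +kernel) (by decide +kernel) (by decide +kernel)
      (by decide +kernel)
  let W := S.toSubmodule ⊔ (wtSpace h ![2, 2, 2, 1] ⊔ wtSpace h ![2, 2, 1, 1] ⊔
    wtSpace h ![1, 2, 2, 1])
  have W₀ : S.toSubmodule ≤ W := le_sup_left
  have W₁ : wtSpace h ![2, 2, 2, 1] ≤ W := (le_sup_left.trans le_sup_left).trans le_sup_right
  have W₂ : wtSpace h ![2, 2, 1, 1] ≤ W := (le_sup_right.trans le_sup_left).trans le_sup_right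
  have W₃ : wtSpace h ![1, 2, 2, 1] ≤ W := le_sup_right.trans le_sup_right
  have hlink : ∀ v w, Linked h S v w → wtSpace h w ≤ W → wtSpace h v ≤ W := by
    intro v w hl hw p hp
    obtain ⟨q, hq, hpq⟩ := hl p hp
    have := W.sub_mem (W₀ hpq) (hw hq)
    rwa [add_sub_cancel_right] at this
  have hlast : wtSpace h ![0, 2, 1, 0] ≤ W := by
    intro y hy
    obtain ⟨p, hp, hp0⟩ := H.exists_ne_zero_of_mem_roots ![0, 1, 0, 0] (by decide +kernel)
    obtain ⟨q, hq, rfl⟩ := H.exists_lie_eq (w := ![0, 1, 1, 0]) (by decide +kernel)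
      (by decide +kernel) (by decide +kernel) (by decide +kernel) hp hp0 hy
    obtain ⟨p', hp', hpS⟩ := l₁ p hp
    obtain ⟨q', hq', hqS⟩ := l₃ q hq
    have h1 : ⁅p, q'⁆ ∈ wtSpace h ![1, 2, 1, 1] := by
      rw [show ![1, 2, 1, 1] = ![0, 1, 0, 0] + ![1, 1, 1, (1 : ℤ)] by decide +kernel]
      exact lie_mem_wtSpace hp hq'
    have h2 : ⁅p', q⁆ = 0 := H.eq_zero_of_notMem_roots (by decide +kernel) (by decide +kernel)
      (lie_mem_wtSpace hp' hq)
    have h3 : ⁅p', q'⁆ ∈ wtSpace h ![2, 2, 2, 1] := by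
      rw [show ![2, 2, 2, 1] = ![1, 1, 1, 0] + ![1, 1, 1, (1 : ℤ)] by decide +kernel]
      exact lie_mem_wtSpace hp' hq'
    have h4 : ⁅p, q⁆ = ⁅p + p', q + q'⁆ - ⁅p, q'⁆ - ⁅p', q'⁆ := by
      rw [add_lie, lie_add, lie_add, h2]
      abel
    rw [h4]
    exact W.sub_mem (W.sub_mem (W₀ (S.lie_mem hpS hqS)) (W₀ (k₁ h1))) (W₁ h3)
  have hW : ∀ y : L, ⁅d, y⁆ = (2 : ℂ) • y → y ∈ W := by
    intro y hy
    refine mem_of_lie_eq_smul hb hd hy fun i hi => ?_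
    have hi : deg ![0, 1, 0, 0] (idxWt i) = 2 := by exact_mod_cast hi
    have hcases : ∀ v ∈ roots, deg ![0, 1, 0, 0] v = 2 → v ∈ [![2, 2, 2, 1], ![2, 2, 1, 1],
        ![2, 2, 1, 0], ![1, 2, 2, 1], ![1, 2, 1, 1], ![1, 2, 1, 0], ![0, 2, 2, 1],
        ![0, 2, 1, 1], ![0, 2, 1, 0]] := by decide +kernel
    have hv := hcases _ (idxWt_mem_roots two_ne_zero hi) hi
    have hbi := hb i
    generalize idxWt i = v at hv hbi
    simp only [List.mem_cons, List.not_mem_nil, or_false] at hv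
    rcases hv with rfl | rfl | rfl | rfl | rfl | rfl | rfl | rfl | rfl
    · exact W₁ hbi
    · exact W₂ hbi
    · exact W₀ (k₂ hbi)
    · exact W₃ hbi
    · exact W₀ (k₁ hbi)
    · exact hlink _ _ m₁ W₂ hbi
    · exact W₀ (k₃ hbi)
    · exact hlink _ _ m₂ W₃ hbi
    · exact hlast hbi
  refine isGenerated_of_le H hd (fun y hxy hdy => ?_) fun v hv hav => ?_
  · obtain ⟨s, hs, t, ht, rfl⟩ := Submodule.mem_sup.1 (hW y hdy)
    obtain ⟨p, hp, r₃, hr₃, rfl⟩ := Submodule.mem_sup.1 ht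
    obtain ⟨r₁, hr₁, r₂, hr₂, rfl⟩ := Submodule.mem_sup.1 hp
    have hsum : ⁅z 2, r₁⁆ + ⁅z 2, r₂⁆ + ⁅z 1, r₃⁆ = 0 := by
      rw [lie_add, lie_eq_zero_of_mem_lieSpan hs, zero_add, lie_add, lie_add,
        sum_lie_eq_of_notMem_roots H hz 2 (by decide +kernel) hr₁,
        sum_lie_eq_of_notMem_roots H hz 2 (by decide +kernel) hr₂,
        sum_lie_eq_of_notMem_roots H hz 1 (by decide +kernel) hr₃] at hxy
      exact hxy
    have h₁ := lie_mem_wtSpace (hz 2) hr₁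
    have h₂ := lie_mem_wtSpace (hz 2) hr₂
    have h₃ := lie_mem_wtSpace (hz 1) hr₃
    have e₁ : r₁ = 0 := by
      by_contra h0
      exact H.lie_ne_zero _ (r 2) _ (by decide +kernel) (by decide +kernel) _ (hz 2) _ hr₁ (hz0 2)
        h0 (eq_zero_of_add_add_eq_zero H h₁ h₂ h₃ (by decide +kernel) (by decide +kernel) hsum)
    have e₂ : r₂ = 0 := by
      by_contra h0
      exact H.lie_ne_zero _ (r 2) _ (by decide +kernel) (by decide +kernel) _ (hz 2) _ hr₂ (hz0 2)
        h0 (eq_zero_of_add_add_eq_zero H h₂ h₁ h₃ (by decide +kernel) (by decide +kernel)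
          (by rw [← hsum]; abel))
    have e₃ : r₃ = 0 := by
      by_contra h0
      exact H.lie_ne_zero _ (r 1) _ (by decide +kernel) (by decide +kernel) _ (hz 1) _ hr₃ (hz0 1)
        h0 (eq_zero_of_add_add_eq_zero H h₃ h₁ h₂ (by decide +kernel) (by decide +kernel)
          (by rw [← hsum]; abel))
    rw [e₁, e₂, e₃, add_zero, add_zero, add_zero]
    exact hs
  · have hcases : ∀ v ∈ roots, 3 ≤ deg ![0, 1, 0, 0] v → v ∈ [![1, 3, 2, 1], ![2, 3, 2, 1],
        ![2, 4, 2, 1], ![2, 4, 3, 1], ![2, 4, 3, 2]] := by decide +kernel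
    have hv := hcases v hv hav
    simp only [List.mem_cons, List.not_mem_nil, or_false] at hv
    rcases hv with rfl | rfl | rfl | rfl | rfl
    · exact H.wtSpace_le_of_add (v := ![1, 1, 0, 0]) (w := ![0, 2, 2, 1]) (by decide +kernel)
        (by decide +kernel) (by decide +kernel) (by decide +kernel) g₁ k₃
    · exact H.wtSpace_le_of_add (v := ![0, 1, 1, 1]) (w := ![2, 2, 1, 0]) (by decide +kernel)
        (by decide +kernel) (by decide +kernel) (by decide +kernel) g₂ k₂
    · exact (m₁.lie H k₁ (by decide +kernel) (by decide +kernel) (by decide +kernel)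
        (by decide +kernel) rfl).wtSpace_le H (by decide +kernel) (by decide +kernel)
    · exact H.wtSpace_le_of_add (v := ![0, 2, 2, 1]) (w := ![2, 2, 1, 0]) (by decide +kernel)
        (by decide +kernel) (by decide +kernel) (by decide +kernel) k₃ k₂
    · exact (m₃.lie H k₁ (by decide +kernel) (by decide +kernel) (by decide +kernel)
        (by decide +kernel) rfl).wtSpace_le H (by decide +kernel) (by decide +kernel)

end HeightFour

section Derived

variable {L : Type*} [LieRing L] [LieAlgebra ℂ L]

/-- The sum of the eigenspaces of `ad d` for the integers which are at least `k`. -/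
def filtration (d : L) (k : ℤ) : Submodule ℂ L :=
  Submodule.span ℂ {y | ∃ j : ℤ, k ≤ j ∧ ⁅d, y⁆ = (j : ℂ) • y}

theorem lie_mem_filtration {d : L} {j k l : ℤ} (hl : l ≤ j + k) {y z : L}
    (hy : y ∈ filtration d j) (hz : z ∈ filtration d k) : ⁅y, z⁆ ∈ filtration d l := by
  induction hy, hz using Submodule.span_induction₂ with
  | mem_mem y z hy hz =>
    obtain ⟨m, hm, hy⟩ := hy
    obtain ⟨n, hn, hz⟩ := hz
    refine Submodule.subset_span ⟨m + n, by lia, ?_⟩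
    rw [lie_weight hy hz, Int.cast_add]
  | zero_left z hz => simp
  | zero_right y hy => simp
  | add_left y y' z _ _ _ h1 h2 => rw [add_lie]; exact Submodule.add_mem _ h1 h2
  | add_right y z z' _ _ _ h1 h2 => rw [lie_add]; exact Submodule.add_mem _ h1 h2
  | smul_left c y z _ _ h1 => rw [smul_lie]; exact Submodule.smul_mem _ c h1
  | smul_right c y z _ _ h1 => rw [lie_smul]; exact Submodule.smul_mem _ c h1

/-- The part of degree one of the centralizer of `x`. -/
def centOne (d x : L) : Submodule ℂ L := (LieAlgebra.ad ℂ L x).ker ⊓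
  Module.End.eigenspace (LieAlgebra.ad ℂ L d) 1

theorem mem_centOne {d x y : L} : y ∈ centOne d x ↔ ⁅x, y⁆ = 0 ∧ ⁅d, y⁆ = y := by
  rw [centOne, Submodule.mem_inf, Module.End.mem_eigenspace_iff, one_smul]
  rfl

theorem lie_mem_sup_filtration {d : L} {U V : Submodule ℂ L} (h₁ : U ≤ filtration d 1)
    (h₂ : V ≤ filtration d 2) (hUV : ∀ u ∈ U, ∀ v ∈ U, ⁅u, v⁆ ∈ V) {y z : L}
    (hy : y ∈ U ⊔ V ⊔ filtration d 3) (hz : z ∈ U ⊔ V ⊔ filtration d 3) :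
    ⁅y, z⁆ ∈ U ⊔ V ⊔ filtration d 3 := by
  obtain ⟨p, hp, y₃, hy₃, rfl⟩ := Submodule.mem_sup.1 hy
  obtain ⟨y₁, hy₁, y₂, hy₂, rfl⟩ := Submodule.mem_sup.1 hp
  obtain ⟨q, hq, z₃, hz₃, rfl⟩ := Submodule.mem_sup.1 hz
  obtain ⟨z₁, hz₁, z₂, hz₂, rfl⟩ := Submodule.mem_sup.1 hq
  have e : ⁅y₁ + y₂ + y₃, z₁ + z₂ + z₃⁆ = ⁅y₁, z₁⁆ + (⁅y₁, z₂⁆ + ⁅y₁, z₃⁆ + ⁅y₂, z₁⁆ +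
      ⁅y₂, z₂⁆ + ⁅y₂, z₃⁆ + ⁅y₃, z₁⁆ + ⁅y₃, z₂⁆ + ⁅y₃, z₃⁆) := by
    simp only [add_lie, lie_add]
    abel
  rw [e]
  refine Submodule.add_mem_sup (Submodule.mem_sup_right (hUV _ hy₁ _ hz₁)) ?_
  have hy₁ := h₁ hy₁
  have hz₁ := h₁ hz₁
  have hy₂ := h₂ hy₂
  have hz₂ := h₂ hz₂
  exact add_mem (add_mem (add_mem (add_mem (add_mem (add_mem (add_mem
    (lie_mem_filtration (by norm_num) hy₁ hz₂) (lie_mem_filtration (by norm_num) hy₁ hz₃))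
    (lie_mem_filtration (by norm_num) hy₂ hz₁)) (lie_mem_filtration (by norm_num) hy₂ hz₂))
    (lie_mem_filtration (by norm_num) hy₂ hz₃)) (lie_mem_filtration (by norm_num) hy₃ hz₁))
    (lie_mem_filtration (by norm_num) hy₃ hz₂)) (lie_mem_filtration (by norm_num) hy₃ hz₃)

theorem lieSpan_centOne_le (d x : L) :
    (LieSubalgebra.lieSpan ℂ L {y | ⁅x, y⁆ = 0 ∧ ⁅d, y⁆ = y}).toSubmodule ≤
      centOne d x ⊔ Submodule.span ℂ {z | ∃ u ∈ centOne d x, ∃ v ∈ centOne d x, ⁅u, v⁆ = z} ⊔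
        filtration d 3 := by
  have h₁ : centOne d x ≤ filtration d 1 := fun y hy =>
    Submodule.subset_span ⟨1, le_rfl, by rw [(mem_centOne.1 hy).2, Int.cast_one, one_smul]⟩
  have h₂ : Submodule.span ℂ {z | ∃ u ∈ centOne d x, ∃ v ∈ centOne d x, ⁅u, v⁆ = z} ≤
      filtration d 2 := by
    refine Submodule.span_le.2 ?_
    rintro _ ⟨u, hu, v, hv, rfl⟩
    exact lie_mem_filtration (by norm_num) (h₁ hu) (h₁ hv)
  have hUV : ∀ u ∈ centOne d x, ∀ v ∈ centOne d x, ⁅u, v⁆ ∈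
      Submodule.span ℂ {z | ∃ u ∈ centOne d x, ∃ v ∈ centOne d x, ⁅u, v⁆ = z} :=
    fun u hu v hv => Submodule.subset_span ⟨u, hu, v, hv, rfl⟩
  let U : LieSubalgebra ℂ L :=
    ⟨centOne d x ⊔ Submodule.span ℂ {z | ∃ u ∈ centOne d x, ∃ v ∈ centOne d x, ⁅u, v⁆ = z} ⊔
      filtration d 3, fun hy hz => lie_mem_sup_filtration h₁ h₂ hUV hy hz⟩
  have h3 : LieSubalgebra.lieSpan ℂ L {y | ⁅x, y⁆ = 0 ∧ ⁅d, y⁆ = y} ≤ U :=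
    LieSubalgebra.lieSpan_le.2 fun w hw =>
      Submodule.mem_sup_left (Submodule.mem_sup_left (mem_centOne.2 hw))
  exact h3

theorem IsGenerated.mem_span {d x : L} (hg : IsGenerated d x) (hdx : ⁅d, x⁆ = (2 : ℂ) • x) :
    x ∈ Submodule.span ℂ {z | ∃ u ∈ (LieAlgebra.ad ℂ L x).ker,
      ∃ v ∈ (LieAlgebra.ad ℂ L x).ker, ⁅u, v⁆ = z} := by
  have h1 := lieSpan_centOne_le d x (hg 2 (by norm_num) x (lie_self x) (by exact_mod_cast hdx))
  obtain ⟨p, hp, q, hq, hpq⟩ := Submodule.mem_sup.1 h1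
  obtain ⟨u, hu, v, hv, rfl⟩ := Submodule.mem_sup.1 hp
  let E := Module.End.eigenspace (LieAlgebra.ad ℂ L d)
  have hvE : v ∈ E 2 := by
    refine Submodule.span_le.2 ?_ hv
    rintro _ ⟨y, hy, z, hz, rfl⟩
    rw [mem_centOne, ← one_smul ℂ ⁅d, _⁆] at hy hz
    refine Module.End.mem_eigenspace_iff.2 ?_
    change ⁅d, ⁅y, z⁆⁆ = _
    rw [lie_weight (a := 1) (b := 1) (by simpa using hy.2) (by simpa using hz.2)]
    norm_num
  have hxE : x ∈ E 2 := Module.End.mem_eigenspace_iff.2 hdx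
  have hother : u + q ∈ ⨆ j, ⨆ (_ : j ≠ 2), E j := by
    refine Submodule.add_mem _ ?_ ?_
    · exact Submodule.mem_iSup_of_mem 1 (Submodule.mem_iSup_of_mem (by norm_num) hu.2)
    · refine Submodule.span_le.2 ?_ hq
      rintro y ⟨j, hj, hy⟩
      refine Submodule.mem_iSup_of_mem (j : ℂ) (Submodule.mem_iSup_of_mem ?_
        (Module.End.mem_eigenspace_iff.2 hy))
      have : j ≠ 2 := by lia
      exact_mod_cast this
  have h0 : x - v = 0 := by
    refine Submodule.disjoint_def.1 (Module.End.eigenspaces_iSupIndep (LieAlgebra.ad ℂ L d) 2) _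
      (Submodule.sub_mem _ hxE hvE) ?_
    rwa [show x - v = u + q by rw [← hpq]; abel]
  suffices h2 : ∀ w, w = v → w ∈ Submodule.span ℂ {z | ∃ u ∈ (LieAlgebra.ad ℂ L x).ker,
      ∃ v ∈ (LieAlgebra.ad ℂ L x).ker, ⁅u, v⁆ = z} from h2 x (sub_eq_zero.1 h0)
  rintro _ rfl
  refine Submodule.span_mono ?_ hv
  rintro _ ⟨y, hy, z, hz, rfl⟩
  exact ⟨y, hy.1, z, hz.1, rfl⟩

end Derived

section Conclusion

variable {L : Type*} [LieRing L] [LieAlgebra ℂ L]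

theorem mem_span_map {x : L} (g : L ≃ₗ⁅ℂ⁆ L)
    (hx : x ∈ Submodule.span ℂ {z | ∃ u ∈ (LieAlgebra.ad ℂ L x).ker,
      ∃ v ∈ (LieAlgebra.ad ℂ L x).ker, ⁅u, v⁆ = z}) :
    g x ∈ Submodule.span ℂ {z | ∃ u ∈ (LieAlgebra.ad ℂ L (g x)).ker,
      ∃ v ∈ (LieAlgebra.ad ℂ L (g x)).ker, ⁅u, v⁆ = z} := by
  have hker : ∀ u ∈ (LieAlgebra.ad ℂ L x).ker, g u ∈ (LieAlgebra.ad ℂ L (g x)).ker := by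
    intro u hu
    have hu : ⁅x, u⁆ = 0 := hu
    change ⁅g x, g u⁆ = 0
    rw [← LieEquiv.map_lie, hu, map_zero]
  have h1 := Submodule.mem_map_of_mem (f := (g : L →ₗ[ℂ] L)) hx
  rw [Submodule.map_span] at h1
  refine Submodule.span_mono ?_ h1
  rintro _ ⟨_, ⟨u, hu, v, hv, rfl⟩, rfl⟩
  exact ⟨g u, hker u hu, g v, hker v hv, (g.map_lie u v).symm⟩

variable {h e f : Fin 4 → L} {d x y : L}

theorem IsChevalley.exists_dominant_labels [Nontrivial L] (H : IsChevalley h e f)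
    (T : IsTriple d x y) :
    ∃ (g : L ≃ₗ⁅ℂ⁆ L) (a : Fin 4 → ℤ), (∀ i, 0 ≤ a i ∧ a i ≤ 2) ∧ HasLabels h (g d) a := by
  obtain ⟨g₁, hg₁⟩ := H.exists_lieEquiv_mem_zero T
  obtain ⟨a, ha⟩ := H.exists_hasLabels_of_mem_zero (T.map g₁) hg₁
  obtain ⟨g₂, a', ha', hlab⟩ := H.exists_dominant _ _ a ha le_rfl
  exact ⟨g₁.trans g₂, a', fun i => ⟨ha' i, H.label_le_two ((T.map g₁).map g₂) ha' hlab i⟩, hlab⟩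

theorem IsChevalley.isGenerated_of_mem_span [Nontrivial L] (H : IsChevalley h e f)
    (T : IsTriple d x y)
    (hx : x ∈ Submodule.span ℂ {z | ∃ u ∈ (LieAlgebra.ad ℂ L x).ker,
      ∃ v ∈ (LieAlgebra.ad ℂ L x).ker, ⁅u, v⁆ = z}) : IsGenerated d x := by
  obtain ⟨g, a, ha, hd⟩ := H.exists_dominant_labels T
  refine IsGenerated.of_map g ?_
  replace T := T.map g
  replace hx := mem_span_map g hx
  generalize g d = d at hd T ⊢
  generalize g x = x at hx T ⊢
  have := H.finiteDimensional
  obtain ⟨b, -, hb⟩ := H.exists_basis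
  have hcases := labels_of_mem_span hb hd T ha hx
  simp only [List.mem_cons, List.not_mem_nil, or_false] at hcases
  rcases hcases with rfl | rfl | rfl | rfl | rfl
  · obtain ⟨h1, h2⟩ := exists_sub_mem_roots _ (by simp : ![0, 0, 0, (0 : ℤ)] ∈ _)
    exact isGenerated_of_height_two H hd T.dx h1 h2
  · obtain ⟨h1, h2⟩ := exists_sub_mem_roots _ (by simp : ![1, 0, 0, (0 : ℤ)] ∈ _)
    exact isGenerated_of_height_two H hd T.dx h1 h2
  · obtain ⟨h1, h2⟩ := exists_sub_mem_roots _ (by simp : ![0, 0, 0, (1 : ℤ)] ∈ _)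
    exact isGenerated_of_height_two H hd T.dx h1 h2
  · exact isGenerated_of_normalForm H normalForm_two T hd exists_sub_mem_commRoots
  · obtain ⟨z, hz, hz0, g', hgd, hgx⟩ := normalForm_three.exists_lieEquiv H hd T
    refine IsGenerated.of_map g' ?_
    rw [hgd, hgx]
    exact isGenerated_sum_three H hd hz hz0

end Conclusion

/-- Panyushev property for the simple Lie algebra of type F4:
`e` is reachable iff the Lie subalgebra generated by `g(1)_e` contains every `g(k)_e`, `k ≥ 1`. -/
theorem panyushev_property_F4 (h e f : LieAlgebra.f₄ ℂ)
    (hhe : ⁅h, e⁆ = (2 : ℂ) • e) (hhf : ⁅h, f⁆ = (-2 : ℂ) • f) (hef : ⁅e, f⁆ = h) :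
    e ∈ derived e ↔
      ∀ k : ℤ, 1 ≤ k → ∀ x : LieAlgebra.f₄ ℂ, ⁅e, x⁆ = 0 → ⁅h, x⁆ = (k : ℂ) • x →
        x ∈ LieSubalgebra.lieSpan ℂ (LieAlgebra.f₄ ℂ)
            {x : LieAlgebra.f₄ ℂ | ⁅e, x⁆ = 0 ∧ ⁅h, x⁆ = x} := by
  obtain ⟨h₀, e₀, f₀, H⟩ := exists_isChevalley_f₄
  rcases subsingleton_or_nontrivial (LieAlgebra.f₄ ℂ) with hs | hn
  · have h0 : ∀ x : LieAlgebra.f₄ ℂ, x = 0 := fun x => Subsingleton.elim x 0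
    refine ⟨fun _ k _ x _ _ => ?_, fun _ => ?_⟩
    · rw [h0 x]
      exact zero_mem _
    · rw [h0 e]
      exact zero_mem _
  · exact ⟨fun he => H.isGenerated_of_mem_span ⟨hhe, hhf, hef⟩ he,
      fun hg => IsGenerated.mem_span hg hhe⟩
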